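/- arXiv:2404.14166 — 5 statements merged into one kernel-verified Lean document; each statement's English description precedes it below -/
import Mathlib

section
/- Given a set S of matrices in matr and a matrix N ∈ matr, one has S ⇒_lex N (i.e., every finitely complete category with S-closed relations has N-closed relations) if and only if there is a finite subset S' ⊆ S such that S' ⇒_lex N. Analogously, given a set S of pointed matrices in matr_* and a matrix N ∈ matr_*, one has S ⇒_{lex*} N (i.e., every finitely complete pointed category with S-closed relations has N-closed relations) if and only if there is a finite subset S' ⊆ S such that S' ⇒_{lex*} N. -/
open CategoryTheory CategoryTheory.Limits

universe w v u

/-- A (non-pointed) extended matrix `M ∈ matr(n,m,k)`: `n > 0` rows, `m` left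
columns and one right column, with entries in `{x₁, …, x_k}` (modelled as
`Fin k`). `matr` is the union over all `n,m,k`, i.e. the type `Matr`. -/
structure Matr where
  n : ℕ
  m : ℕ
  k : ℕ
  npos : 0 < n
  left : Fin n → Fin m → Fin k
  right : Fin n → Fin k

namespace Matr

variable {C : Type u} [Category.{v} C]

/-- A relation `r : R ⟶ P`, where `pr` exhibits `P` as the `n`-fold product
`Xⁿ`, is `M`-closed: for every object `Z` and every interpretation
`f : {x₁,…,x_k} → C(Z,X)` of the entries of `M`, if for every left column `j`
the induced morphism `Z ⟶ Xⁿ` factors through `r`, then so does the morphism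
induced by the right column. -/
def IsClosed (M : Matr) {X P R : C} (pr : Fin M.n → (P ⟶ X))
    (hP : IsLimit (Fan.mk P pr)) (r : R ⟶ P) : Prop :=
  ∀ (Z : C) (f : Fin M.k → (Z ⟶ X)),
    (∀ j : Fin M.m, ∃ g : Z ⟶ R,
        g ≫ r = hP.lift (Fan.mk Z (fun i => f (M.left i j)))) →
    ∃ g : Z ⟶ R, g ≫ r = hP.lift (Fan.mk Z (fun i => f (M.right i)))

/-- A relation `r : R ⟶ P`, where `pr` exhibits `P` as the product
`X₁ × ⋯ × X_n` of a family `X : Fin n → C`, is strictly `M`-closed: for every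
object `Z` and every row-wise interpretation `fᵢ : {x₁,…,x_k} → C(Z,Xᵢ)`, if
every left column's induced morphism `Z ⟶ X₁ × ⋯ × X_n` factors through `r`,
then so does the right column's induced morphism. -/
def IsStrictClosed (M : Matr) {X : Fin M.n → C} {P R : C}
    (pr : ∀ i, P ⟶ X i) (hP : IsLimit (Fan.mk P pr)) (r : R ⟶ P) : Prop :=
  ∀ (Z : C) (f : ∀ i, Fin M.k → (Z ⟶ X i)),
    (∀ j : Fin M.m, ∃ g : Z ⟶ R,
        g ≫ r = hP.lift (Fan.mk Z (fun i => f i (M.left i j)))) →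
    ∃ g : Z ⟶ R, g ≫ r = hP.lift (Fan.mk Z (fun i => f i (M.right i)))

/-- `C` has `M`-closed `W`-relations: every `n`-ary relation `r : R ⟶ Xⁿ`
belonging to the class of monomorphisms `W` is `M`-closed. -/
def HasClosedRels (M : Matr) (C : Type u) [Category.{v} C]
    (W : MorphismProperty C) : Prop :=
  ∀ (X P R : C) (pr : Fin M.n → (P ⟶ X)) (hP : IsLimit (Fan.mk P pr))
    (r : R ⟶ P), W r → M.IsClosed pr hP r

/-- `C` has `S`-closed `W`-relations. -/
def HasSClosedRels (S : Set Matr) (C : Type u) [Category.{v} C]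
    (W : MorphismProperty C) : Prop :=
  ∀ M ∈ S, HasClosedRels M C W

end Matr

/-- The class of strong monomorphisms of `C`, as a `MorphismProperty`. -/
def strongMonos (C : Type u) [Category.{v} C] : MorphismProperty C :=
  fun _ _ f => StrongMono f

open CategoryTheory CategoryTheory.Limits



/-- A pointed extended matrix `M ∈ matr_*(n,m,k)`: `n > 0` rows, `m` left
columns and one right column, with entries in `{∗, x₁, …, x_k}` (modelled as
`Option (Fin k)`, where `none` is `∗`). `matr_*` is the union over all
`n,m,k`, i.e. the type `MatrStar`. -/
structure MatrStar where
  n : ℕ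
  m : ℕ
  k : ℕ
  npos : 0 < n
  left : Fin n → Fin m → Option (Fin k)
  right : Fin n → Option (Fin k)

namespace MatrStar

variable {C : Type u} [Category.{v} C] [HasZeroMorphisms C]

/-- A relation `r : R ⟶ P` in a pointed category, where `pr` exhibits `P` as
the `n`-fold product `Xⁿ`, is `M`-closed: for every object `Z` and every
interpretation `f : {∗,x₁,…,x_k} → C(Z,X)` with `f ∗ = 0`, if for every left
column `j` the induced morphism `Z ⟶ Xⁿ` factors through `r`, then so does
the morphism induced by the right column. -/
def IsClosed (M : MatrStar) {X P R : C} (pr : Fin M.n → (P ⟶ X))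
    (hP : IsLimit (Fan.mk P pr)) (r : R ⟶ P) : Prop :=
  ∀ (Z : C) (f : Option (Fin M.k) → (Z ⟶ X)), f none = 0 →
    ((∀ j : Fin M.m, ∃ g : Z ⟶ R,
        g ≫ r = hP.lift (Fan.mk Z (fun i => f (M.left i j)))) →
    ∃ g : Z ⟶ R, g ≫ r = hP.lift (Fan.mk Z (fun i => f (M.right i))))

/-- A relation `r : R ⟶ P`, where `pr` exhibits `P` as the product
`X₁ × ⋯ × X_n` of a family `X : Fin n → C`, is strictly `M`-closed: for every
object `Z` and every row-wise interpretation `fᵢ : {∗,x₁,…,x_k} → C(Z,Xᵢ)`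
with `fᵢ ∗ = 0`, if every left column's induced morphism factors through `r`,
then so does the right column's induced morphism. -/
def IsStrictClosed (M : MatrStar) {X : Fin M.n → C} {P R : C}
    (pr : ∀ i, P ⟶ X i) (hP : IsLimit (Fan.mk P pr)) (r : R ⟶ P) : Prop :=
  ∀ (Z : C) (f : ∀ i, Option (Fin M.k) → (Z ⟶ X i)), (∀ i, f i none = 0) →
    ((∀ j : Fin M.m, ∃ g : Z ⟶ R,
        g ≫ r = hP.lift (Fan.mk Z (fun i => f i (M.left i j)))) →
    ∃ g : Z ⟶ R, g ≫ r = hP.lift (Fan.mk Z (fun i => f i (M.right i))))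

/-- `C` has `M`-closed `W`-relations: every `n`-ary relation `r : R ⟶ Xⁿ`
belonging to the class of monomorphisms `W` is `M`-closed. -/
def HasClosedRels (M : MatrStar) (C : Type u) [Category.{v} C]
    [HasZeroMorphisms C] (W : MorphismProperty C) : Prop :=
  ∀ (X P R : C) (pr : Fin M.n → (P ⟶ X)) (hP : IsLimit (Fan.mk P pr))
    (r : R ⟶ P), W r → M.IsClosed pr hP r

/-- `C` has `S`-closed `W`-relations. -/
def HasSClosedRels (S : Set MatrStar) (C : Type u) [Category.{v} C]
    [HasZeroMorphisms C] (W : MorphismProperty C) : Prop :=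
  ∀ M ∈ S, HasClosedRels M C W

end MatrStar

/-- `S ⇒_lex N`: every finitely complete category with `S`-closed relations
has `N`-closed relations. -/
def LexImp (S : Set Matr) (N : Matr) : Prop :=
  ∀ (C : Type u) [Category.{v} C] [HasFiniteLimits C],
    Matr.HasSClosedRels S C (MorphismProperty.monomorphisms C) →
    Matr.HasClosedRels N C (MorphismProperty.monomorphisms C)

/-- `S ⇒_{lex*} N`: every finitely complete pointed category with `S`-closed
relations has `N`-closed relations. -/
def LexImpStar (S : Set MatrStar) (N : MatrStar) : Prop :=
  ∀ (C : Type u) [Category.{v} C] [HasFiniteLimits C] [HasZeroObject C]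
    [HasZeroMorphisms C],
    MatrStar.HasSClosedRels S C (MorphismProperty.monomorphisms C) →
    MatrStar.HasClosedRels N C (MorphismProperty.monomorphisms C)

universe v' u'
namespace LexAux

/-- closure of a set of tuples under row-wise interpretations of matrices in `S`. -/
inductive Cl (S : Set Matr) (n : ℕ) {T : Type} (B : Set (Fin n → T)) : (Fin n → T) → Prop
  | base (t : Fin n → T) (ht : t ∈ B) : Cl S n B t
  | step (M : Matr) (hM : M ∈ S) (h : Fin n → Fin M.n) (g : Fin n → Fin M.k → T)
      (hl : ∀ l, Cl S n B (fun j => g j (M.left (h j) l))) :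
      Cl S n B (fun j => g j (M.right (h j)))

/-- a set of tuples is closed under row-wise interpretations of matrices in `S`. -/
def RelClosed (S : Set Matr) (n : ℕ) {T : Type} (B : Set (Fin n → T)) : Prop :=
  ∀ M ∈ S, ∀ (h : Fin n → Fin M.n) (g : Fin n → Fin M.k → T),
    (∀ l, (fun j => g j (M.left (h j) l)) ∈ B) → (fun j => g j (M.right (h j))) ∈ B

/-- the closure as a set. -/
def clSet (S : Set Matr) (n : ℕ) {T : Type} (B : Set (Fin n → T)) : Set (Fin n → T) :=
  {t | Cl S n B t}

theorem clSet_closed (S : Set Matr) (n : ℕ) {T : Type} (B : Set (Fin n → T)) :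
    RelClosed S n (clSet S n B) := fun M hM h g hl => Cl.step M hM h g hl

theorem Cl.map {S : Set Matr} {n : ℕ} {T T' : Type} {B : Set (Fin n → T)} {D : Set (Fin n → T')}
    (hD : RelClosed S n D) (φ : T → T') (hB : ∀ t ∈ B, (fun j => φ (t j)) ∈ D) {t : Fin n → T}
    (ht : Cl S n B t) : (fun j => φ (t j)) ∈ D := by
  induction ht with
  | base t ht => exact hB t ht
  | step M hM h g hl ih => exact hD M hM h (fun j x => φ (g j x)) ih

theorem Cl.mono {S S' : Set Matr} (hS : S ⊆ S') {n : ℕ} {T : Type} {B : Set (Fin n → T)}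
    {t : Fin n → T} (ht : Cl S n B t) : Cl S' n B t := by
  induction ht with
  | base t ht => exact Cl.base t ht
  | step M hM h g hl ih => exact Cl.step M (hS hM) h g ih

theorem Cl.finite {S : Set Matr} {n : ℕ} {T : Type} {B : Set (Fin n → T)}
    {t : Fin n → T} (ht : Cl S n B t) : ∃ S' ⊆ S, S'.Finite ∧ Cl S' n B t := by
  induction ht with
  | base t ht => exact ⟨∅, by simp, by simp, Cl.base t ht⟩
  | step M hM h g hl ih =>
    choose F h1 h2 h3 using ih
    refine ⟨insert M (⋃ l, F l), ?_, ?_, ?_⟩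
    · exact Set.insert_subset hM (Set.iUnion_subset h1)
    · exact (Set.finite_iUnion h2).insert M
    · exact Cl.step M (Set.mem_insert _ _) h g fun l =>
        (h3 l).mono ((Set.subset_iUnion F l).trans (Set.subset_insert _ _))

theorem fac_iff {C : Type u} [Category.{v} C] {n : ℕ} {X P R Z : C} (pr : Fin n → (P ⟶ X))
    (hP : IsLimit (Fan.mk P pr)) (r : R ⟶ P) (φ : Fin n → (Z ⟶ X)) (g : Z ⟶ R) :
    g ≫ r = hP.lift (Fan.mk Z φ) ↔ ∀ i, g ≫ r ≫ pr i = φ i := by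
  have hl : ∀ i, hP.lift (Fan.mk Z φ) ≫ pr i = φ i := fun i => hP.fac (Fan.mk Z φ) ⟨i⟩
  constructor
  · intro h i
    rw [← Category.assoc, h, hl]
  · intro h
    refine hP.hom_ext ?_
    rintro ⟨i⟩
    have := (h i).trans (hl i).symm
    simpa using this

/-- Closedness in the grouped form. -/
theorem key {C : Type u} [Category.{v} C] [HasFiniteLimits C] {M : Matr}
    (hM : M.HasClosedRels C (MorphismProperty.monomorphisms C)) {n : ℕ} {X P R Z : C}
    (pr : Fin n → (P ⟶ X)) (hP : IsLimit (Fan.mk P pr)) (r : R ⟶ P) [Mono r]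
    (h : Fin n → Fin M.n) (G : Fin n → Fin M.k → (Z ⟶ X))
    (hl : ∀ l, ∃ g : Z ⟶ R, ∀ j, g ≫ r ≫ pr j = G j (M.left (h j) l)) :
    ∃ g : Z ⟶ R, ∀ j, g ≫ r ≫ pr j = G j (M.right (h j)) := by
  let Q : C := ∏ᶜ fun _ : Fin M.n => P
  let π : Fin M.n → (Q ⟶ P) := fun i => Pi.π (fun _ : Fin M.n => P) i
  let hQ : IsLimit (Fan.mk Q π) := productIsProduct _
  let q : Q ⟶ P := hP.lift (Fan.mk Q fun j => π (h j) ≫ pr j)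
  have hq : ∀ j, q ≫ pr j = π (h j) ≫ pr j := fun j =>
    hP.fac (Fan.mk Q fun j => π (h j) ≫ pr j) ⟨j⟩
  let F : Fin M.k → (Z ⟶ P) := fun x => hP.lift (Fan.mk Z fun j => G j x)
  have hF : ∀ x j, F x ≫ pr j = G j x := fun x j => hP.fac (Fan.mk Z fun j => G j x) ⟨j⟩
  have := hM P Q (pullback r q) π hQ (pullback.snd r q)
    (MorphismProperty.monomorphisms.infer_property _) Z F
  obtain ⟨g, hg⟩ := this (by
    intro l
    obtain ⟨g, hg⟩ := hl l
    let b : Z ⟶ Q := hQ.lift (Fan.mk Z fun i => F (M.left i l))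
    have hb : ∀ i, b ≫ π i = F (M.left i l) := fun i =>
      hQ.fac (Fan.mk Z fun i => F (M.left i l)) ⟨i⟩
    refine ⟨pullback.lift g b ?_, pullback.lift_snd _ _ _⟩
    refine hP.hom_ext ?_
    rintro ⟨j⟩
    change (g ≫ r) ≫ pr j = (b ≫ q) ≫ pr j
    rw [Category.assoc, hg, Category.assoc, hq, ← Category.assoc, hb, hF])
  rw [fac_iff] at hg
  refine ⟨g ≫ pullback.fst r q, fun j => ?_⟩
  have h1 : (g ≫ pullback.fst r q) ≫ r ≫ pr j = (g ≫ pullback.snd r q ≫ π (h j)) ≫ pr j := by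
    have := pullback.condition (f := r) (g := q)
    simp only [Category.assoc]
    rw [← hq, reassoc_of% this]
  rw [h1, hg, hF]

/-- Soundness. -/
theorem sound {S : Set Matr} {N : Matr}
    (h : Cl S N.n (Set.range fun j i => N.left i j) N.right) : LexImp.{v, u} S N := by
  intro C _ _ hS X P R pr hP r hr Z f hf
  have : Mono r := hr
  have main : ∀ t, Cl S N.n (Set.range fun j i => N.left i j) t →
      ∃ g : Z ⟶ R, ∀ i, g ≫ r ≫ pr i = f (t i) := by
    intro t ht
    induction ht with
    | base t ht =>
      obtain ⟨j, rfl⟩ := ht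
      obtain ⟨g, hg⟩ := hf j
      exact ⟨g, (fac_iff _ _ _ _ _).1 hg⟩
    | step M hM h g hl ih => exact key (hS M hM) pr hP r h (fun j x => f (g j x)) ih
  obtain ⟨g, hg⟩ := main _ h
  exact ⟨g, (fac_iff _ _ _ _ _).2 hg⟩

/-- the matrix does not force equality of parallel morphisms. -/
def EqC (M : Matr) : Prop :=
  ∀ (i i' : Fin M.n) (f g : Fin M.k → ℕ), (∀ l, f (M.left i l) = g (M.left i' l)) →
    f (M.right i) = g (M.right i')

theorem preorder_of_not_eqC {C : Type u} [Category.{v} C] [HasFiniteLimits C] {M : Matr}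
    (hM : M.HasClosedRels C (MorphismProperty.monomorphisms C)) (hE : ¬ EqC M)
    {Z X : C} (a b : Z ⟶ X) : a = b := by
  classical
  unfold EqC at hE
  push Not at hE
  obtain ⟨i, i', f, g, hl, hne⟩ := hE
  let φ : ℕ → (Z ⟶ X) := fun x => if x = f (M.right i) then a else b
  let P : C := ∏ᶜ fun _ : Fin 2 => X
  let π : Fin 2 → (P ⟶ X) := fun i => Pi.π (fun _ : Fin 2 => X) i
  let hP : IsLimit (Fan.mk P π) := productIsProduct _
  let r : X ⟶ P := hP.lift (Fan.mk X fun _ => 𝟙 X)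
  have hr : ∀ i, r ≫ π i = 𝟙 X := fun i => hP.fac (Fan.mk X fun _ => 𝟙 X) ⟨i⟩
  have : Mono r := by
    have : Mono (r ≫ π 0) := by rw [hr]; infer_instance
    exact mono_of_mono r (π 0)
  obtain ⟨k, hk⟩ := key hM π hP r ![i, i'] (![fun x => φ (f x), fun x => φ (g x)]) (by
    intro l
    refine ⟨φ (f (M.left i l)), ?_⟩
    intro j
    rw [hr, Category.comp_id]
    fin_cases j
    · rfl
    · exact congrArg φ (hl l))
  have h0 := hk 0
  have h1 := hk 1
  rw [hr, Category.comp_id] at h0 h1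
  have h2 : φ (f (M.right i)) = φ (g (M.right i')) := h0.symm.trans h1
  simpa [φ, hne.symm] using h2

/-- Structures. -/
structure SObj (S : Set Matr) (n : ℕ) : Type u where
  a : ℕ
  rel : Set (Fin n → Fin a)
  closed : RelClosed S n rel

/-- Morphisms, in the opposite direction. -/
@[ext]
structure SHom {S : Set Matr} {n : ℕ} (X Y : SObj.{u} S n) : Type v where
  f : Fin Y.a → Fin X.a
  pres : ∀ t ∈ Y.rel, (fun j => f (t j)) ∈ X.rel

instance sCat (S : Set Matr) (n : ℕ) : Category.{v} (SObj.{u} S n) where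
  Hom X Y := SHom.{v, u} X Y
  id X := ⟨fun x => x, fun t ht => ht⟩
  comp p q := ⟨fun x => p.f (q.f x), fun t ht => p.pres _ (q.pres t ht)⟩

section
variable {S : Set Matr} {n : ℕ}

theorem s_ext {X Y : SObj.{u} S n} (p q : X ⟶ Y) (h : ∀ x, SHom.f.{v} p x = q.f x) : p = q :=
  SHom.ext (funext h)

theorem s_comp {X Y W : SObj.{u} S n} (p : X ⟶ Y) (q : Y ⟶ W) (x) :
    SHom.f.{v} (p ≫ q) x = p.f (q.f x) := rfl

theorem s_congr {X Y : SObj.{u} S n} {p q : X ⟶ Y} (h : p = q) (x) : SHom.f.{v} p x = q.f x := by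
  rw [h]

section lim
variable {J : Type} [SmallCategory J] [FinCategory J] (F : J ⥤ SObj.{u} S n)

/-- gluing relation. -/
def glue (p q : Σ j, Fin (F.obj j).a) : Prop :=
  ∃ φ : p.1 ⟶ q.1, p.2 = SHom.f.{v} (F.map φ) q.2

/-- The underlying colimit. -/
abbrev LQ : Type := Quot (glue.{v} F)

/-- coding of the colimit. -/
noncomputable def lqEquiv : LQ.{v} F ≃ Fin (Nat.card (LQ.{v} F)) := Finite.equivFin _

/-- coprojection. -/
noncomputable def lqIn (j : J) (x : Fin (F.obj j).a) : Fin (Nat.card (LQ.{v} F)) :=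
  lqEquiv F (Quot.mk _ ⟨j, x⟩)

/-- limit object. -/
noncomputable def limObj : SObj.{u} S n where
  a := Nat.card (LQ.{v} F)
  rel := clSet S n {t | ∃ j, ∃ s ∈ (F.obj j).rel, t = fun i => lqIn.{v} F j (s i)}
  closed := clSet_closed _ _ _

/-- limit cone. -/
noncomputable def limCone : Cone F where
  pt := limObj.{v} F
  π :=
    { app := fun j => ⟨lqIn.{v} F j, fun t ht => Cl.base _ ⟨j, t, ht, rfl⟩⟩
      naturality := by
        intro j j' φ
        refine s_ext _ _ fun x => ?_
        exact congrArg (lqEquiv F) (Quot.sound ⟨φ, rfl⟩).symm }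

/-- descent map. -/
noncomputable def lqOut (s : Cone F) (x : Fin (Nat.card (LQ.{v} F))) : Fin s.pt.a :=
  Quot.lift (fun p : Σ j, Fin (F.obj j).a => SHom.f.{v} (s.π.app p.1) p.2) (by
    rintro ⟨j, x⟩ ⟨j', y⟩ ⟨φ, h⟩
    dsimp only at φ h ⊢
    subst h
    rw [← s_comp, s.w]) ((lqEquiv F).symm x)

theorem lqOut_in (s : Cone F) (j : J) (x : Fin (F.obj j).a) :
    lqOut F s (lqIn.{v} F j x) = SHom.f.{v} (s.π.app j) x := by
  simp [lqOut, lqIn]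

/-- it is a limit. -/
noncomputable def limIsLimit : IsLimit (limCone.{v} F) where
  lift s := ⟨lqOut F s, by
      intro t ht
      refine Cl.map s.pt.closed (lqOut F s) ?_ ht
      rintro _ ⟨j, u, hu, rfl⟩
      simpa [lqOut_in] using SHom.pres (s.π.app j) u hu⟩
  fac s j := by
    refine s_ext _ _ fun x => ?_
    exact lqOut_in F s j x
  uniq s m hm := by
    refine s_ext _ _ fun x => ?_
    obtain ⟨y, rfl⟩ := (lqEquiv F).surjective x
    obtain ⟨⟨j, y⟩, rfl⟩ := Quot.exists_rep y
    exact (s_congr (hm j) y).trans (lqOut_in F s j y).symm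
end lim

instance : HasFiniteLimits.{v} (SObj.{u} S n) :=
  ⟨fun _ _ _ => ⟨fun F => ⟨⟨limCone F, limIsLimit F⟩⟩⟩⟩

theorem joint_surj {V : SObj.{u} S n} {ι : Type} {X : ι → SObj.{u} S n}
    (s : ∀ i, SHom.{v} V (X i))
    (hs : ∀ (W : SObj.{u} S n) (a b : SHom.{v} W V),
      (∀ i x, a.f ((s i).f x) = b.f ((s i).f x)) → a = b)
    (y : Fin V.a) : ∃ i x, (s i).f x = y := by
  classical
  by_contra hcon
  push Not at hcon
  let W : SObj.{u} S n := ⟨2, Set.univ, fun _ _ _ _ _ => trivial⟩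
  have := hs W ⟨fun _ => 0, fun _ _ => trivial⟩ ⟨fun z => if z = y then 1 else 0, fun _ _ => trivial⟩
    (fun i x => by simp [hcon i x])
  have h2 := congrFun (congrArg SHom.f this) y
  simp at h2

theorem s_closed (hE : ∀ M ∈ S, EqC M) :
    Matr.HasSClosedRels.{v} S (SObj.{u} S n) (MorphismProperty.monomorphisms _) := by
  intro M hM X P R pr hP r hr Z f hf
  have : Mono r := hr
  simp only [fac_iff] at hf ⊢
  choose g hg using hf
  have surj : ∀ y : Fin R.a, ∃ (i : Fin M.n) (x : Fin X.a), SHom.f (r ≫ pr i) x = y := by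
    refine joint_surj (X := fun _ => X) (fun i => r ≫ pr i) ?_
    intro W a b hab
    have : (show W ⟶ R from a) ≫ r = (show W ⟶ R from b) ≫ r := by
      refine hP.hom_ext ?_
      rintro ⟨i⟩
      exact s_ext _ _ fun x => hab i x
    exact (cancel_mono r).1 this
  choose I U hIU using surj
  have hgl : ∀ l i x, SHom.f (g l) (SHom.f (r ≫ pr i) x) = SHom.f (f (M.left i l)) x := by
    intro l i x
    rw [← s_comp, hg]
  refine ⟨⟨fun y => SHom.f (f (M.right (I y))) (U y), ?_⟩, ?_⟩
  · intro t ht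
    refine Z.closed M hM (fun j => I (t j)) (fun j x => SHom.f (f x) (U (t j))) ?_
    intro l
    have := SHom.pres (g l) t ht
    convert this using 2 with j
    rw [← hgl, hIU]
  · intro i
    refine s_ext _ _ fun x => ?_
    rw [s_comp]
    apply Fin.ext
    refine hE M hM _ _ (fun e => (SHom.f (f e) _ : ℕ)) (fun e => (SHom.f (f e) x : ℕ)) ?_
    intro l
    rw [← hgl, ← hgl, hIU]

end

theorem complete {S : Set Matr} {N : Matr} (hE : ∀ M ∈ S, EqC M) (hSN : LexImp.{v, u} S N) :
    Cl S N.n (Set.range fun j i => N.left i j) N.right := by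
  have hN := hSN (SObj.{u} S N.n) (s_closed hE)
  let X : SObj.{u} S N.n := ⟨1, clSet S N.n ∅, clSet_closed _ _ _⟩
  let P : SObj.{u} S N.n := ⟨N.n, clSet S N.n ∅, clSet_closed _ _ _⟩
  let R : SObj.{u} S N.n := ⟨N.n, clSet S N.n {fun i => i}, clSet_closed _ _ _⟩
  let Z : SObj.{u} S N.n := ⟨N.k, clSet S N.n (Set.range fun j i => N.left i j),
    clSet_closed _ _ _⟩
  let pr : Fin N.n → (P ⟶ X) := fun i =>
    ⟨fun _ => i, fun t ht => Cl.map (clSet_closed _ _ _) (fun _ => i) (by simp) ht⟩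
  let r : R ⟶ P := ⟨fun i => i, fun t ht => Cl.map (clSet_closed _ _ _) (fun i => i) (by simp) ht⟩
  have hr : Mono r := ⟨fun a b hab => s_ext _ _ fun x => s_congr hab x⟩
  let hP : IsLimit (Fan.mk P pr) := Fan.IsLimit.mk _
    (fun s => ⟨fun i => SHom.f (s.proj i) (0 : Fin 1), fun t ht =>
      Cl.map (s.pt.closed) (fun i => SHom.f (s.proj i) (0 : Fin 1)) (by simp) ht⟩)
    (fun s i => s_ext _ _ fun x => by
      obtain rfl : x = (0 : Fin 1) := Subsingleton.elim (α := Fin 1) _ _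
      rfl)
    (fun s m hm => s_ext _ _ fun i => s_congr (hm i) (0 : Fin 1))
  let f : Fin N.k → (Z ⟶ X) := fun x =>
    ⟨fun _ => x, fun t ht => Cl.map (clSet_closed _ _ _) (fun _ => x) (by simp) ht⟩
  obtain ⟨g, hg⟩ := hN X P R pr hP r hr Z f (by
    intro j
    refine ⟨⟨fun i => N.left i j, fun t ht => Cl.map (clSet_closed _ _ _) (fun i => N.left i j) ?_ ht⟩, ?_⟩
    · rintro _ rfl
      exact Cl.base _ ⟨j, rfl⟩
    · rw [fac_iff]
      intro i
      rfl)
  rw [fac_iff] at hg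
  have h1 := SHom.pres g (fun i => i) (Cl.base _ rfl)
  have h2 : (fun i => SHom.f g i) = N.right := funext fun i => s_congr (hg i) (0 : Fin 1)
  rw [h2] at h1
  exact h1

theorem two_imp {S : Set Matr} {N : Matr} (hSN : LexImp.{v, u} S N) (hN : N.m = 0) :
    ∃ M ∈ S, M.m = 0 := by
  by_contra hcon
  push Not at hcon
  let _ : Category.{0} (ULift.{u} Bool) := uliftCategory Bool
  let C := ULiftHom.{v} (ULift.{u} Bool)
  let e : Bool ≌ C := (ULift.equivalence.{0, 0, u} (C := Bool)).trans
    (ULiftHom.equiv.{0} (C := ULift.{u} Bool))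
  have hsub : ∀ (A B : C), Subsingleton (A ⟶ B) := fun A B =>
    ⟨fun a b => e.inverse.map_injective (Subsingleton.elim _ _)⟩
  have : HasFiniteLimits Bool := inferInstance
  have : HasFiniteLimits C := ⟨fun J _ _ => Adjunction.hasLimitsOfShape_of_equivalence e.inverse⟩
  have h := hSN C (by
    intro M hM X P R pr hP r hr Z f hf
    obtain ⟨g, hg⟩ := hf ⟨0, Nat.pos_of_ne_zero (hcon M hM)⟩
    exact ⟨g, (hsub _ _).elim _ _⟩)
  let T : C := e.functor.obj ⊤
  let B : C := e.functor.obj ⊥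
  let hP : IsLimit (Fan.mk T (fun _ : Fin N.n => 𝟙 T)) := Fan.IsLimit.mk _
    (fun s => s.proj ⟨0, N.npos⟩) (fun s j => (hsub _ _).elim _ _)
    (fun s m hm => (hsub _ _).elim _ _)
  obtain ⟨g, -⟩ := h T T B _ hP (e.functor.map (homOfLE bot_le))
    ⟨fun a b _ => (hsub _ _).elim _ _⟩ T (fun _ => 𝟙 T) (fun j => (Fin.cast hN j).elim0)
  have := leOfHom (e.functor.preimage g)
  exact absurd this (by decide)

theorem core {S : Set Matr} {N : Matr} (hSN : LexImp.{v, u} S N) :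
    ∃ S' ⊆ S, S'.Finite ∧ LexImp.{v', u'} S' N := by
  by_cases hE : ∀ M ∈ S, EqC M
  · obtain ⟨S', h1, h2, h3⟩ := (complete hE hSN).finite
    exact ⟨S', h1, h2, sound h3⟩
  push Not at hE
  obtain ⟨M, hM, hME⟩ := hE
  by_cases hN : N.m = 0
  · obtain ⟨M₀, hM₀, hm⟩ := two_imp hSN hN
    refine ⟨{M₀}, by simpa, by simp, sound ?_⟩
    have := Cl.step (S := {M₀}) (n := N.n) (B := (Set.range fun j i => N.left i j)) M₀ rfl
      (fun _ => ⟨0, M₀.npos⟩) (fun j _ => N.right j) (fun j => (Fin.cast hm j).elim0)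
    exact this
  · refine ⟨{M}, by simpa, by simp, ?_⟩
    intro C _ _ hS X P R pr hP r hr Z f hf
    obtain ⟨g, hg⟩ := hf ⟨0, Nat.pos_of_ne_zero hN⟩
    exact ⟨g, preorder_of_not_eqC (hS M rfl) hME _ _⟩

end LexAux

namespace LexAuxStar
open LexAux (fac_iff)

/-- closure of a set of tuples under the base tuple and row-wise interpretations of matrices
in `S`. -/
inductive Cl (S : Set MatrStar) (n : ℕ) {T : Type} (b : T) (B : Set (Fin n → T)) :
    (Fin n → T) → Prop
  | base (t : Fin n → T) (ht : t ∈ B) : Cl S n b B t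
  | zero : Cl S n b B (fun _ => b)
  | step (M : MatrStar) (hM : M ∈ S) (h : Fin n → Fin M.n) (g : Fin n → Option (Fin M.k) → T)
      (hg : ∀ j, g j none = b)
      (hl : ∀ l, Cl S n b B (fun j => g j (M.left (h j) l))) :
      Cl S n b B (fun j => g j (M.right (h j)))

/-- closed sets of tuples. -/
structure RelClosed (S : Set MatrStar) (n : ℕ) {T : Type} (b : T) (B : Set (Fin n → T)) :
    Prop where
  zero : (fun _ => b) ∈ B
  step : ∀ M ∈ S, ∀ (h : Fin n → Fin M.n) (g : Fin n → Option (Fin M.k) → T),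
    (∀ j, g j none = b) →
    (∀ l, (fun j => g j (M.left (h j) l)) ∈ B) → (fun j => g j (M.right (h j))) ∈ B

/-- the closure as a set. -/
def clSet (S : Set MatrStar) (n : ℕ) {T : Type} (b : T) (B : Set (Fin n → T)) :
    Set (Fin n → T) := {t | Cl S n b B t}

theorem clSet_closed (S : Set MatrStar) (n : ℕ) {T : Type} (b : T) (B : Set (Fin n → T)) :
    RelClosed S n b (clSet S n b B) :=
  ⟨Cl.zero, fun M hM h g hg hl => Cl.step M hM h g hg hl⟩

theorem Cl.map {S : Set MatrStar} {n : ℕ} {T T' : Type} {b : T} {b' : T'} {B : Set (Fin n → T)}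
    {D : Set (Fin n → T')}
    (hD : RelClosed S n b' D) (φ : T → T') (hφ : φ b = b')
    (hB : ∀ t ∈ B, (fun j => φ (t j)) ∈ D) {t : Fin n → T}
    (ht : Cl S n b B t) : (fun j => φ (t j)) ∈ D := by
  induction ht with
  | base t ht => exact hB t ht
  | zero => subst hφ; exact hD.zero
  | step M hM h g hg hl ih =>
    exact hD.step M hM h (fun j x => φ (g j x)) (fun j => by rw [hg, hφ]) ih

theorem Cl.mono {S S' : Set MatrStar} (hS : S ⊆ S') {n : ℕ} {T : Type} {b : T}
    {B : Set (Fin n → T)} {t : Fin n → T} (ht : Cl S n b B t) : Cl S' n b B t := by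
  induction ht with
  | base t ht => exact Cl.base t ht
  | zero => exact Cl.zero
  | step M hM h g hg hl ih => exact Cl.step M (hS hM) h g hg ih

theorem Cl.finite {S : Set MatrStar} {n : ℕ} {T : Type} {b : T} {B : Set (Fin n → T)}
    {t : Fin n → T} (ht : Cl S n b B t) : ∃ S' ⊆ S, S'.Finite ∧ Cl S' n b B t := by
  induction ht with
  | base t ht => exact ⟨∅, by simp, by simp, Cl.base t ht⟩
  | zero => exact ⟨∅, by simp, by simp, Cl.zero⟩
  | step M hM h g hg hl ih =>
    choose F h1 h2 h3 using ih
    refine ⟨insert M (⋃ l, F l), ?_, ?_, ?_⟩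
    · exact Set.insert_subset hM (Set.iUnion_subset h1)
    · exact (Set.finite_iUnion h2).insert M
    · exact Cl.step M (Set.mem_insert _ _) h g hg fun l =>
        (h3 l).mono ((Set.subset_iUnion F l).trans (Set.subset_insert _ _))

/-- Closedness in the grouped form. -/
theorem key {C : Type u} [Category.{v} C] [HasFiniteLimits C] [HasZeroMorphisms C] {M : MatrStar}
    (hM : M.HasClosedRels C (MorphismProperty.monomorphisms C)) {n : ℕ} {X P R Z : C}
    (pr : Fin n → (P ⟶ X)) (hP : IsLimit (Fan.mk P pr)) (r : R ⟶ P) [Mono r]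
    (h : Fin n → Fin M.n) (G : Fin n → Option (Fin M.k) → (Z ⟶ X)) (hG : ∀ j, G j none = 0)
    (hl : ∀ l, ∃ g : Z ⟶ R, ∀ j, g ≫ r ≫ pr j = G j (M.left (h j) l)) :
    ∃ g : Z ⟶ R, ∀ j, g ≫ r ≫ pr j = G j (M.right (h j)) := by
  let Q : C := ∏ᶜ fun _ : Fin M.n => P
  let π : Fin M.n → (Q ⟶ P) := fun i => Pi.π (fun _ : Fin M.n => P) i
  let hQ : IsLimit (Fan.mk Q π) := productIsProduct _
  let q : Q ⟶ P := hP.lift (Fan.mk Q fun j => π (h j) ≫ pr j)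
  have hq : ∀ j, q ≫ pr j = π (h j) ≫ pr j := fun j =>
    hP.fac (Fan.mk Q fun j => π (h j) ≫ pr j) ⟨j⟩
  let F : Option (Fin M.k) → (Z ⟶ P) := fun x => hP.lift (Fan.mk Z fun j => G j x)
  have hF : ∀ x j, F x ≫ pr j = G j x := fun x j => hP.fac (Fan.mk Z fun j => G j x) ⟨j⟩
  have hF0 : F none = 0 := by
    refine hP.hom_ext ?_
    rintro ⟨j⟩
    change F none ≫ pr j = 0 ≫ pr j
    rw [hF, hG, zero_comp]
  have := hM P Q (pullback r q) π hQ (pullback.snd r q)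
    (MorphismProperty.monomorphisms.infer_property _) Z F hF0
  obtain ⟨g, hg⟩ := this (by
    intro l
    obtain ⟨g, hg⟩ := hl l
    let b : Z ⟶ Q := hQ.lift (Fan.mk Z fun i => F (M.left i l))
    have hb : ∀ i, b ≫ π i = F (M.left i l) := fun i =>
      hQ.fac (Fan.mk Z fun i => F (M.left i l)) ⟨i⟩
    refine ⟨pullback.lift g b ?_, pullback.lift_snd _ _ _⟩
    refine hP.hom_ext ?_
    rintro ⟨j⟩
    change (g ≫ r) ≫ pr j = (b ≫ q) ≫ pr j
    rw [Category.assoc, hg, Category.assoc, hq, ← Category.assoc, hb, hF])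
  rw [fac_iff] at hg
  refine ⟨g ≫ pullback.fst r q, fun j => ?_⟩
  have h1 : (g ≫ pullback.fst r q) ≫ r ≫ pr j = (g ≫ pullback.snd r q ≫ π (h j)) ≫ pr j := by
    have := pullback.condition (f := r) (g := q)
    simp only [Category.assoc]
    rw [← hq, reassoc_of% this]
  rw [h1, hg, hF]

/-- Soundness. -/
theorem sound {S : Set MatrStar} {N : MatrStar}
    (h : Cl S N.n none (Set.range fun j i => N.left i j) N.right) : LexImpStar.{v, u} S N := by
  intro C _ _ _ _ hS X P R pr hP r hr Z f hf0 hf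
  have : Mono r := hr
  have main : ∀ t, Cl S N.n none (Set.range fun j i => N.left i j) t →
      ∃ g : Z ⟶ R, ∀ i, g ≫ r ≫ pr i = f (t i) := by
    intro t ht
    induction ht with
    | base t ht =>
      obtain ⟨j, rfl⟩ := ht
      obtain ⟨g, hg⟩ := hf j
      exact ⟨g, (fac_iff _ _ _ _ _).1 hg⟩
    | zero => exact ⟨0, fun i => by rw [zero_comp, hf0]⟩
    | step M hM h g hg hl ih =>
      exact key (hS M hM) pr hP r h (fun j x => f (g j x)) (fun j => by rw [hg, hf0]) ih
  obtain ⟨g, hg⟩ := main _ h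
  exact ⟨g, (fac_iff _ _ _ _ _).2 hg⟩

/-- the matrix does not force triviality. -/
def EqC (M : MatrStar) : Prop :=
  ∀ (i i' : Fin M.n) (f g : Option (Fin M.k) → ℕ), f none = g none →
    (∀ l, f (M.left i l) = g (M.left i' l)) → f (M.right i) = g (M.right i')

theorem zero_of_not_eqC {C : Type u} [Category.{v} C] [HasFiniteLimits C] [HasZeroMorphisms C]
    {M : MatrStar}
    (hM : M.HasClosedRels C (MorphismProperty.monomorphisms C)) (hE : ¬ EqC M)
    {Z X : C} (a : Z ⟶ X) : a = 0 := by
  classical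
  unfold EqC at hE
  push Not at hE
  obtain ⟨i, i', f, g, h0, hl, hne⟩ := hE
  obtain ⟨c, hc, hcne⟩ : ∃ c : ℕ, c ≠ f none ∧
      ((c = f (M.right i) ∧ c ≠ g (M.right i')) ∨ (c ≠ f (M.right i) ∧ c = g (M.right i'))) := by
    by_cases hf : f (M.right i) = f none
    · exact ⟨g (M.right i'), fun h => hne (hf.trans h.symm), Or.inr ⟨hne.symm, rfl⟩⟩
    · exact ⟨f (M.right i), hf, Or.inl ⟨rfl, hne⟩⟩
  let φ : ℕ → (Z ⟶ X) := fun x => if x = c then a else 0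
  have hφ0 : φ (f none) = 0 := by simp [φ, hc.symm]
  let P : C := ∏ᶜ fun _ : Fin 2 => X
  let π : Fin 2 → (P ⟶ X) := fun i => Pi.π (fun _ : Fin 2 => X) i
  let hP : IsLimit (Fan.mk P π) := productIsProduct _
  let r : X ⟶ P := hP.lift (Fan.mk X fun _ => 𝟙 X)
  have hr : ∀ i, r ≫ π i = 𝟙 X := fun i => hP.fac (Fan.mk X fun _ => 𝟙 X) ⟨i⟩
  have : Mono r := by
    have : Mono (r ≫ π 0) := by rw [hr]; infer_instance
    exact mono_of_mono r (π 0)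
  obtain ⟨k, hk⟩ := key hM π hP r ![i, i'] (![fun x => φ (f x), fun x => φ (g x)]) (by
    intro j
    fin_cases j
    · exact hφ0
    · exact (congrArg φ h0).symm.trans hφ0) (by
    intro l
    refine ⟨φ (f (M.left i l)), ?_⟩
    intro j
    rw [hr, Category.comp_id]
    fin_cases j
    · rfl
    · exact congrArg φ (hl l))
  have h0 := hk 0
  have h1 := hk 1
  rw [hr, Category.comp_id] at h0 h1
  have h2 : φ (f (M.right i)) = φ (g (M.right i')) := h0.symm.trans h1
  rcases hcne with ⟨h3, h4⟩ | ⟨h3, h4⟩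
  · simpa [φ, ← h3, h4.symm] using h2
  · simp only [φ, if_neg h3.symm, if_pos h4.symm] at h2
    exact h2.symm

/-- Structures. -/
structure SObj (S : Set MatrStar) (n : ℕ) : Type u where
  a : ℕ
  b : Fin a
  rel : Set (Fin n → Fin a)
  closed : RelClosed S n b rel

/-- Morphisms, in the opposite direction. -/
@[ext]
structure SHom {S : Set MatrStar} {n : ℕ} (X Y : SObj.{u} S n) : Type v where
  f : Fin Y.a → Fin X.a
  pt : f Y.b = X.b
  pres : ∀ t ∈ Y.rel, (fun j => f (t j)) ∈ X.rel

instance sCat (S : Set MatrStar) (n : ℕ) : Category.{v} (SObj.{u} S n) where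
  Hom X Y := SHom.{v, u} X Y
  id X := ⟨fun x => x, rfl, fun t ht => ht⟩
  comp p q := ⟨fun x => p.f (q.f x), by rw [q.pt, p.pt], fun t ht => p.pres _ (q.pres t ht)⟩

section
variable {S : Set MatrStar} {n : ℕ}

theorem s_ext {X Y : SObj.{u} S n} (p q : X ⟶ Y) (h : ∀ x, SHom.f.{v} p x = q.f x) : p = q :=
  SHom.ext (funext h)

theorem s_comp {X Y W : SObj.{u} S n} (p : X ⟶ Y) (q : Y ⟶ W) (x) :
    SHom.f.{v} (p ≫ q) x = p.f (q.f x) := rfl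

theorem s_congr {X Y : SObj.{u} S n} {p q : X ⟶ Y} (h : p = q) (x) : SHom.f.{v} p x = q.f x := by
  rw [h]

instance : HasZeroMorphisms.{v} (SObj.{u} S n) where
  zero X _ := ⟨⟨fun _ => X.b, rfl, fun _ _ => X.closed.zero⟩⟩
  comp_zero _ _ := s_ext _ _ fun _ => SHom.pt _
  zero_comp _ _ _ _ := s_ext _ _ fun _ => rfl

theorem s_zero {X Y : SObj.{u} S n} (x) : SHom.f.{v} (0 : X ⟶ Y) x = X.b := rfl

instance : HasZeroObject.{v} (SObj.{u} S n) :=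
  ⟨⟨1, 0, Set.univ, ⟨trivial, fun _ _ _ _ _ _ => trivial⟩⟩, by
    rw [IsZero.iff_id_eq_zero]
    exact s_ext _ _ fun x => Subsingleton.elim (α := Fin 1) _ _⟩

section lim
variable {J : Type} [SmallCategory J] [FinCategory J] (F : J ⥤ SObj.{u} S n)

/-- gluing relation. -/
inductive glue : Option (Σ j, Fin (F.obj j).a) → Option (Σ j, Fin (F.obj j).a) → Prop
  | pt (j : J) : glue none (some ⟨j, (F.obj j).b⟩)
  | map {j j' : J} (φ : j ⟶ j') (x : Fin (F.obj j').a) :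
      glue (some ⟨j, SHom.f.{v} (F.map φ) x⟩) (some ⟨j', x⟩)

/-- The underlying colimit. -/
abbrev LQ : Type := Quot (glue.{v} F)

/-- coding of the colimit. -/
noncomputable def lqEquiv : LQ.{v} F ≃ Fin (Nat.card (LQ.{v} F)) := Finite.equivFin _

/-- coprojection. -/
noncomputable def lqIn (j : J) (x : Fin (F.obj j).a) : Fin (Nat.card (LQ.{v} F)) :=
  lqEquiv F (Quot.mk _ (some ⟨j, x⟩))

/-- base point. -/
noncomputable def lqPt : Fin (Nat.card (LQ.{v} F)) := lqEquiv F (Quot.mk _ none)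

/-- limit object. -/
noncomputable def limObj : SObj.{u} S n where
  a := Nat.card (LQ.{v} F)
  b := lqPt F
  rel := clSet S n (lqPt F) {t | ∃ j, ∃ s ∈ (F.obj j).rel, t = fun i => lqIn.{v} F j (s i)}
  closed := clSet_closed _ _ _ _

/-- limit cone. -/
noncomputable def limCone : Cone F where
  pt := limObj.{v} F
  π :=
    { app := fun j => ⟨lqIn.{v} F j, congrArg (lqEquiv F) (Quot.sound (glue.pt j)).symm,
        fun t ht => Cl.base _ ⟨j, t, ht, rfl⟩⟩
      naturality := by
        intro j j' φ
        refine s_ext _ _ fun x => ?_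
        exact congrArg (lqEquiv F) (Quot.sound (glue.map φ x)).symm }

/-- descent map. -/
noncomputable def lqOut (s : Cone F) (x : Fin (Nat.card (LQ.{v} F))) : Fin s.pt.a :=
  Quot.lift (fun p : Option (Σ j, Fin (F.obj j).a) =>
      p.elim s.pt.b fun p => SHom.f.{v} (s.π.app p.1) p.2) (by
    rintro _ _ (j | ⟨φ, x⟩)
    · exact (SHom.pt (s.π.app j)).symm
    · dsimp only [Option.elim]
      rw [← s_comp, s.w]) ((lqEquiv F).symm x)

theorem lqOut_in (s : Cone F) (j : J) (x : Fin (F.obj j).a) :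
    lqOut F s (lqIn.{v} F j x) = SHom.f.{v} (s.π.app j) x := by
  simp [lqOut, lqIn]

theorem lqOut_pt (s : Cone F) : lqOut F s (lqPt.{v} F) = s.pt.b := by
  simp [lqOut, lqPt]

/-- it is a limit. -/
noncomputable def limIsLimit : IsLimit (limCone.{v} F) where
  lift s := ⟨lqOut F s, lqOut_pt F s, by
      intro t ht
      refine Cl.map s.pt.closed (lqOut F s) (lqOut_pt F s) ?_ ht
      rintro _ ⟨j, u, hu, rfl⟩
      simpa [lqOut_in] using SHom.pres (s.π.app j) u hu⟩
  fac s j := by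
    refine s_ext _ _ fun x => ?_
    exact lqOut_in F s j x
  uniq s m hm := by
    refine s_ext _ _ fun x => ?_
    obtain ⟨y, rfl⟩ := (lqEquiv F).surjective x
    obtain ⟨_ | ⟨j, y⟩, rfl⟩ := Quot.exists_rep y
    · exact (SHom.pt m).trans (lqOut_pt F s).symm
    · exact (s_congr (hm j) y).trans (lqOut_in F s j y).symm
end lim

instance : HasFiniteLimits.{v} (SObj.{u} S n) :=
  ⟨fun _ _ _ => ⟨fun F => ⟨⟨limCone F, limIsLimit F⟩⟩⟩⟩

theorem joint_surj {V : SObj.{u} S n} {ι : Type} [Nonempty ι] {X : ι → SObj.{u} S n}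
    (s : ∀ i, SHom.{v} V (X i))
    (hs : ∀ (W : SObj.{u} S n) (a b : SHom.{v} W V),
      (∀ i x, a.f ((s i).f x) = b.f ((s i).f x)) → a = b)
    (y : Fin V.a) : ∃ i x, (s i).f x = y := by
  classical
  by_contra hcon
  push Not at hcon
  have hy : V.b ≠ y := by
    obtain ⟨i⟩ := ‹Nonempty ι›
    rw [← (s i).pt]
    exact hcon i _
  let W : SObj.{u} S n := ⟨2, 0, Set.univ, ⟨trivial, fun _ _ _ _ _ _ => trivial⟩⟩
  have := hs W ⟨fun _ => 0, rfl, fun _ _ => trivial⟩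
    ⟨fun z => if z = y then 1 else 0, by simp [hy, W], fun _ _ => trivial⟩
    (fun i x => by simp [hcon i x])
  have h2 := congrFun (congrArg SHom.f this) y
  simp at h2

theorem s_closed (hE : ∀ M ∈ S, EqC M) :
    MatrStar.HasSClosedRels.{v} S (SObj.{u} S n) (MorphismProperty.monomorphisms _) := by
  intro M hM X P R pr hP r hr Z f hf0 hf
  have : Mono r := hr
  have : Nonempty (Fin M.n) := ⟨⟨0, M.npos⟩⟩
  simp only [fac_iff] at hf ⊢
  choose g hg using hf
  have surj : ∀ y : Fin R.a, ∃ (i : Fin M.n) (x : Fin X.a), SHom.f (r ≫ pr i) x = y := by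
    refine joint_surj (X := fun _ => X) (fun i => r ≫ pr i) ?_
    intro W a b hab
    have : (show W ⟶ R from a) ≫ r = (show W ⟶ R from b) ≫ r := by
      refine hP.hom_ext ?_
      rintro ⟨i⟩
      exact s_ext _ _ fun x => hab i x
    exact (cancel_mono r).1 this
  choose I U hIU using surj
  have hgl : ∀ l i x, SHom.f (g l) (SHom.f (r ≫ pr i) x) = SHom.f (f (M.left i l)) x := by
    intro l i x
    rw [← s_comp, hg]
  have hfn : ∀ x, SHom.f (f none) x = Z.b := fun x => by rw [hf0, s_zero]
  have hcomm : ∀ i x, SHom.f (f (M.right (I (SHom.f (r ≫ pr i) x)))) (U (SHom.f (r ≫ pr i) x)) =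
      SHom.f (f (M.right i)) x := by
    intro i x
    apply Fin.ext
    refine hE M hM _ _ (fun e => (SHom.f (f e) _ : ℕ)) (fun e => (SHom.f (f e) x : ℕ)) ?_ ?_
    · simp only [hfn]
    intro l
    rw [← hgl, ← hgl, hIU]
  refine ⟨⟨fun y => SHom.f (f (M.right (I y))) (U y), ?_, ?_⟩, ?_⟩
  · have h1 := hcomm ⟨0, M.npos⟩ X.b
    rw [SHom.pt, SHom.pt] at h1
    exact h1
  · intro t ht
    refine Z.closed.step M hM (fun j => I (t j)) (fun j x => SHom.f (f x) (U (t j)))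
      (fun j => hfn _) ?_
    intro l
    have := SHom.pres (g l) t ht
    convert this using 2 with j
    rw [← hgl, hIU]
  · intro i
    exact s_ext _ _ fun x => hcomm i x

end

/-- coding of entries. -/
def enc {k : ℕ} : Option (Fin k) → Fin (k + 1) := fun e => e.elim 0 Fin.succ

/-- decoding of entries. -/
def dec {k : ℕ} : Fin (k + 1) → Option (Fin k) := Fin.cons none some

theorem dec_enc {k : ℕ} (e : Option (Fin k)) : dec (enc e) = e := by
  cases e <;> simp [dec, enc]

theorem complete {S : Set MatrStar} {N : MatrStar} (hE : ∀ M ∈ S, EqC M)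
    (hSN : LexImpStar.{v, u} S N) :
    Cl S N.n none (Set.range fun j i => N.left i j) N.right := by
  have hN := hSN (SObj.{u} S N.n) (s_closed hE)
  let X : SObj.{u} S N.n := ⟨2, 0, clSet S N.n 0 ∅, clSet_closed _ _ _ _⟩
  let P : SObj.{u} S N.n := ⟨N.n + 1, 0, clSet S N.n 0 ∅, clSet_closed _ _ _ _⟩
  let R : SObj.{u} S N.n := ⟨N.n + 1, 0, clSet S N.n 0 {Fin.succ}, clSet_closed _ _ _ _⟩
  let Z : SObj.{u} S N.n := ⟨N.k + 1, 0, clSet S N.n 0 (Set.range fun j i => enc (N.left i j)),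
    clSet_closed _ _ _ _⟩
  -- maps out of the free structure on `l` points
  let free : ∀ (W : SObj.{u} S N.n) (l : ℕ) (w : Fin l → Fin W.a),
      SHom.{v} W ⟨l + 1, 0, clSet S N.n 0 ∅, clSet_closed _ _ _ _⟩ := fun W l w =>
    ⟨Fin.cons (α := fun _ => Fin W.a) W.b w, rfl, fun t ht =>
      Cl.map W.closed (Fin.cons (α := fun _ => Fin W.a) W.b w) rfl (by simp) ht⟩
  let pr : Fin N.n → (P ⟶ X) := fun i => free P 1 (fun _ => (i.succ : Fin (N.n + 1)))
  let r : R ⟶ P := ⟨fun i => i, rfl, fun t ht =>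
    Cl.map (clSet_closed _ _ _ _) (fun i => i) rfl (by simp) ht⟩
  have hr : Mono r := ⟨fun a b hab => s_ext _ _ fun x => s_congr hab x⟩
  have two : ∀ {W : SObj.{u} S N.n} (p q : W ⟶ X), SHom.f p (1 : Fin 2) = SHom.f q (1 : Fin 2) →
      p = q := by
    intro W p q hpq
    refine s_ext _ _ fun x => ?_
    change Fin 2 at x
    fin_cases x
    · exact (SHom.pt p).trans (SHom.pt q).symm
    · exact hpq
  let hP : IsLimit (Fan.mk P pr) := Fan.IsLimit.mk _
    (fun s => free s.pt N.n (fun i => SHom.f (s.proj i) (1 : Fin 2)))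
    (fun s i => two _ _ rfl)
    (fun s m hm => s_ext _ _ fun i => by
      refine Fin.cases ?_ (fun i => ?_) (show Fin (N.n + 1) from i)
      · exact SHom.pt m
      · exact s_congr (hm i) (1 : Fin 2))
  let f : Option (Fin N.k) → (Z ⟶ X) := fun x => free Z 1 (fun _ => (enc x : Fin (N.k + 1)))
  obtain ⟨g, hg⟩ := hN X P R pr hP r hr Z f (two _ _ rfl) (by
    intro j
    let w : Fin (N.n + 1) → Fin (N.k + 1) :=
      Fin.cons (α := fun _ => Fin (N.k + 1)) 0 (fun i => enc (N.left i j))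
    refine ⟨⟨w, rfl, fun t ht => Cl.map (clSet_closed _ _ _ _) w rfl ?_ ht⟩, ?_⟩
    · rintro _ rfl
      exact Cl.base _ ⟨j, rfl⟩
    · rw [fac_iff]
      intro i
      exact two _ _ rfl)
  rw [fac_iff] at hg
  have h1 := SHom.pres g Fin.succ (Cl.base _ rfl)
  have h2 : (fun i : Fin N.n => SHom.f g (i.succ : Fin (N.n + 1))) = fun i => enc (N.right i) :=
    funext fun i => s_congr (hg i) (1 : Fin 2)
  have h3 : Cl S N.n 0 (Set.range fun j i => enc (N.left i j)) fun i => enc (N.right i) := by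
    rw [← h2]
    exact h1
  have h4 := Cl.map (clSet_closed S N.n none (Set.range fun j i => N.left i j)) dec rfl (by
    rintro _ ⟨j, rfl⟩
    simp only [dec_enc]
    exact Cl.base _ ⟨j, rfl⟩) h3
  simp only [dec_enc] at h4
  exact h4

theorem core {S : Set MatrStar} {N : MatrStar} (hSN : LexImpStar.{v, u} S N) :
    ∃ S' ⊆ S, S'.Finite ∧ LexImpStar.{v', u'} S' N := by
  by_cases hE : ∀ M ∈ S, EqC M
  · obtain ⟨S', h1, h2, h3⟩ := (complete hE hSN).finite
    exact ⟨S', h1, h2, sound h3⟩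
  push Not at hE
  obtain ⟨M, hM, hME⟩ := hE
  refine ⟨{M}, by simpa, by simp, ?_⟩
  intro C _ _ _ _ hS X P R pr hP r hr Z f hf0 hf
  refine ⟨0, ?_⟩
  rw [zero_of_not_eqC (hS M rfl) hME (hP.lift _), zero_comp]

end LexAuxStar

/-- `S ⇒_lex N` holds if and only if `S' ⇒_lex N` for some
finite subset `S' ⊆ S`; and analogously in the pointed case. -/
theorem lexImp_iff_finite_subset :
    (∀ (S : Set Matr) (N : Matr),
      LexImp S N ↔ ∃ S' ⊆ S, S'.Finite ∧ LexImp S' N) ∧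
    (∀ (S : Set MatrStar) (N : MatrStar),
      LexImpStar S N ↔ ∃ S' ⊆ S, S'.Finite ∧ LexImpStar S' N) := by
  refine ⟨fun S N => ⟨LexAux.core, ?_⟩, fun S N => ⟨LexAuxStar.core, ?_⟩⟩
  · rintro ⟨S', hS, -, h⟩
    obtain ⟨S'', hS', -, h'⟩ := LexAux.core h
    exact fun C _ _ hC => h' C fun M hM => hC M (hS (hS' hM))
  · rintro ⟨S', hS, -, h⟩
    obtain ⟨S'', hS', -, h'⟩ := LexAuxStar.core h
    exact fun C _ _ _ _ hC => h' C fun M hM => hC M (hS (hS' hM))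
end

section
/- For a set S of pointed matrices (S ⊆ matr_*), the following are equivalent: (i) every finitely complete pointed category with S-closed relations is equivalent to the single-morphism category 1 (one object and only its identity morphism); (ii) the opposite of the category of pointed sets does not have S-closed relations. -/
open CategoryTheory CategoryTheory.Limits

universe w v u

/-- The canonical zero-morphism structure on the category `Pointed` of
pointed sets: the zero morphism is the constant map at the base point. -/
instance : HasZeroMorphisms Pointed.{w} where
  zero X Y := ⟨⟨fun _ => Y.point, rfl⟩⟩
  comp_zero _ _ := Pointed.Hom.ext rfl
  zero_comp _ {_ _} f := Pointed.Hom.ext (funext fun _ => f.map_point)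

/-- Combinatorial condition on `M` characterising closedness in `Pointedᵒᵖ`. -/
def MatrStar.Good (M : MatrStar) : Prop :=
  ∀ (i i' : Fin M.n) (g h : Option (Fin M.k) → Prop), ¬ g none → ¬ h none →
    (∀ j, g (M.left i j) ↔ h (M.left i' j)) → (g (M.right i) ↔ h (M.right i'))

/-- The condition for `Prop`-valued maps gives it for maps to any pointed set. -/
theorem MatrStar.Good.apply {M : MatrStar} (hM : M.Good) {Z : Type*} (z : Z)
    (i i' : Fin M.n) (g h : Option (Fin M.k) → Z) (hg : g none = z) (hh : h none = z)
    (H : ∀ j, g (M.left i j) = h (M.left i' j)) : g (M.right i) = h (M.right i') := by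
  by_contra hne
  by_cases hz : g (M.right i) = z
  · have := hM i i' (fun p => g p = h (M.right i')) (fun p => h p = h (M.right i'))
      (by rw [hg, ← hz]; exact hne) (by rw [hh, ← hz]; exact hne)
      (fun j => by simp only [H j])
    exact hne (this.2 rfl)
  · have := hM i i' (fun p => g p = g (M.right i)) (fun p => h p = g (M.right i))
      (by rw [hg]; exact fun h => hz h.symm) (by rw [hh]; exact fun h => hz h.symm)
      (fun j => by simp only [H j])
    exact hne (this.1 rfl).symm

open Classical in
/-- If `C` has `M`-closed relations with `M` not good, then all objects are zero. -/
theorem id_eq_zero_of_not_good {C : Type u} [Category.{v} C] [HasFiniteLimits C]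
    [HasZeroMorphisms C] (M : MatrStar) (hM : ¬ M.Good)
    (hC : M.HasClosedRels C (MorphismProperty.monomorphisms C)) (Y : C) : 𝟙 Y = 0 := by
  unfold MatrStar.Good at hM
  push Not at hM
  obtain ⟨i, i', g, h, hg, hh, H, hne⟩ := hM
  let pr : Fin M.n → ((∏ᶜ fun _ : Fin M.n => (Y ⨯ Y)) ⟶ (Y ⨯ Y)) := Pi.π _
  have hP : IsLimit (Fan.mk _ pr) := productIsProduct _
  let r := equalizer.ι (pr i ≫ prod.fst) (pr i' ≫ prod.snd)
  let ind : Prop → (Y ⟶ Y) := fun p => if p then 𝟙 Y else 0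
  let f : Option (Fin M.k) → (Y ⟶ Y ⨯ Y) := fun p => prod.lift (ind (g p)) (ind (h p))
  have hfac : ∀ (c : Fin M.n → Option (Fin M.k)) (q : Fin M.n),
      hP.lift (Fan.mk Y (fun i => f (c i))) ≫ pr q = f (c q) := fun c q =>
    hP.fac (Fan.mk Y (fun i => f (c i))) ⟨q⟩
  obtain ⟨t, ht⟩ := hC _ _ _ pr hP r (inferInstanceAs (Mono (equalizer.ι _ _))) Y f
    (by simp only [f, ind, hg, hh, if_false]; ext <;> rw [zero_comp]; exacts [prod.lift_fst _ _, prod.lift_snd _ _])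
    (fun j => ⟨equalizer.lift (hP.lift (Fan.mk Y (fun i => f (M.left i j)))) (by
      have h1 := hfac (fun i => M.left i j) i
      have h2 := hfac (fun i => M.left i j) i'
      rw [← Category.assoc, ← Category.assoc, h1, h2]
      rw [prod.lift_fst, prod.lift_snd]
      simp only [ind, H j]), equalizer.lift_ι _ _⟩)
  have e : t ≫ r ≫ pr i ≫ prod.fst = t ≫ r ≫ pr i' ≫ prod.snd := by
    rw [equalizer.condition]
  rw [← Category.assoc, ht, ← Category.assoc, hfac, ← Category.assoc t, ht,
    ← Category.assoc, hfac] at e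
  simp only [f, prod.lift_fst, prod.lift_snd, ind] at e
  rcases hne with ⟨a, b⟩ | ⟨a, b⟩
  · simpa [a, b] using e
  · simpa [a, b] using e.symm

/-- A pointed category all of whose objects are zero is trivial. -/
theorem trivial_of_id_eq_zero {C : Type u} [Category.{v} C] [HasZeroObject C]
    [HasZeroMorphisms C] (h : ∀ Y : C, 𝟙 Y = 0) : Nonempty (C ≌ Discrete PUnit.{1}) := by
  have hz : ∀ Y : C, IsZero Y := fun Y => (IsZero.iff_id_eq_zero Y).2 (h Y)
  let F : C ⥤ Discrete PUnit.{1} := Functor.star C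
  have : F.Full := ⟨fun {X Y} f => ⟨0, Subsingleton.elim _ _⟩⟩
  have : F.Faithful := ⟨fun {X Y} a b _ => (hz X).eq_of_src a b⟩
  have : F.EssSurj := ⟨fun _ => ⟨(HasZeroObject.zero (C := C)).choose, ⟨eqToIso (Subsingleton.elim _ _)⟩⟩⟩
  have : F.IsEquivalence := {}
  exact ⟨F.asEquivalence⟩

section Closed

variable {E : Type u} [Category.{v} E] (G : E ⥤ Pointed.{w})

open Classical in
/-- Jointly epic families are jointly surjective. -/
theorem jointly_surj [G.Full] (Ω : E) (t : (G.obj Ω).X) (ht : t ≠ (G.obj Ω).point)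
    {I : Type*} {A : I → E} {B : E} (f : ∀ i, A i ⟶ B)
    (hf : ∀ (Z : E) (a b : B ⟶ Z), (∀ i, f i ≫ a = f i ≫ b) → a = b) [G.Faithful]
    (b : (G.obj B).X) (hb : b ≠ (G.obj B).point) :
    ∃ i a, (G.map (f i)).toFun a = b := by
  by_contra hcon
  push Not at hcon
  let p : G.obj B ⟶ G.obj Ω := ⟨fun y => if y = b then t else (G.obj Ω).point, by simp [hb.symm]⟩
  let q : G.obj B ⟶ G.obj Ω := ⟨fun _ => (G.obj Ω).point, rfl⟩
  have e := hf Ω (G.preimage p) (G.preimage q) (fun i => G.map_injective (by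
    simp only [Functor.map_comp, Functor.map_preimage]
    apply Pointed.Hom.ext
    funext a
    simp [p, q, hcon i a]))
  have e' : p = q := by simpa using congrArg G.map e
  have := congrFun (congrArg Pointed.Hom.toFun e') b
  simp [p, q] at this
  exact ht this

/-- Good matrices are closed in opposites of nice categories of pointed sets. -/
theorem closed_of_good [HasZeroMorphisms E] [G.Full] [G.Faithful]
    (hG0 : ∀ (X Y : E) x, (G.map (0 : X ⟶ Y)).toFun x = (G.obj Y).point)
    (Ω : E) (t : (G.obj Ω).X) (ht : t ≠ (G.obj Ω).point)
    (M : MatrStar) (hM : M.Good) :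
    M.HasClosedRels Eᵒᵖ (MorphismProperty.monomorphisms Eᵒᵖ) := by
  intro X P R pr hP r hr Z f hf0 hj
  have : Mono r := hr
  have : Epi r.unop := inferInstance
  -- the map out of the coproduct attached to a column
  let L : (Fin M.n → Option (Fin M.k)) → (P.unop ⟶ Z.unop) :=
    fun c => (hP.lift (Fan.mk Z (fun i => f (c i)))).unop
  have hL : ∀ c i, (pr i).unop ≫ L c = (f (c i)).unop := fun c i =>
    congrArg Quiver.Hom.unop (hP.fac (Fan.mk Z (fun i => f (c i))) ⟨i⟩)
  have hLv : ∀ c i a, (G.map (L c)).toFun ((G.map (pr i).unop).toFun a)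
      = (G.map (f (c i)).unop).toFun a := fun c i a => by
    rw [← hL c i, G.map_comp]; rfl
  have hPs : ∀ b, ∃ i a, (G.map (pr i).unop).toFun a = b := fun b => by
    by_cases hb : b = (G.obj P.unop).point
    · exact ⟨⟨0, M.npos⟩, (G.obj X.unop).point, by rw [hb]; exact Pointed.Hom.map_point _⟩
    · refine jointly_surj G Ω t ht (fun i => (pr i).unop) (fun W a b hab => ?_) b hb
      have : a.op = b.op := hP.hom_ext (fun ⟨i⟩ => congrArg Quiver.Hom.op (hab i))
      exact congrArg Quiver.Hom.unop this
  have hRs : ∀ b, ∃ a, (G.map r.unop).toFun a = b := fun b => by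
    by_cases hb : b = (G.obj R.unop).point
    · exact ⟨(G.obj P.unop).point, by rw [hb]; exact Pointed.Hom.map_point _⟩
    · obtain ⟨_, a, ha⟩ := jointly_surj G Ω t ht (fun _ : Unit => r.unop)
        (fun W a b hab => (cancel_epi r.unop).1 (hab ())) b hb
      exact ⟨a, ha⟩
  have key : ∀ x y, (G.map r.unop).toFun x = (G.map r.unop).toFun y →
      (G.map (L M.right)).toFun x = (G.map (L M.right)).toFun y := by
    intro x y hxy
    obtain ⟨i, a, rfl⟩ := hPs x
    obtain ⟨i', a', rfl⟩ := hPs y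
    rw [hLv, hLv]
    refine hM.apply (G.obj Z.unop).point i i' (fun p => (G.map (f p).unop).toFun a)
      (fun p => (G.map (f p).unop).toFun a') ?_ ?_ ?_
    · simp only [hf0]; exact hG0 _ _ _
    · simp only [hf0]; exact hG0 _ _ _
    · intro j
      obtain ⟨g, hg⟩ := hj j
      have hg' : r.unop ≫ g.unop = L (fun i => M.left i j) := congrArg Quiver.Hom.unop hg
      have h1 := hLv (fun i => M.left i j) i a
      have h2 := hLv (fun i => M.left i j) i' a'
      rw [← hg', G.map_comp] at h1 h2
      simp only [Pointed.Hom.comp_toFun', Function.comp_apply] at h1 h2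
      rw [hxy] at h1
      exact h1.symm.trans h2
  choose s hs using hRs
  let q : G.obj R.unop ⟶ G.obj Z.unop := ⟨fun b => (G.map (L M.right)).toFun (s b), by
    rw [key _ (G.obj P.unop).point (by rw [hs]; exact (Pointed.Hom.map_point _).symm)]
    exact Pointed.Hom.map_point _⟩
  refine ⟨(G.preimage q).op, ?_⟩
  have : r.unop ≫ G.preimage q = L M.right := G.map_injective (by
    rw [G.map_comp, G.map_preimage]
    apply Pointed.Hom.ext
    funext x
    exact key _ _ (hs _))
  exact congrArg Quiver.Hom.op this

end Closed

section Colim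

variable {J : Type} [SmallCategory J] (F : J ⥤ Pointed.{w})

/-- The relation defining colimits of pointed sets. -/
inductive PtRel : Option (Σ j, (F.obj j).X) → Option (Σ j, (F.obj j).X) → Prop
  | pt (j : J) : PtRel (some ⟨j, (F.obj j).point⟩) none
  | map {j j' : J} (f : j ⟶ j') (x : (F.obj j).X) :
      PtRel (some ⟨j, x⟩) (some ⟨j', (F.map f).toFun x⟩)

/-- The colimit cocone of a diagram of pointed sets. -/
def ptCocone : Cocone F where
  pt := ⟨Quot (PtRel F), Quot.mk _ none⟩
  ι :=
    { app := fun j => ⟨fun x => Quot.mk _ (some ⟨j, x⟩), Quot.sound (.pt j)⟩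
      naturality := fun j j' f => Pointed.Hom.ext (funext fun x =>
        (Quot.sound (PtRel.map f x)).symm) }

/-- The colimit cocone is a colimit. -/
def ptCoconeIsColimit : IsColimit (ptCocone F) where
  desc s := ⟨Quot.lift (fun o => o.elim s.pt.point (fun a => (s.ι.app a.1).toFun a.2)) (by
    rintro _ _ (j | ⟨f, x⟩)
    · exact (s.ι.app j).map_point
    · exact (congrFun (congrArg Pointed.Hom.toFun (s.w f)) x).symm), rfl⟩
  fac s j := rfl
  uniq s m hm := Pointed.Hom.ext (funext fun x => by
    induction x using Quot.ind with
    | mk o =>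
      cases o with
      | none => exact m.map_point
      | some a => exact congrFun (congrArg Pointed.Hom.toFun (hm a.1)) a.2)

end Colim

instance pointedHasFiniteColimits : HasFiniteColimits Pointed.{w} where
  out _ := { has_colimit := fun F => ⟨⟨⟨ptCocone F, ptCoconeIsColimit F⟩⟩⟩ }

/-- Objects of the skeleton of finite pointed sets, in arbitrary universes. -/
structure PtNatAux (T : Type v) : Type u where
  /-- number of non-base points -/
  n : ℕ

/-- Objects of the skeleton of finite pointed sets, with morphisms in universe `v`. -/
abbrev PtNat : Type u := PtNatAux.{v, u} PUnit.{v + 1}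

/-- Morphisms of finite pointed sets. -/
structure PtNatHom (X Y : PtNat.{v, u}) : Type v where
  /-- the map of pointed sets -/
  hom : (Pointed.of (none : Option (Fin X.n))) ⟶ Pointed.of (none : Option (Fin Y.n))

instance : Category.{v} PtNat.{v, u} where
  Hom X Y := PtNatHom X Y
  id X := ⟨𝟙 _⟩
  comp f g := ⟨f.hom ≫ g.hom⟩

/-- The inclusion into pointed sets. -/
def ptNatIncl : PtNat.{v, u} ⥤ Pointed.{0} where
  obj X := Pointed.of (none : Option (Fin X.n))
  map f := f.hom

instance : (ptNatIncl.{v, u}).Full := ⟨fun f => ⟨⟨f⟩, rfl⟩⟩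

instance : (ptNatIncl.{v, u}).Faithful :=
  ⟨fun {X Y} (a b : PtNatHom X Y) (h : a.hom = b.hom) =>
    show a = b by cases a; cases b; cases h; rfl⟩

instance : HasZeroMorphisms PtNat.{v, u} where
  zero X Y := ⟨(⟨0⟩ : PtNatHom X Y)⟩
  comp_zero _ _ := rfl
  zero_comp _ {_ _} f := ptNatIncl.map_injective (zero_comp (f := ptNatIncl.map f))

open Classical in
/-- Finite pointed sets are in the image of the inclusion. -/
theorem ptNat_iso (A : Pointed.{0}) [Finite A.X] :
    ∃ X : PtNat.{v, u}, Nonempty (ptNatIncl.obj X ≅ A) := by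
  obtain ⟨n, ⟨e⟩⟩ := Finite.exists_equiv_fin {a : A.X // a ≠ A.point}
  exact ⟨⟨n⟩, ⟨Pointed.Iso.mk ((Equiv.optionCongr e.symm).trans
    (Equiv.optionSubtypeNe A.point)) rfl⟩⟩

instance : HasFiniteColimits PtNat.{v, u} where
  out J _ _ := ⟨fun F => by
    have : ∀ j, Finite ((F ⋙ ptNatIncl).obj j).X := fun j =>
      inferInstanceAs (Finite (Option (Fin _)))
    have : Finite (ptCocone (F ⋙ ptNatIncl)).pt.X :=
      inferInstanceAs (Finite (Quot (PtRel (F ⋙ ptNatIncl))))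
    obtain ⟨X, ⟨i⟩⟩ := ptNat_iso.{v, u} (ptCocone (F ⋙ ptNatIncl)).pt
    letI := createsColimitOfFullyFaithfulOfIso' (ptCoconeIsColimit (F ⋙ ptNatIncl)) X i
    exact hasColimit_of_created F ptNatIncl⟩

instance : HasZeroObject PtNat.{v, u} :=
  ⟨⟨0⟩, (IsZero.iff_id_eq_zero _).2 (ptNatIncl.map_injective (Pointed.Hom.ext (funext fun x => by
    rcases x with _ | x
    · rfl
    · exact x.elim0)))⟩

theorem ptNat_nontrivial : ¬ Nonempty ((PtNat.{v, u})ᵒᵖ ≌ Discrete PUnit.{1}) := by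
  rintro ⟨e⟩
  let Ω : PtNat.{v, u} := ⟨1⟩
  have h : (𝟙 Ω).op = (0 : Ω ⟶ Ω).op := e.functor.map_injective (Subsingleton.elim _ _)
  have h1 : 𝟙 Ω = 0 := congrArg Quiver.Hom.unop h
  have h2 := congrFun (congrArg (fun f => (ptNatIncl.map f).toFun) h1) (some (0 : Fin 1))
  exact Option.some_ne_none _ h2

/-- `Pointedᵒᵖ` has `M`-closed relations exactly for good `M`. -/
theorem pointedOp_closed_iff (M : MatrStar) :
    M.HasClosedRels (Pointed.{w})ᵒᵖ (MorphismProperty.monomorphisms (Pointed.{w})ᵒᵖ) ↔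
      M.Good := by
  constructor
  · intro h
    by_contra hM
    have e := id_eq_zero_of_not_good M hM h (Opposite.op (Pointed.of (ULift.up.{w} false)))
    have e1 := congrArg Quiver.Hom.unop e
    have e2 := congrFun (congrArg Pointed.Hom.toFun e1) (ULift.up true)
    exact Bool.noConfusion (congrArg ULift.down e2)
  · intro hM
    exact closed_of_good (𝟭 _) (fun _ _ _ => rfl) (Pointed.of (ULift.up.{w} false))
      (ULift.up true) (fun e => Bool.noConfusion (congrArg ULift.down e)) M hM

/-- For a set `S` of pointed matrices, every finitely complete
pointed category with `S`-closed relations is equivalent to the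
single-morphism category `1` if and only if the opposite of the category of
pointed sets does not have `S`-closed relations. -/
theorem pointed_trivial_iff_not_PointedOp (S : Set MatrStar) :
    (∀ (C : Type u) [Category.{v} C] [HasFiniteLimits C] [HasZeroObject C]
        [HasZeroMorphisms C],
        MatrStar.HasSClosedRels S C (MorphismProperty.monomorphisms C) →
        Nonempty (C ≌ Discrete PUnit.{1})) ↔
    ¬ MatrStar.HasSClosedRels S (Pointed.{w})ᵒᵖ
        (MorphismProperty.monomorphisms (Pointed.{w})ᵒᵖ) := by
  constructor
  · intro h hS
    refine ptNat_nontrivial.{v, u} (h (PtNat.{v, u})ᵒᵖ (fun M hM => ?_))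
    exact closed_of_good ptNatIncl.{v, u} (fun _ _ _ => rfl) ⟨1⟩ (some (0 : Fin 1))
      (Option.some_ne_none _) M ((pointedOp_closed_iff M).1 (hS M hM))
  · intro h C _ _ _ _ hC
    apply trivial_of_id_eq_zero
    intro Y
    by_contra hY
    refine h (fun M hM => (pointedOp_closed_iff M).2 ?_)
    by_contra hg
    exact hY (id_eq_zero_of_not_good M hg (hC M hM) Y)
end

section
/- For a set S of pointed matrices (S ⊆ matr_*), the following are equivalent: (i) every finitely complete pointed category with S-closed relations is equivalent to the single-morphism category 1; (ii) every finitely complete pointed category with S-closed strong relations (i.e., every relation given by a strong monomorphism is M-closed for each M ∈ S) is equivalent to the single-morphism category 1. -/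
open CategoryTheory CategoryTheory.Limits

universe w v u

/-- Two rows (possibly equal) of `M`, with pointed interpretations in `{false, true}` that agree
on the left part but not on the right part. -/
def MatrStar.Conflict (M : MatrStar) : Prop :=
  ∃ (i i' : Fin M.n) (f f' : Option (Fin M.k) → Bool), f none = false ∧ f' none = false ∧
    (∀ j, f (M.left i j) = f' (M.left i' j)) ∧ f (M.right i) = true ∧ f' (M.right i') = false

/-- A conflict forces every identity to be zero, already with closed strong relations. -/
theorem MatrStar.Conflict.id_eq_zero {M : MatrStar} (h : M.Conflict) {C : Type u} [Category.{v} C]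
    [HasFiniteLimits C] [HasZeroMorphisms C] (hC : M.HasClosedRels C (strongMonos C)) (X : C) :
    𝟙 X = 0 := by
  obtain ⟨i, i', f, f', hf, hf', hl, hr, hr'⟩ := h
  let Y : C := X ⨯ X
  let P : C := ∏ᶜ (fun _ : Fin M.n => Y)
  let pr : Fin M.n → (P ⟶ Y) := fun i => Pi.π (fun _ : Fin M.n => Y) i
  let hP : IsLimit (Fan.mk P pr) := productIsProduct (fun _ : Fin M.n => Y)
  let a : P ⟶ X := pr i ≫ prod.fst
  let b : P ⟶ X := pr i' ≫ prod.snd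
  have hs : strongMonos C (equalizer.ι a b) := by
    unfold strongMonos
    infer_instance
  let c : Bool → (X ⟶ X) := fun t => if t then 𝟙 X else 0
  let F : Option (Fin M.k) → (X ⟶ Y) := fun x => prod.lift (c (f x)) (c (f' x))
  have hF1 : ∀ x, F x ≫ (prod.fst : X ⨯ X ⟶ X) = c (f x) := fun x => prod.lift_fst _ _
  have hF2 : ∀ x, F x ≫ (prod.snd : X ⨯ X ⟶ X) = c (f' x) := fun x => prod.lift_snd _ _
  have hF : F none = 0 := by
    apply Limits.prod.hom_ext
    · rw [hF1]; simp [c, hf]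
    · rw [hF2]; simp [c, hf']
  have hfac : ∀ (G : Fin M.n → (X ⟶ Y)) (j : Fin M.n),
      hP.lift (Fan.mk X G) ≫ pr j = G j := fun G j => hP.fac (Fan.mk X G) ⟨j⟩
  obtain ⟨g, hg⟩ := hC Y P _ pr hP (equalizer.ι a b) hs X F hF (by
    intro j
    refine ⟨equalizer.lift (hP.lift (Fan.mk X fun i => F (M.left i j))) ?_, ?_⟩
    · simp only [a, b]
      rw [← Category.assoc, ← Category.assoc, hfac, hfac, hF1, hF2, hl]
    · simp)
  have e : hP.lift (Fan.mk X fun i => F (M.right i)) ≫ a =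
      hP.lift (Fan.mk X fun i => F (M.right i)) ≫ b := by
    rw [← hg, Category.assoc, Category.assoc, equalizer.condition]
  simp only [a, b] at e
  rw [← Category.assoc, ← Category.assoc, hfac, hfac, hF1, hF2, hr, hr'] at e
  simpa [c] using e

/-- Pointwise action of a Boolean operation. -/
def ptw {m : ℕ} (p : (Fin m → Bool) → Bool) (a : Fin m → (ℕ → Bool)) : ℕ → Bool :=
  fun n => p (fun j => a j n)

/-- Objects: sets of sequences of Booleans closed under all zero-preserving operations
(that is, subrings of the non-unital Boolean ring of all sequences). -/
structure BObj : Type u where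
  carrier : Set (ℕ → Bool)
  closed : ∀ (m : ℕ) (p : (Fin m → Bool) → Bool), p (fun _ => false) = false →
    ∀ a : Fin m → (ℕ → Bool), (∀ j, a j ∈ carrier) → ptw p a ∈ carrier

namespace BObj

/-- The operation on an object. -/
def op (A : BObj.{u}) {m : ℕ} (p : (Fin m → Bool) → Bool) (hp : p (fun _ => false) = false)
    (a : Fin m → A.carrier) : A.carrier :=
  ⟨ptw p (fun j => (a j).1), A.closed m p hp _ (fun j => (a j).2)⟩

/-- Morphisms preserve all operations. -/
@[ext]
structure Hom (A B : BObj.{u}) : Type v where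
  toFun : A.carrier → B.carrier
  map_op : ∀ (m : ℕ) (p : (Fin m → Bool) → Bool) (hp : p (fun _ => false) = false)
    (a : Fin m → A.carrier), toFun (A.op p hp a) = B.op p hp (fun j => toFun (a j))

instance : Category.{v} BObj.{u} where
  Hom A B := Hom.{v} A B
  id A := ⟨id, fun _ _ _ _ => rfl⟩
  comp f g := ⟨fun x => g.toFun (f.toFun x), fun m p hp a => by rw [f.map_op, g.map_op]⟩

theorem hom_ext' {A B : BObj.{u}} {f g : Hom.{v} A B} (h : ∀ x, f.toFun x = g.toFun x) :
    f = g := Hom.ext (funext h)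

theorem zero_mem (A : BObj.{u}) : (fun _ => false) ∈ A.carrier :=
  A.closed 0 (fun _ => false) rfl Fin.elim0 (fun j => j.elim0)

theorem map_zero' {A B : BObj.{u}} (f : Hom.{v} A B) :
    f.toFun ⟨_, A.zero_mem⟩ = ⟨_, B.zero_mem⟩ :=
  f.map_op 0 (fun _ => false) rfl Fin.elim0

/-- The zero morphism. -/
def zeroHom (A B : BObj.{u}) : Hom.{v} A B where
  toFun _ := ⟨_, B.zero_mem⟩
  map_op m p hp a := by
    apply Subtype.ext
    funext n
    exact hp.symm

instance : HasZeroMorphisms BObj.{u} where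
  zero A B := ⟨zeroHom.{v} A B⟩
  comp_zero _ _ := rfl
  zero_comp A B C f := hom_ext' fun _ => map_zero' f

theorem zero_toFun {A B : BObj.{u}} (x : A.carrier) :
    (show Hom.{v} A B from (0 : A ⟶ B)).toFun x = ⟨_, B.zero_mem⟩ := rfl

/-- The zero object. -/
def zeroObj : BObj.{u} where
  carrier := {fun _ => false}
  closed m p hp a ha := by
    funext n
    have : (fun j => a j n) = fun _ => false := funext fun j => congrFun (ha j) n
    simp only [ptw, this, hp]

theorem zeroObj_isZero : @IsZero BObj.{u} (inferInstance : Category.{v} BObj.{u}) zeroObj := by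
  rw [IsZero.iff_id_eq_zero]
  exact hom_ext' fun x => Subtype.ext x.2

instance : @HasZeroObject BObj.{u} (inferInstance : Category.{v} BObj.{u}) :=
  ⟨⟨zeroObj, zeroObj_isZero⟩⟩

/-- All sequences. -/
def topObj : BObj.{u} where
  carrier := Set.univ
  closed _ _ _ _ _ := trivial

/-- The morphism from `topObj` picking a point. -/
def point (A : BObj.{u}) (x : A.carrier) : Hom.{v} topObj.{u} A where
  toFun a := ⟨fun n => a.1 0 && x.1 n, by
    cases h : a.1 0
    · simpa using A.zero_mem
    · simp⟩
  map_op m p hp a := by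
    apply Subtype.ext
    funext n
    simp only [op, ptw]
    cases x.1 n <;> simp [hp]

/-- The constant sequence `true`. -/
def e : (topObj.{u}).carrier := ⟨fun _ => true, trivial⟩

theorem point_e (A : BObj.{u}) (x : A.carrier) : (point.{v} A x).toFun e = x := by
  apply Subtype.ext
  funext n
  simp [point, e]

theorem point_comp {A B : BObj.{u}} (x : A.carrier) (f : A ⟶ B) :
    ((show topObj.{u} ⟶ A from point.{v} A x) ≫ f) = point.{v} B (Hom.toFun f x) := by
  apply hom_ext'
  intro a
  change Hom.toFun f _ = _
  cases h : a.1 0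
  · have h1 : (point.{v} A x).toFun a = ⟨_, A.zero_mem⟩ := by
      apply Subtype.ext; funext n; simp [point, h]
    rw [h1, map_zero']
    apply Subtype.ext; funext n; simp [point, h]
  · have h1 : (point.{v} A x).toFun a = x := by
      apply Subtype.ext; funext n; simp [point, h]
    rw [h1]
    apply Subtype.ext; funext n; simp [point, h]

theorem inj_of_mono {A B : BObj.{u}} (r : A ⟶ B) [@Mono _ (inferInstance : Category.{v} _) _ _ r] :
    Function.Injective (Hom.toFun.{v} r) := by
  intro x y h
  have h1 : (show topObj.{u} ⟶ A from point.{v} A x) = point.{v} A y := by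
    rw [← cancel_mono r]
    rw [point_comp, h]
    exact (point_comp y r).symm
  have h2 := congrArg (fun t : Hom.{v} topObj A => t.toFun e) h1
  simpa [point_e] using h2

section pullback

variable {A B X : BObj.{u}} (f : Hom.{v} A X) (g : Hom.{v} B X)

/-- Pullbacks, by interleaving sequences. -/
def pb : BObj.{u} where
  carrier := {c | ∃ (ha : (fun n => c (2 * n)) ∈ A.carrier)
    (hb : (fun n => c (2 * n + 1)) ∈ B.carrier), f.toFun ⟨_, ha⟩ = g.toFun ⟨_, hb⟩}
  closed m p hp a ha := by
    choose h1 h2 h3 using ha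
    refine ⟨A.closed m p hp _ h1, B.closed m p hp _ h2, ?_⟩
    have e1 := f.map_op m p hp (fun j => ⟨_, h1 j⟩)
    have e2 := g.map_op m p hp (fun j => ⟨_, h2 j⟩)
    simp only [h3] at e1
    exact e1.trans e2.symm

/-- First projection. -/
def pbFst : Hom.{v} (pb f g) A where
  toFun c := ⟨fun n => c.1 (2 * n), c.2.1⟩
  map_op _ _ _ _ := rfl

/-- Second projection. -/
def pbSnd : Hom.{v} (pb f g) B where
  toFun c := ⟨fun n => c.1 (2 * n + 1), c.2.2.1⟩
  map_op _ _ _ _ := rfl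

theorem pb_ext (c d : (pb f g).carrier) (h1 : (pbFst f g).toFun c = (pbFst f g).toFun d)
    (h2 : (pbSnd f g).toFun c = (pbSnd f g).toFun d) : c = d := by
  apply Subtype.ext
  funext n
  have h1 := congrFun (congrArg Subtype.val h1) (n / 2)
  have h2 := congrFun (congrArg Subtype.val h2) (n / 2)
  simp only [pbFst, pbSnd] at h1 h2
  rcases Nat.mod_two_eq_zero_or_one n with h | h
  · rwa [show 2 * (n / 2) = n by omega] at h1
  · rwa [show 2 * (n / 2) + 1 = n by omega] at h2

/-- Interleaving. -/
def inter (a b : ℕ → Bool) : ℕ → Bool := fun n => if n % 2 = 0 then a (n / 2) else b (n / 2)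

theorem inter_even (a b : ℕ → Bool) : (fun n => inter a b (2 * n)) = a := by
  funext n; simp [inter]

theorem inter_odd (a b : ℕ → Bool) : (fun n => inter a b (2 * n + 1)) = b := by
  funext n
  have h1 : (2 * n + 1) % 2 = 1 := by omega
  have h2 : (2 * n + 1) / 2 = n := by omega
  simp [inter, h1, h2]

/-- An element of the pullback. -/
def pbMk (x : A.carrier) (y : B.carrier) (h : f.toFun x = g.toFun y) : (pb f g).carrier :=
  ⟨inter x.1 y.1, by rw [inter_even]; exact x.2, by rw [inter_odd]; exact y.2, by
    simpa only [inter_even, inter_odd] using h⟩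

theorem pbFst_mk (x : A.carrier) (y : B.carrier) (h : f.toFun x = g.toFun y) :
    (pbFst f g).toFun (pbMk f g x y h) = x := Subtype.ext (inter_even _ _)

theorem pbSnd_mk (x : A.carrier) (y : B.carrier) (h : f.toFun x = g.toFun y) :
    (pbSnd f g).toFun (pbMk f g x y h) = y := Subtype.ext (inter_odd _ _)

/-- Lift into the pullback. -/
def pbLift {Z : BObj.{u}} (a : Hom.{v} Z A) (b : Hom.{v} Z B)
    (h : ∀ z, f.toFun (a.toFun z) = g.toFun (b.toFun z)) : Hom.{v} Z (pb f g) where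
  toFun z := pbMk f g (a.toFun z) (b.toFun z) (h z)
  map_op m p hp c := by
    apply pb_ext
    · rw [pbFst_mk, Hom.map_op, Hom.map_op]
      simp only [pbFst_mk]
    · rw [pbSnd_mk, Hom.map_op, Hom.map_op]
      simp only [pbSnd_mk]

end pullback

theorem hasLimit_cospan' {A B X : BObj.{u}} (f : A ⟶ X) (g : B ⟶ X) :
    @HasLimit _ _ BObj.{u} (inferInstance : Category.{v} BObj.{u}) (cospan f g) := by
  have w : (show pb.{v} f g ⟶ A from pbFst.{v} f g) ≫ f =
      (show pb.{v} f g ⟶ B from pbSnd.{v} f g) ≫ g := hom_ext' fun c => c.2.2.2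
  refine ⟨⟨⟨PullbackCone.mk _ _ w, ?_⟩⟩⟩
  refine PullbackCone.IsLimit.mk w
    (fun s => pbLift.{v} f g s.fst s.snd
      (fun z => congrArg (fun t : Hom.{v} _ X => t.toFun z) s.condition)) ?_ ?_ ?_
  · intro s
    exact hom_ext' fun z => pbFst_mk f g (Hom.toFun s.fst z) (Hom.toFun s.snd z)
      (congrArg (fun t : Hom.{v} _ X => t.toFun z) s.condition)
  · intro s
    exact hom_ext' fun z => pbSnd_mk f g (Hom.toFun s.fst z) (Hom.toFun s.snd z)
      (congrArg (fun t : Hom.{v} _ X => t.toFun z) s.condition)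
  · intro s m h1 h2
    apply hom_ext'
    intro z
    apply pb_ext
    · refine Eq.trans ?_ (pbFst_mk f g (Hom.toFun s.fst z) (Hom.toFun s.snd z)
        (congrArg (fun t : Hom.{v} _ X => t.toFun z) s.condition)).symm
      exact congrArg (fun t : Hom.{v} _ A => t.toFun z) h1
    · refine Eq.trans ?_ (pbSnd_mk f g (Hom.toFun s.fst z) (Hom.toFun s.snd z)
        (congrArg (fun t : Hom.{v} _ X => t.toFun z) s.condition)).symm
      exact congrArg (fun t : Hom.{v} _ B => t.toFun z) h2

instance : @HasFiniteLimits BObj.{u} (inferInstance : Category.{v} BObj.{u}) := by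
  have h1 : @HasPullbacks BObj.{u} (inferInstance : Category.{v} BObj.{u}) :=
    @hasPullbacks_of_hasLimit_cospan _ _ (fun {_ _ _ f g} => hasLimit_cospan' f g)
  exact hasFiniteLimits_of_hasTerminal_and_pullbacks

open Classical in
/-- The operation attached to a matrix. -/
noncomputable def term (M : MatrStar) (w : Fin M.m → Bool) : Bool :=
  decide (∃ (i : Fin M.n) (f : Option (Fin M.k) → Bool), f none = false ∧
    (∀ j, f (M.left i j) = w j) ∧ f (M.right i) = true)

theorem term_eq {M : MatrStar} (h : ¬ M.Conflict) (i : Fin M.n) (f : Option (Fin M.k) → Bool)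
    (hf : f none = false) : term M (fun j => f (M.left i j)) = f (M.right i) := by
  cases hr : f (M.right i)
  · simp only [term, decide_eq_false_iff_not]
    rintro ⟨i', f', hf', hl, hr'⟩
    exact h ⟨i', i, f', f, hf', hf, hl, hr', hr⟩
  · simp only [term, decide_eq_true_iff]
    exact ⟨i, f, hf, fun _ => rfl, hr⟩

theorem term_zero {M : MatrStar} (h : ¬ M.Conflict) : term M (fun _ => false) = false :=
  term_eq h ⟨0, M.npos⟩ (fun _ => false) rfl

theorem closedRels {M : MatrStar} (h : ¬ M.Conflict) :
    @MatrStar.HasClosedRels M BObj.{u} (inferInstance : Category.{v} BObj.{u}) _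
      (MorphismProperty.monomorphisms _) := by
  intro X P R pr hP r hr Z f hf hl
  have : Mono r := hr
  have hinj := inj_of_mono.{v} r
  choose g hg using hl
  have hP_ext : ∀ a b : P.carrier, (∀ i, Hom.toFun.{v} (pr i) a = Hom.toFun.{v} (pr i) b) →
      a = b := by
    intro a b hab
    have h1 : (show topObj.{u} ⟶ P from point.{v} P a) = point.{v} P b := by
      apply hP.hom_ext
      rintro ⟨i⟩
      refine (point_comp a (pr i)).trans (Eq.trans ?_ (point_comp b (pr i)).symm)
      rw [hab]
    have h2 := congrArg (fun t : Hom.{v} topObj P => t.toFun e) h1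
    simpa [point_e] using h2
  have hfac : ∀ (G : Fin M.n → (Z ⟶ X)) (i : Fin M.n) (z : Z.carrier),
      Hom.toFun.{v} (pr i) (Hom.toFun.{v} (hP.lift (Fan.mk Z G)) z) = Hom.toFun.{v} (G i) z :=
    fun G i z => congrArg (fun t : Hom.{v} Z X => t.toFun z) (hP.fac (Fan.mk Z G) ⟨i⟩)
  have key : ∀ z, Hom.toFun.{v} r (R.op (term M) (term_zero h) (fun j => Hom.toFun.{v} (g j) z)) =
      Hom.toFun.{v} (hP.lift (Fan.mk Z (fun i => f (M.right i)))) z := by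
    intro z
    apply hP_ext
    intro i
    rw [hfac, Hom.map_op, Hom.map_op]
    have h3 : ∀ j, Hom.toFun.{v} r (Hom.toFun.{v} (g j) z) =
        Hom.toFun.{v} (hP.lift (Fan.mk Z (fun i => f (M.left i j)))) z :=
      fun j => congrArg (fun t : Hom.{v} Z P => t.toFun z) (hg j)
    simp only [h3, hfac]
    apply Subtype.ext
    funext n
    refine term_eq h i (fun x => (Hom.toFun.{v} (f x) z).1 n) ?_
    simp only [hf]
    rfl
  refine ⟨Hom.mk (fun z => R.op (term M) (term_zero h) (fun j => Hom.toFun.{v} (g j) z)) ?_, ?_⟩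
  · intro m p hp a
    apply hinj
    rw [key, Hom.map_op r]
    simp only [key]
    exact Hom.map_op _ _ _ _ _
  · exact hom_ext' key

end BObj

/-- For a set `S` of pointed matrices, every finitely complete
pointed category with `S`-closed relations is equivalent to the
single-morphism category `1` if and only if every finitely complete pointed
category with `S`-closed strong relations is equivalent to the
single-morphism category `1`. -/
theorem pointed_trivial_iff_weakly_trivial (S : Set MatrStar) :
    (∀ (C : Type u) [Category.{v} C] [HasFiniteLimits C] [HasZeroObject C]
        [HasZeroMorphisms C],
        MatrStar.HasSClosedRels S C (MorphismProperty.monomorphisms C) →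
        Nonempty (C ≌ Discrete PUnit.{1})) ↔
    (∀ (C : Type u) [Category.{v} C] [HasFiniteLimits C] [HasZeroObject C]
        [HasZeroMorphisms C],
        MatrStar.HasSClosedRels S C (strongMonos C) →
        Nonempty (C ≌ Discrete PUnit.{1})) := by
  constructor
  · intro h C _ _ _ _ hC
    by_cases hS : ∃ M ∈ S, M.Conflict
    · obtain ⟨M, hM, hc⟩ := hS
      have hz : ∀ X : C, 𝟙 X = 0 := hc.id_eq_zero (hC M hM)
      rw [equiv_punit_iff_unique]
      refine ⟨⟨(HasZeroObject.zero' C).zero⟩, fun x y => ⟨⟨⟨0⟩, fun f => ?_⟩⟩⟩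
      rw [← Category.id_comp f, hz x, zero_comp]
      rfl
    · obtain ⟨E⟩ := h BObj.{u} (fun M hM => BObj.closedRels fun hc => hS ⟨M, hM, hc⟩)
      have h1 : (𝟙 BObj.topObj.{u} : BObj.topObj.{u} ⟶ BObj.topObj.{u}) = 0 :=
        E.functor.map_injective (Subsingleton.elim _ _)
      have h2 := congrArg
        (fun t : BObj.Hom.{v} BObj.topObj BObj.topObj => (t.toFun BObj.e).1 0) h1
      exact Bool.noConfusion (show true = false from h2)
  · intro h C _ _ _ _ hC
    refine h C fun M hM X P R pr hP r hr => hC M hM X P R pr hP r ?_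
    have : StrongMono r := hr
    exact this.mono
end

section
/- Let S be a set of pointed matrices (S ⊆ matr_*) and N ∈ matr_* a pointed matrix. Then the following are equivalent: (i) every finitely complete pointed category with S-closed relations has N-closed relations; (ii) every finitely complete pointed category with S-closed strong relations has N-closed strong relations. -/
open CategoryTheory CategoryTheory.Limits

universe w v u

namespace PLex

section Generic

variable {C : Type u} [Category.{v} C] [HasZeroMorphisms C]

/-- Componentwise reformulation of `M`-closedness. -/
theorem isClosed_iff (M : MatrStar) {X P R : C} (pr : Fin M.n → (P ⟶ X))
    (hP : IsLimit (Fan.mk P pr)) (r : R ⟶ P) :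
    M.IsClosed pr hP r ↔ ∀ (Z : C) (f : Option (Fin M.k) → (Z ⟶ X)), f none = 0 →
      ((∀ j : Fin M.m, ∃ g : Z ⟶ R, ∀ i, g ≫ r ≫ pr i = f (M.left i j)) →
        ∃ g : Z ⟶ R, ∀ i, g ≫ r ≫ pr i = f (M.right i)) := by
  have key : ∀ {Z : C} (q : Fin M.n → (Z ⟶ X)) (g : Z ⟶ R),
      g ≫ r = hP.lift (Fan.mk Z q) ↔ ∀ i, g ≫ r ≫ pr i = q i := by
    intro Z q g
    have fac : ∀ i, hP.lift (Fan.mk Z q) ≫ pr i = q i := fun i =>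
      hP.fac (Fan.mk Z q) ⟨i⟩
    constructor
    · intro h i
      rw [← Category.assoc, h, fac]
    · intro h
      refine Fan.IsLimit.hom_ext hP _ _ (fun i => ?_)
      change (g ≫ r) ≫ pr i = _ ≫ pr i
      rw [fac, Category.assoc, h]
  unfold MatrStar.IsClosed
  simp only [key]

/-- A set `ρ` of `n`-tuples of a pointed set is closed under the rules given by `S`. -/
def RClosed (S : Set MatrStar) {A : Type*} (z : A) {n : ℕ} (ρ : Set (Fin n → A)) : Prop :=
  ∀ M ∈ S, ∀ (φ : Fin n → Fin M.n) (g : Fin n → Option (Fin M.k) → A),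
    (∀ l, g l none = z) → (∀ j, (fun l => g l (M.left (φ l) j)) ∈ ρ) →
    (fun l => g l (M.right (φ l))) ∈ ρ

/-- The right column of `N` is derivable from the left columns by the rules in `S`. -/
def Deriv (S : Set MatrStar) (N : MatrStar) : Prop :=
  ∀ ρ : Set (Fin N.n → Option (Fin N.k)), RClosed S none ρ → (fun _ => none) ∈ ρ →
    (∀ j, (fun i => N.left i j) ∈ ρ) → N.right ∈ ρ

/-- Equality on the two-element pointed set is compatible with the rules in `S`. -/
def Nondeg (S : Set MatrStar) : Prop :=
  ∀ M ∈ S, ∀ (i i' : Fin M.n) (g g' : Option (Fin M.k) → Bool), g none = false →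
    g' none = false → (∀ j, g (M.left i j) = g' (M.left i' j)) → g (M.right i) = g' (M.right i')

theorem Nondeg.eq {S : Set MatrStar} (h : Nondeg S) {A : Type*} {z : A} {M : MatrStar}
    (hM : M ∈ S) (i i' : Fin M.n) (g g' : Option (Fin M.k) → A) (hg : g none = z)
    (hg' : g' none = z) (hl : ∀ j, g (M.left i j) = g' (M.left i' j)) :
    g (M.right i) = g' (M.right i') := by
  classical
  by_contra hne
  by_cases hz : g (M.right i) = z
  · have := h M hM i i' (fun e => decide (g e = g' (M.right i')))
      (fun e => decide (g' e = g' (M.right i')))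
    simp only [hg, hg', hl] at this
    have h2 : z ≠ g' (M.right i') := by rw [← hz]; exact hne
    simp [h2, hne] at this
  · have := h M hM i i' (fun e => decide (g e = g (M.right i)))
      (fun e => decide (g' e = g (M.right i)))
    simp only [hg, hg', hl] at this
    have h2 : z ≠ g (M.right i) := fun e => hz e.symm
    have h3 : g' (M.right i') ≠ g (M.right i) := fun e => hne e.symm
    simp [h2, h3] at this

theorem strict [HasFiniteLimits C] {W : MorphismProperty C}
    [W.IsStableUnderBaseChange] {M : MatrStar} (hM : M.HasClosedRels C W)
    {n : ℕ} {X P R : C} (pr : Fin n → (P ⟶ X)) (hP : IsLimit (Fan.mk P pr)) (r : R ⟶ P)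
    (hr : W r) {Z : C} (φ : Fin n → Fin M.n) (F : Fin n → Option (Fin M.k) → (Z ⟶ X))
    (hF : ∀ l, F l none = 0)
    (hl : ∀ j, ∃ h : Z ⟶ R, ∀ l, h ≫ r ≫ pr l = F l (M.left (φ l) j)) :
    ∃ h : Z ⟶ R, ∀ l, h ≫ r ≫ pr l = F l (M.right (φ l)) := by
  have ext : ∀ {T : C} (a b : T ⟶ P), (∀ l, a ≫ pr l = b ≫ pr l) → a = b := fun a b h =>
    Fan.IsLimit.hom_ext hP a b h
  have lft : ∀ {T : C} (q : Fin n → (T ⟶ X)), ∃ a : T ⟶ P, ∀ l, a ≫ pr l = q l := fun q =>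
    ⟨hP.lift (Fan.mk _ q), fun l => hP.fac (Fan.mk _ q) ⟨l⟩⟩
  let Q : C := ∏ᶜ (fun _ : Fin M.n => P)
  let q : Fin M.n → (Q ⟶ P) := Pi.π (fun _ : Fin M.n => P)
  obtain ⟨t, ht⟩ := lft (fun l => q (φ l) ≫ pr l)
  choose f hf using fun e => lft (fun l => F l e)
  have hc := hM P Q (pullback r t) q (productIsProduct _) (pullback.snd r t)
    (W.pullback_snd _ _ hr)
  rw [isClosed_iff] at hc
  obtain ⟨g, hg⟩ := hc Z f (ext _ _ (fun l => by rw [hf, hF, zero_comp])) (by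
    intro j
    obtain ⟨h, hh⟩ := hl j
    refine ⟨pullback.lift h (Pi.lift fun i => f (M.left i j)) (ext _ _ fun l => ?_), fun i => ?_⟩
    · rw [Category.assoc, hh, Category.assoc, ht, ← Category.assoc]
      simp [q, hf]
    · rw [pullback.lift_snd_assoc]
      simp [q])
  refine ⟨g ≫ pullback.fst r t, fun l => ?_⟩
  rw [Category.assoc, pullback.condition_assoc, ht, ← Category.assoc (pullback.snd r t),
    ← Category.assoc, hg, hf]

theorem closed_of_deriv [HasFiniteLimits C] {W : MorphismProperty C}
    [W.IsStableUnderBaseChange]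
    (hW : ∀ {X Y : C} (f : X ⟶ Y), IsSplitMono f → W f) {S : Set MatrStar} {N : MatrStar}
    (hS : MatrStar.HasSClosedRels S C W) (hD : Nondeg S → Deriv S N) :
    N.HasClosedRels C W := by
  intro X P R pr hP r hr
  rw [isClosed_iff]
  intro Z f hf hl
  by_cases hnd : Nondeg S
  · exact hD hnd {c | ∃ h : Z ⟶ R, ∀ l, h ≫ r ≫ pr l = f (c l)}
      (fun M hM φ g hg hc => strict (hS M hM) pr hP r hr φ (fun l e => f (g l e))
        (fun l => by rw [hg, hf]) hc)
      ⟨0, fun l => by simp [hf]⟩ hl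
  · have hid : 𝟙 X = 0 := by
      unfold Nondeg at hnd
      push Not at hnd
      obtain ⟨M, hM, i, i', g, g', h1, h2, h3, h4⟩ := hnd
      let d : X ⟶ ∏ᶜ (fun _ : Fin 2 => X) := Pi.lift fun _ => 𝟙 X
      have hd : IsSplitMono d := ⟨⟨⟨Pi.π _ 0, by simp [d]⟩⟩⟩
      let b : Bool → (X ⟶ X) := fun c => if c then 𝟙 X else 0
      obtain ⟨h, hh⟩ := strict (hS M hM) _ (productIsProduct (fun _ : Fin 2 => X)) d
        (hW d hd) (![i, i']) (![fun e => b (g e), fun e => b (g' e)])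
        (by intro l; fin_cases l <;> simp [h1, h2, b])
        (by
          intro j
          refine ⟨b (g (M.left i j)), fun l => ?_⟩
          fin_cases l
          · simp [d]
          · simp [d, h3])
      have e0 := hh 0
      have e1 := hh 1
      simp [d] at e0 e1
      have := e0.symm.trans e1
      cases hgi : g (M.right i) <;> cases hgi' : g' (M.right i') <;>
        simp_all [b]
    refine ⟨0, fun i => ?_⟩
    rw [← Category.comp_id (f _), hid]
    simp

end Generic

section Transfer

instance strongMonos_stable (C : Type u) [Category.{v} C] :
    (strongMonos C).IsStableUnderBaseChange where
  of_isPullback {X Y Y' S f g f' g'} sq hg := by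
    have : StrongMono g := hg
    have hm : Mono g' := (MorphismProperty.monomorphisms C).of_isPullback sq
      (show Mono g from inferInstance)
    exact ⟨hm, fun _ _ z _ => sq.hasLiftingProperty z⟩

theorem strongMonos_split {C : Type u} [Category.{v} C] {X Y : C} (f : X ⟶ Y)
    (hf : IsSplitMono f) : strongMonos C f := by
  have : IsRegularMono f := inferInstance
  exact (IsRegularMono.getStruct f).strongMono

theorem strongMono_map {C : Type*} [Category* C] {D : Type*} [Category* D] (G : C ⥤ D)
    [G.IsEquivalence] {X Y : C} (f : X ⟶ Y) [StrongMono f] : StrongMono (G.map f) := by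
  refine ⟨inferInstance, fun A B z _ => ?_⟩
  change HasLiftingProperty z (G.asEquivalence.symm.inverse.map f)
  rw [← G.asEquivalence.symm.toAdjunction.hasLiftingProperty_iff]
  have : Epi (G.asEquivalence.symm.functor.map z) := inferInstance
  infer_instance

theorem closed_transfer {C : Type*} [Category* C] [HasZeroMorphisms C]
    {D : Type*} [Category* D] [HasZeroMorphisms D] (G : D ⥤ C) [G.IsEquivalence]
    (W : MorphismProperty C) (W' : MorphismProperty D)
    (hW : ∀ {X Y : D} (f : X ⟶ Y), W' f → W (G.map f)) {M : MatrStar}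
    (h : M.HasClosedRels C W) : M.HasClosedRels D W' := by
  intro X P R pr hP r hr
  have hc := h (G.obj X) (G.obj P) (G.obj R) (fun i => G.map (pr i))
    (isLimitFanMkObjOfIsLimit G (fun _ => X) pr hP) (G.map r) (hW r hr)
  rw [isClosed_iff] at hc ⊢
  intro Z f hf hl
  obtain ⟨g, hg⟩ := hc (G.obj Z) (fun e => G.map (f e)) (by simp [hf]) (by
    intro j
    obtain ⟨g, hg⟩ := hl j
    exact ⟨G.map g, fun i => by rw [← hg, G.map_comp, G.map_comp]⟩)
  refine ⟨G.preimage g, fun i => G.map_injective ?_⟩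
  rw [G.map_comp, G.map_comp, G.map_preimage, hg]

theorem hasZeroObject_transfer {C : Type*} [Category* C] {D : Type*} [Category* D] (G : D ⥤ C)
    [G.IsEquivalence] [HasZeroObject C] : HasZeroObject D := by
  obtain ⟨Z, hZ⟩ := HasZeroObject.zero (C := C)
  have hZ' : IsZero (G.obj (G.objPreimage Z)) := hZ.of_iso (G.objObjPreimageIso Z)
  refine ⟨⟨G.objPreimage Z, fun Y => ⟨⟨⟨G.preimage (hZ'.to_ (G.obj Y))⟩, fun a => ?_⟩⟩,
    fun Y => ⟨⟨⟨G.preimage (hZ'.from_ (G.obj Y))⟩, fun a => ?_⟩⟩⟩⟩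
  · exact G.map_injective (hZ'.eq_of_src _ _)
  · exact G.map_injective (hZ'.eq_of_tgt _ _)

/-- Any essentially small example can be moved to the universe levels `u`, `v`. -/
theorem mono_transfer {C : Type 1} [Category.{0} C] [HasFiniteLimits C] [HasZeroObject C]
    [HasZeroMorphisms C] {D₀ : Type} [Category.{0} D₀] (e : C ≌ D₀)
    (S : Set MatrStar) (N : MatrStar)
    (H : ∀ (C : Type u) [Category.{v} C] [HasFiniteLimits C] [HasZeroObject C]
        [HasZeroMorphisms C],
        MatrStar.HasSClosedRels S C (MorphismProperty.monomorphisms C) →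
        MatrStar.HasClosedRels N C (MorphismProperty.monomorphisms C))
    (hS : MatrStar.HasSClosedRels S C (MorphismProperty.monomorphisms C)) :
    MatrStar.HasClosedRels N C (MorphismProperty.monomorphisms C) := by
  let D : Type u := ULiftHom.{v} (ULift.{u} D₀)
  let E : C ≌ D := e.trans (ULiftHomULiftCategory.equiv.{v, u} D₀)
  have : HasFiniteLimits D := ⟨fun J _ _ =>
    Adjunction.hasLimitsOfShape_of_equivalence E.inverse⟩
  have : HasZeroObject D := hasZeroObject_transfer E.inverse
  let _ : HasZeroMorphisms D := HasZeroObject.zeroMorphismsOfZeroObject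
  refine closed_transfer E.functor _ _ ?_ (H D (fun M hM =>
    closed_transfer E.inverse _ _ ?_ (hS M hM)))
  · intro X Y f (hf : Mono f)
    exact (inferInstance : Mono (E.functor.map f))
  · intro X Y f (hf : Mono f)
    exact (inferInstance : Mono (E.inverse.map f))

theorem strong_transfer {C : Type 1} [Category.{0} C] [HasFiniteLimits C] [HasZeroObject C]
    [HasZeroMorphisms C] {D₀ : Type} [Category.{0} D₀] (e : C ≌ D₀)
    (S : Set MatrStar) (N : MatrStar)
    (H : ∀ (C : Type u) [Category.{v} C] [HasFiniteLimits C] [HasZeroObject C]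
        [HasZeroMorphisms C],
        MatrStar.HasSClosedRels S C (strongMonos C) →
        MatrStar.HasClosedRels N C (strongMonos C))
    (hS : MatrStar.HasSClosedRels S C (strongMonos C)) :
    MatrStar.HasClosedRels N C (strongMonos C) := by
  let D : Type u := ULiftHom.{v} (ULift.{u} D₀)
  let E : C ≌ D := e.trans (ULiftHomULiftCategory.equiv.{v, u} D₀)
  have : HasFiniteLimits D := ⟨fun J _ _ =>
    Adjunction.hasLimitsOfShape_of_equivalence E.inverse⟩
  have : HasZeroObject D := hasZeroObject_transfer E.inverse
  let _ : HasZeroMorphisms D := HasZeroObject.zeroMorphismsOfZeroObject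
  refine closed_transfer E.functor _ _ ?_ (H D (fun M hM =>
    closed_transfer E.inverse _ _ ?_ (hS M hM)))
  · intro X Y f (hf : StrongMono f)
    exact strongMono_map E.functor f
  · intro X Y f (hf : StrongMono f)
    exact strongMono_map E.inverse f

end Transfer

set_option linter.unusedVariables false

section PartialAlgebras

/-- Finite pointed sets with, for every `M ∈ S`, a partial operation defined at least on the
instances of the rows of `M`. -/
structure PAlg (S : Set MatrStar) : Type 1 where
  carrier : Type
  fin : Finite carrier
  pt : carrier
  op : ∀ M : MatrStar, M ∈ S → (Fin M.m → carrier) → carrier → Prop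
  func : ∀ M hM x a b, op M hM x a → op M hM x b → a = b
  row : ∀ M hM i (f : Option (Fin M.k) → carrier), f none = pt →
    op M hM (fun j => f (M.left i j)) (f (M.right i))

namespace PAlg

variable {S : Set MatrStar}

@[ext]
structure Hom (A B : PAlg S) : Type where
  toFun : A.carrier → B.carrier
  map_pt : toFun A.pt = B.pt
  map_op : ∀ M hM x a, A.op M hM x a → B.op M hM (fun j => toFun (x j)) (toFun a)

instance : Category.{0} (PAlg S) where
  Hom := Hom
  id A := ⟨id, rfl, fun _ _ _ _ h => h⟩
  comp f g := ⟨fun x => g.toFun (f.toFun x), by rw [f.map_pt, g.map_pt],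
    fun M hM x a h => g.map_op M hM _ _ (f.map_op M hM x a h)⟩

def fn {A B : PAlg S} (f : A ⟶ B) : A.carrier → B.carrier := Hom.toFun f

theorem fn_pt {A B : PAlg S} (f : A ⟶ B) : fn f A.pt = B.pt := Hom.map_pt f

theorem fn_op {A B : PAlg S} (f : A ⟶ B) {M hM x a} (h : A.op M hM x a) :
    B.op M hM (fun j => fn f (x j)) (fn f a) := Hom.map_op f M hM x a h

@[simp] theorem fn_comp {A B C : PAlg S} (f : A ⟶ B) (g : B ⟶ C) (x : A.carrier) :
    fn (f ≫ g) x = fn g (fn f x) := rfl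

@[simp] theorem fn_id {A : PAlg S} (x : A.carrier) : fn (𝟙 A) x = x := rfl

theorem hom_ext {A B : PAlg S} {f g : A ⟶ B} (h : ∀ x, fn f x = fn g x) : f = g :=
  Hom.ext (funext h)

def mkHom {A B : PAlg S} (f : A.carrier → B.carrier) (h : f A.pt = B.pt)
    (h' : ∀ M hM x a, A.op M hM x a → B.op M hM (fun j => f (x j)) (f a)) : A ⟶ B :=
  Hom.mk f h h'

@[simp] theorem fn_mkHom {A B : PAlg S} (f : A.carrier → B.carrier) (h : f A.pt = B.pt)
    (h' : ∀ M hM x a, A.op M hM x a → B.op M hM (fun j => f (x j)) (f a)) (x : A.carrier) :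
    fn (mkHom f h h') x = f x := rfl

theorem op_pt (A : PAlg S) (M) (hM : M ∈ S) : A.op M hM (fun _ => A.pt) A.pt :=
  A.row M hM ⟨0, M.npos⟩ (fun _ => A.pt) rfl

instance : HasZeroMorphisms (PAlg S) where
  zero A B := ⟨mkHom (fun _ => B.pt) rfl (fun M hM _ _ _ => B.op_pt M hM)⟩
  comp_zero _ _ := rfl
  zero_comp _ {_ _} f := hom_ext fun _ => fn_pt f

@[simp] theorem fn_zero {A B : PAlg S} (x : A.carrier) : fn (0 : A ⟶ B) x = B.pt := rfl

instance : HasZeroObject (PAlg S) := by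
  let Z : PAlg S := ⟨Unit, inferInstance, (), fun _ _ _ _ => True, fun _ _ _ _ _ _ _ => rfl,
    fun _ _ _ _ _ => trivial⟩
  refine ⟨⟨Z, fun Y => ⟨⟨⟨0⟩, fun a => hom_ext fun x => ?_⟩⟩, fun Y => ⟨⟨⟨0⟩, fun a => ?_⟩⟩⟩⟩
  · exact fn_pt a
  · exact hom_ext fun x => rfl

/-- The limit of a finite diagram. -/
def lim {J : Type} [SmallCategory J] [FinCategory J] (F : J ⥤ PAlg S) : PAlg S where
  carrier := {x : ∀ j, (F.obj j).carrier // ∀ {i j} (f : i ⟶ j), fn (F.map f) (x i) = x j}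
  fin := by
    have : ∀ j, Finite (F.obj j).carrier := fun j => (F.obj j).fin
    infer_instance
  pt := ⟨fun j => (F.obj j).pt, fun f => fn_pt _⟩
  op M hM x a := ∀ j, (F.obj j).op M hM (fun l => (x l).1 j) (a.1 j)
  func M hM x a b ha hb := Subtype.ext (funext fun j => (F.obj j).func M hM _ _ _ (ha j) (hb j))
  row M hM i f hf j := (F.obj j).row M hM i (fun e => (f e).1 j) (by rw [hf])

instance : HasFiniteLimits (PAlg S) := ⟨fun J _ _ => ⟨fun F => by
  let c : Cone F :=
    { pt := lim F
      π :=
        { app := fun j => mkHom (B := F.obj j) (fun x : (lim F).carrier => x.1 j) rfl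
            (fun M hM x a h => h j)
          naturality := fun i j f => hom_ext fun x => (x.2 f).symm } }
  refine ⟨⟨c, ⟨fun s => mkHom (B := lim F) (fun x => ⟨fun j => fn (s.π.app j) x, fun {i j} f => ?_⟩)
    (Subtype.ext (funext fun j => fn_pt _)) (fun M hM x a h j => fn_op _ h),
    fun s j => rfl, fun s m hm => hom_ext fun x => Subtype.ext (funext fun j => ?_)⟩⟩⟩
  · rw [← fn_comp, s.w]
  · exact congrArg (fun g => fn g x) (hm j)⟩⟩

/-- Powers. -/
def pow (X : PAlg S) (n : ℕ) : PAlg S where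
  carrier := Fin n → X.carrier
  fin := by
    have := X.fin
    infer_instance
  pt := fun _ => X.pt
  op M hM x a := ∀ j, X.op M hM (fun l => x l j) (a j)
  func M hM x a b ha hb := funext fun j => X.func M hM _ _ _ (ha j) (hb j)
  row M hM i f hf j := X.row M hM i (fun e => f e j) (by rw [hf])

def proj (X : PAlg S) (n : ℕ) (i : Fin n) : pow X n ⟶ X :=
  mkHom (A := pow X n) (fun x => x i) rfl (fun M hM x a h => h i)

def powLift {X Z : PAlg S} {n : ℕ} (q : Fin n → (Z ⟶ X)) : Z ⟶ pow X n :=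
  mkHom (B := pow X n) (fun z i => fn (q i) z) (funext fun i => fn_pt (q i))
    (fun M hM x a h j => fn_op (q j) h)

def powIsLimit (X : PAlg S) (n : ℕ) : IsLimit (Fan.mk (pow X n) (proj X n)) :=
  Fan.IsLimit.mk _ (fun s => powLift (fun i => s.proj i)) (fun s j => rfl)
    (fun s m hm => hom_ext fun x => funext fun j => congrArg (fun g => fn g x) (hm j))

theorem op_of_isLimit {X P : PAlg S} {n : ℕ} (pr : Fin n → (P ⟶ X))
    (hP : IsLimit (Fan.mk P pr)) {M hM} {x : Fin M.m → P.carrier} {a : P.carrier}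
    (h : ∀ i, X.op M hM (fun l => fn (pr i) (x l)) (fn (pr i) a)) : P.op M hM x a := by
  let k : pow X n ⟶ P := hP.lift (Fan.mk _ (proj X n))
  have hk : ∀ i, k ≫ pr i = proj X n i := fun i => hP.fac (Fan.mk _ (proj X n)) ⟨i⟩
  have hck : powLift pr ≫ k = 𝟙 P := by
    refine Fan.IsLimit.hom_ext hP _ _ (fun i => ?_)
    change (powLift pr ≫ k) ≫ pr i = 𝟙 P ≫ pr i
    rw [Category.assoc, hk]
    rfl
  have hx : ∀ y, fn k (fn (powLift pr) y) = y := fun y => by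
    rw [← fn_comp, hck, fn_id]
  have := fn_op k (M := M) (hM := hM) (x := fun l => fn (powLift pr) (x l))
    (a := fn (powLift pr) a) h
  simpa only [hx] using this

/-- A subset closed under the partial operations. -/
structure ClosedSub (Y : PAlg S) where
  set : Set Y.carrier
  pt_mem : Y.pt ∈ set
  closed : ∀ M hM x a, Y.op M hM x a → (∀ j, x j ∈ set) → a ∈ set

def sub (Y : PAlg S) (E : ClosedSub Y) : PAlg S where
  carrier := {y // y ∈ E.set}
  fin := by
    have := Y.fin
    infer_instance
  pt := ⟨Y.pt, E.pt_mem⟩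
  op M hM x a := Y.op M hM (fun l => (x l).1) a.1
  func M hM x a b ha hb := Subtype.ext (Y.func M hM _ _ _ ha hb)
  row M hM i f hf := Y.row M hM i (fun e => (f e).1) (by rw [hf])

def incl (Y : PAlg S) (E : ClosedSub Y) : sub Y E ⟶ Y :=
  mkHom (A := sub Y E) (fun y => y.1) rfl (fun M hM x a h => h)

def corestrict {Y Z : PAlg S} (E : ClosedSub Y) (f : Z ⟶ Y) (h : ∀ z, fn f z ∈ E.set) :
    Z ⟶ sub Y E :=
  mkHom (B := sub Y E) (fun z => ⟨fn f z, h z⟩) (Subtype.ext (fn_pt f))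
    (fun M hM x a h => fn_op f h)

theorem strong_closed {R Y : PAlg S} (r : R ⟶ Y) [StrongMono r] :
    Function.Injective (fn r) ∧ ∀ M hM x y, Y.op M hM (fun l => fn r (x l)) y →
      ∃ a, R.op M hM x a ∧ fn r a = y := by
  let E : ClosedSub Y :=
    { set := {y | ∀ E' : ClosedSub Y, (∀ a, fn r a ∈ E'.set) → y ∈ E'.set}
      pt_mem := fun E' _ => E'.pt_mem
      closed := fun M hM x a h hx E' hE' => E'.closed M hM x a h (fun j => hx j E' hE') }
  have hrE : ∀ a, fn r a ∈ E.set := fun a E' hE' => hE' a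
  let r' : R ⟶ sub Y E := corestrict E r hrE
  have hepi : Epi r' := ⟨fun {T} g h hgh => by
    let E' : ClosedSub Y :=
      { set := {y | ∃ hy : y ∈ E.set, fn g ⟨y, hy⟩ = fn h ⟨y, hy⟩}
        pt_mem := ⟨E.pt_mem, (fn_pt g).trans (fn_pt h).symm⟩
        closed := fun M hM x a ho hx => by
          choose hx1 hx2 using hx
          have ha : a ∈ E.set := E.closed M hM x a ho hx1
          refine ⟨ha, ?_⟩
          have hs : (sub Y E).op M hM (fun l => ⟨x l, hx1 l⟩) ⟨a, ha⟩ := ho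
          have h1 := fn_op g hs
          have h2 := fn_op h hs
          simp only [hx2] at h1
          exact T.func M hM _ _ _ h1 h2 }
    refine hom_ext fun y => ?_
    obtain ⟨_, hy⟩ := y.2 E' (fun a => ⟨hrE a, congrArg (fun g => fn g a) hgh⟩)
    exact hy⟩
  have sq : CommSq (𝟙 R) r' r (incl Y E) := ⟨rfl⟩
  have h1 : ∀ a, fn sq.lift (fn r' a) = a := fun a => by
    rw [← fn_comp, sq.fac_left, fn_id]
  have h2 : ∀ y, fn r (fn sq.lift y) = y.1 := fun y => by
    rw [← fn_comp, sq.fac_right]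
    rfl
  constructor
  · intro a b hab
    have : fn r' a = fn r' b := Subtype.ext hab
    rw [← h1 a, this, h1]
  · intro M hM x y hy
    have hyE : y ∈ E.set := E.closed M hM _ _ hy (fun j => hrE _)
    have hs : (sub Y E).op M hM (fun l => fn r' (x l)) ⟨y, hyE⟩ := hy
    have := fn_op sq.lift hs
    simp only [h1] at this
    exact ⟨_, this, h2 _⟩

theorem hasSClosed : MatrStar.HasSClosedRels S (PAlg S) (strongMonos (PAlg S)) := by
  intro M hM X P R pr hP r hr
  have : StrongMono r := hr
  obtain ⟨hinj, hcl⟩ := strong_closed r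
  rw [isClosed_iff]
  intro Z f hf hl
  choose h hh using hl
  let t : Z ⟶ P := hP.lift (Fan.mk Z (fun i => f (M.right i)))
  have ht : ∀ i, t ≫ pr i = f (M.right i) := fun i =>
    hP.fac (Fan.mk Z (fun i => f (M.right i))) ⟨i⟩
  have ex : ∀ z, ∃ a, R.op M hM (fun j => fn (h j) z) a ∧ fn r a = fn t z := by
    intro z
    apply hcl
    apply op_of_isLimit pr hP
    intro i
    have := X.row M hM i (fun e => fn (f e) z) (by rw [hf]; rfl)
    simp only [← ht, ← hh, fn_comp] at this
    exact this
  choose g hg1 hg2 using ex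
  let G : Z ⟶ R := mkHom g (hinj (by rw [hg2, fn_pt, fn_pt])) (fun M' hM' x a hx => by
    have := fn_op t hx
    simp only [← hg2] at this
    obtain ⟨b, hb, hb'⟩ := hcl M' hM' _ _ this
    rw [← hinj hb']
    exact hb)
  have hG : G ≫ r = t := hom_ext hg2
  exact ⟨G, fun i => by rw [← Category.assoc, hG, ht]⟩

/-- The minimal structure on a pointed set. -/
def minAlg (hS : Nondeg S) (A : Type) [Finite A] (z : A) : PAlg S where
  carrier := A
  fin := inferInstance
  pt := z
  op M _ x a := ∃ (i : Fin M.n) (f : Option (Fin M.k) → A), f none = z ∧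
    x = (fun j => f (M.left i j)) ∧ a = f (M.right i)
  func M hM x a b := by
    rintro ⟨i, f, hf, hx, rfl⟩ ⟨i', f', hf', hx', rfl⟩
    exact hS.eq hM i i' f f' hf hf' (fun j => congrFun (hx.symm.trans hx') j)
  row M hM i f hf := ⟨i, f, hf, rfl, rfl⟩

def minHom (hS : Nondeg S) {A : Type} [Finite A] {z : A} {B : PAlg S} (f : A → B.carrier)
    (hf : f z = B.pt) : minAlg hS A z ⟶ B :=
  mkHom (A := minAlg hS A z) f hf (by
    rintro M hM x a ⟨i, g, hg, rfl, rfl⟩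
    exact B.row M hM i (fun e => f (g e)) (by rw [hg, hf]))

section Amalgam

open Classical in
theorem incl_strong (hS : Nondeg S) (Y : PAlg S) (E : ClosedSub Y) : StrongMono (incl Y E) := by
  let T₀ : Type := {t : Y.carrier × Bool // t.2 = true → t.1 ∉ E.set}
  let u : Y.carrier → T₀ := fun y => ⟨(y, false), by simp⟩
  let v : Y.carrier → T₀ := fun y => if h : y ∈ E.set then u y else ⟨(y, true), fun _ => h⟩
  let p : T₀ → Y.carrier := fun t => t.1.1
  have pu : ∀ y, p (u y) = y := fun y => rfl
  have pv : ∀ y, p (v y) = y := fun y => by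
    by_cases h : y ∈ E.set <;> simp [v, h, p, u]
  have uv : ∀ y, y ∈ E.set → u y = v y := fun y h => by simp [v, h]
  have vu : ∀ y, u y = v y → y ∈ E.set := fun y h => by
    by_contra hy
    have h2 := congrArg (fun t => t.1.2) h
    simp [v, hy, u] at h2
  let Gr : ∀ M : MatrStar, M ∈ S → (Fin M.m → T₀) → T₀ → Prop := fun M hM x a =>
    (∃ y c, Y.op M hM y c ∧ x = (fun j => u (y j)) ∧ a = u c) ∨
    (∃ y c, Y.op M hM y c ∧ x = (fun j => v (y j)) ∧ a = v c) ∨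
    ∃ (i : Fin M.n) (f : Option (Fin M.k) → T₀), f none = u Y.pt ∧
      x = (fun j => f (M.left i j)) ∧ a = f (M.right i)
  have mixed : ∀ M hM y c y' c', Y.op M hM y c → Y.op M hM y' c' →
      (fun j => u (y j)) = (fun j => v (y' j)) → u c = v c' := by
    intro M hM y c y' c' h h' e
    have hy : y = y' := funext fun j => by
      have := congrArg p (congrFun e j)
      rwa [pu, pv] at this
    subst hy
    have hc := Y.func M hM _ _ _ h h'
    subst hc
    exact uv _ (E.closed M hM _ _ h (fun j => vu _ (congrFun e j)))
  have rowlike : ∀ (w : Y.carrier → T₀), (∀ y, p (w y) = y) → w Y.pt = u Y.pt →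
      ∀ M (hM : M ∈ S) y c (i : Fin M.n) (f : Option (Fin M.k) → T₀), Y.op M hM y c →
      f none = u Y.pt → (fun j => w (y j)) = (fun j => f (M.left i j)) →
      w c = f (M.right i) := by
    intro w hw hwpt M hM y c i f h hf e
    have e' : ∀ j, w (y j) = f (M.left i j) := fun j => congrFun e j
    have h1 : y = fun j => p (f (M.left i j)) := funext fun j => by rw [← e', hw]
    have h2 := Y.row M hM i (fun x => p (f x)) (by rw [hf, pu])
    rw [h1] at h
    have h3 := Y.func M hM _ _ _ h h2
    rw [h3]
    refine hS.eq hM (z := u Y.pt) i i (fun x => w (p (f x))) f ?_ hf ?_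
    · change w (p (f none)) = _
      rw [hf, pu, hwpt]
    · intro j
      change w (p (f (M.left i j))) = _
      rw [← e', hw]
  have vpt : v Y.pt = u Y.pt := (uv _ E.pt_mem).symm
  let T : PAlg S :=
    { carrier := T₀
      fin := by
        have := Y.fin
        infer_instance
      pt := u Y.pt
      op := Gr
      func := by
        rintro M hM x a b (⟨y, c, h, rfl, rfl⟩ | ⟨y, c, h, rfl, rfl⟩ | ⟨i, f, hf, rfl, rfl⟩)
          (⟨y', c', h', e, rfl⟩ | ⟨y', c', h', e, rfl⟩ | ⟨i', f', hf', e, rfl⟩)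
        · have hy : y = y' := funext fun j => by
            have := congrArg p (congrFun e j)
            rwa [pu, pu] at this
          subst hy
          rw [Y.func M hM _ _ _ h h']
        · exact mixed M hM _ _ _ _ h h' e
        · exact rowlike u pu rfl M hM y c i' f' h hf' e
        · exact (mixed M hM _ _ _ _ h' h e.symm).symm
        · have hy : y = y' := funext fun j => by
            have := congrArg p (congrFun e j)
            rwa [pv, pv] at this
          subst hy
          rw [Y.func M hM _ _ _ h h']
        · exact rowlike v pv vpt M hM y c i' f' h hf' e
        · exact (rowlike u pu rfl M hM y' c' i f h' hf e.symm).symm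
        · exact (rowlike v pv vpt M hM y' c' i f h' hf e.symm).symm
        · exact hS.eq hM i i' f f' hf hf' (fun j => congrFun e j)
      row := fun M hM i f hf => Or.inr (Or.inr ⟨i, f, hf, rfl, rfl⟩) }
  let U : Y ⟶ T := mkHom (B := T) u rfl (fun M hM x a h => Or.inl ⟨x, a, h, rfl, rfl⟩)
  let V : Y ⟶ T := mkHom (B := T) v vpt
    (fun M hM x a h => Or.inr (Or.inl ⟨x, a, h, rfl, rfl⟩))
  have hUV : incl Y E ≫ U = incl Y E ≫ V := hom_ext fun x => uv x.1 x.2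
  have hm : Mono (incl Y E) := ⟨fun g h hgh => hom_ext fun x => Subtype.ext
    (congrArg (fun g => fn g x) hgh)⟩
  refine ⟨hm, fun A B e _ => ⟨fun {a b} sq => ?_⟩⟩
  have hb : b ≫ U = b ≫ V := by
    rw [← cancel_epi e, ← Category.assoc, ← Category.assoc, ← sq.w, Category.assoc,
      Category.assoc, hUV]
  have hbE : ∀ z, fn b z ∈ E.set := fun z => vu _ (congrArg (fun g => fn g z) hb)
  refine ⟨⟨⟨corestrict E b hbE, ?_, rfl⟩⟩⟩
  rw [← cancel_mono (incl Y E), sq.w]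
  rfl

end Amalgam

theorem deriv_of_closed (hS : Nondeg S) {N : MatrStar}
    (hN : N.HasClosedRels (PAlg S) (strongMonos (PAlg S))) : Deriv S N := by
  intro ρ hρ h0 hl
  let X : PAlg S := minAlg hS (Option (Fin N.k)) none
  let E : ClosedSub (pow X N.n) :=
    { set := ρ
      pt_mem := h0
      closed := fun M hM x a h hx => by
        choose φ g hg hxg hag using h
        have := hρ M hM φ g hg (fun j => by
          have h2 := hx j
          have h3 : x j = fun l => g l (M.left (φ l) j) := funext fun l => congrFun (hxg l) j
          rwa [h3] at h2)
        have h4 : a = fun l => g l (M.right (φ l)) := funext hag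
        rw [h4]
        exact this }
  have hc := hN X (pow X N.n) (sub _ E) (proj X N.n) (powIsLimit X N.n) (incl _ E)
    (incl_strong hS _ E)
  rw [isClosed_iff] at hc
  let Z : PAlg S := minAlg hS Bool false
  let f : Option (Fin N.k) → (Z ⟶ X) := fun e =>
    minHom hS (B := X) (fun b => if b then e else none) rfl
  obtain ⟨g, hg⟩ := hc Z f (hom_ext fun b => by cases b <;> rfl) (fun j =>
    ⟨minHom hS (B := sub _ E) (fun b => if b then ⟨fun i => N.left i j, hl j⟩ else
      ⟨fun _ => none, h0⟩) rfl, fun i => hom_ext fun b => by cases b <;> rfl⟩)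
  let tt : Z.carrier := true
  have h1 := (fn g tt).2
  have h2 : (fn g tt).1 = N.right := funext fun i =>
    congrArg (fun g : Z ⟶ X => fn g tt) (hg i)
  rwa [h2] at h1

/-- Transport of structure along a bijection with some `Fin n`. -/
theorem exists_small (A : PAlg S) : ∃ (n : ℕ) (B : PAlg S), B.carrier = Fin n ∧ Nonempty (B ≅ A) := by
  have := A.fin
  obtain ⟨n, ⟨e⟩⟩ := Finite.exists_equiv_fin A.carrier
  let B : PAlg S :=
    { carrier := Fin n
      fin := inferInstance
      pt := e A.pt
      op := fun M hM x a => A.op M hM (fun l => e.symm (x l)) (e.symm a)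
      func := fun M hM x a b ha hb => e.symm.injective (A.func M hM _ _ _ ha hb)
      row := fun M hM i f hf => A.row M hM i (fun x => e.symm (f x)) (by rw [hf]; simp) }
  refine ⟨n, B, rfl, ⟨⟨mkHom (A := B) e.symm (e.symm_apply_apply _) (fun _ _ _ _ h => h),
    mkHom (B := B) e rfl (fun M hM x a h => ?_), hom_ext fun x => e.apply_symm_apply x,
    hom_ext fun x => e.symm_apply_apply x⟩⟩⟩
  change A.op M hM (fun l => e.symm (e (x l))) (e.symm (e a))
  simpa using h

/-- Structures with underlying set some `Fin n`. -/
structure Code (S : Set MatrStar) : Type where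
  n : ℕ
  pt : Fin n
  op : ∀ M : MatrStar, M ∈ S → (Fin M.m → Fin n) → Fin n → Prop
  func : ∀ M hM x a b, op M hM x a → op M hM x b → a = b
  row : ∀ M hM i (f : Option (Fin M.k) → Fin n), f none = pt →
    op M hM (fun j => f (M.left i j)) (f (M.right i))

def Code.toPAlg (c : Code S) : PAlg S := ⟨Fin c.n, inferInstance, c.pt, c.op, c.func, c.row⟩

instance : (inducedFunctor (Code.toPAlg (S := S))).EssSurj := ⟨fun A => by
  obtain ⟨n, ⟨B, fB, pt, op, func, row⟩, h, ⟨i⟩⟩ := exists_small A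
  dsimp at h
  subst h
  exact ⟨⟨n, pt, op, func, row⟩, ⟨i⟩⟩⟩

instance : (inducedFunctor (Code.toPAlg (S := S))).IsEquivalence where

end PAlg

end PartialAlgebras

section Relational

/-- Finite pointed sets with an `n`-ary relation closed under the rules in `S`. -/
structure RAlg (S : Set MatrStar) (n : ℕ) : Type 1 where
  carrier : Type
  fin : Finite carrier
  pt : carrier
  rel : Set (Fin n → carrier)
  zero_mem : (fun _ => pt) ∈ rel
  closed : RClosed S pt rel

namespace RAlg

variable {S : Set MatrStar} {n : ℕ}

@[ext]
structure Hom (A B : RAlg S n) : Type where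
  toFun : A.carrier → B.carrier
  map_pt : toFun A.pt = B.pt
  map_rel : ∀ x ∈ A.rel, (fun l => toFun (x l)) ∈ B.rel

instance : Category.{0} (RAlg S n) where
  Hom := Hom
  id A := ⟨id, rfl, fun _ h => h⟩
  comp f g := ⟨fun x => g.toFun (f.toFun x), by rw [f.map_pt, g.map_pt],
    fun x h => g.map_rel _ (f.map_rel x h)⟩

def fn {A B : RAlg S n} (f : A ⟶ B) : A.carrier → B.carrier := Hom.toFun f

theorem fn_pt {A B : RAlg S n} (f : A ⟶ B) : fn f A.pt = B.pt := Hom.map_pt f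

theorem fn_rel {A B : RAlg S n} (f : A ⟶ B) {x} (h : x ∈ A.rel) :
    (fun l => fn f (x l)) ∈ B.rel := Hom.map_rel f x h

@[simp] theorem fn_comp {A B C : RAlg S n} (f : A ⟶ B) (g : B ⟶ C) (x : A.carrier) :
    fn (f ≫ g) x = fn g (fn f x) := rfl

@[simp] theorem fn_id {A : RAlg S n} (x : A.carrier) : fn (𝟙 A) x = x := rfl

theorem hom_ext {A B : RAlg S n} {f g : A ⟶ B} (h : ∀ x, fn f x = fn g x) : f = g :=
  Hom.ext (funext h)

def mkHom {A B : RAlg S n} (f : A.carrier → B.carrier) (h : f A.pt = B.pt)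
    (h' : ∀ x ∈ A.rel, (fun l => f (x l)) ∈ B.rel) : A ⟶ B :=
  Hom.mk f h h'

@[simp] theorem fn_mkHom {A B : RAlg S n} (f : A.carrier → B.carrier) (h : f A.pt = B.pt)
    (h' : ∀ x ∈ A.rel, (fun l => f (x l)) ∈ B.rel) (x : A.carrier) :
    fn (mkHom f h h') x = f x := rfl

instance : HasZeroMorphisms (RAlg S n) where
  zero A B := ⟨mkHom (fun _ => B.pt) rfl (fun _ _ => B.zero_mem)⟩
  comp_zero _ _ := rfl
  zero_comp _ {_ _} f := hom_ext fun _ => fn_pt f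

@[simp] theorem fn_zero {A B : RAlg S n} (x : A.carrier) : fn (0 : A ⟶ B) x = B.pt := rfl

/-- Codiscrete structure. -/
def codisc (S : Set MatrStar) (n : ℕ) (A : Type) [Finite A] (z : A) : RAlg S n where
  carrier := A
  fin := inferInstance
  pt := z
  rel := Set.univ
  zero_mem := trivial
  closed := fun _ _ _ _ _ _ => trivial

instance : HasZeroObject (RAlg S n) := by
  refine ⟨⟨codisc S n Unit (), fun Y => ⟨⟨⟨0⟩, fun a => hom_ext fun x => ?_⟩⟩,
    fun Y => ⟨⟨⟨0⟩, fun a => ?_⟩⟩⟩⟩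
  · exact fn_pt a
  · exact hom_ext fun x => rfl

/-- The structure generated by a set of tuples. -/
def gen (S : Set MatrStar) (A : Type) [Finite A] (z : A) (ρ₀ : Set (Fin n → A)) : RAlg S n where
  carrier := A
  fin := inferInstance
  pt := z
  rel := {c | ∀ ρ : Set (Fin n → A), RClosed S z ρ → (fun _ => z) ∈ ρ → ρ₀ ⊆ ρ → c ∈ ρ}
  zero_mem := fun _ _ h _ => h
  closed := fun M hM φ g hg hl ρ h1 h2 h3 => h1 M hM φ g hg (fun j => hl j ρ h1 h2 h3)

theorem mem_gen {A : Type} [Finite A] {z : A} {ρ₀ : Set (Fin n → A)} {c : Fin n → A}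
    (h : c ∈ ρ₀) : c ∈ (gen S A z ρ₀).rel := fun _ _ _ h3 => h3 h

def genHom {A : Type} [Finite A] {z : A} {ρ₀ : Set (Fin n → A)} {B : RAlg S n}
    (f : A → B.carrier) (hf : f z = B.pt) (h : ∀ c ∈ ρ₀, (fun l => f (c l)) ∈ B.rel) :
    gen S A z ρ₀ ⟶ B :=
  mkHom (A := gen S A z ρ₀) f hf (fun x hx => hx {c | (fun l => f (c l)) ∈ B.rel}
    (fun M hM φ g hg hl => B.closed M hM φ (fun l e => f (g l e))
      (fun l => by rw [hg, hf]) hl)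
    (by
      change (fun _ => f z) ∈ B.rel
      rw [hf]
      exact B.zero_mem) h)

section Colim

variable {J : Type} [SmallCategory J] [FinCategory J] (F : J ⥤ RAlg S n)

inductive CRel : Option (Σ j, (F.obj j).carrier) → Option (Σ j, (F.obj j).carrier) → Prop
  | pt (j : J) : CRel (some ⟨j, (F.obj j).pt⟩) none
  | map {i j : J} (f : i ⟶ j) (x : (F.obj i).carrier) :
      CRel (some ⟨i, x⟩) (some ⟨j, fn (F.map f) x⟩)

def CQ : Type := Quot (CRel F)

def CQ.mk (j : J) (x : (F.obj j).carrier) : CQ F := Quot.mk _ (some ⟨j, x⟩)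

instance : Finite (CQ F) := by
  have : ∀ j, Finite (F.obj j).carrier := fun j => (F.obj j).fin
  unfold CQ
  infer_instance

/-- The colimit of a finite diagram. -/
def colim : RAlg S n :=
  gen S (CQ F) (Quot.mk _ none) {c | ∃ j, ∃ x ∈ (F.obj j).rel, c = fun l => CQ.mk F j (x l)}

def colimι (j : J) : F.obj j ⟶ colim F :=
  mkHom (B := colim F) (CQ.mk F j) (Quot.sound (CRel.pt j))
    (fun x hx => mem_gen ⟨j, x, hx, rfl⟩)

def colimDescFun (s : Cocone F) : CQ F → s.pt.carrier :=
  Quot.lift (fun o => match o with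
    | none => s.pt.pt
    | some ⟨j, x⟩ => fn (s.ι.app j) x) (by
      rintro _ _ (j | ⟨f, x⟩)
      · exact fn_pt _
      · change _ = fn (s.ι.app _) (fn (F.map f) x)
        rw [← fn_comp, s.w])

def colimDesc (s : Cocone F) : colim F ⟶ s.pt :=
  genHom (colimDescFun F s) rfl (by
    rintro _ ⟨j, x, hx, rfl⟩
    exact fn_rel (s.ι.app j) hx)

def colimCocone : Cocone F where
  pt := colim F
  ι :=
    { app := colimι F
      naturality := fun i j f => hom_ext fun x => (Quot.sound (CRel.map f x)).symm }

def colimIsColimit : IsColimit (colimCocone F) where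
  desc s := colimDesc F s
  fac s j := rfl
  uniq s m hm := hom_ext fun x => by
    induction x using Quot.ind with
    | mk o =>
      rcases o with _ | ⟨j, x⟩
      · exact fn_pt m
      · exact congrArg (fun g => fn g x) (hm j)

end Colim

instance : HasFiniteColimits (RAlg S n) := ⟨fun _ _ _ =>
  ⟨fun F => ⟨⟨colimCocone F, colimIsColimit F⟩⟩⟩⟩

open Classical in
theorem jointly_surj {ι : Type*} [Nonempty ι] {A B : RAlg S n} (h : ι → (A ⟶ B))
    (hj : ∀ (T : RAlg S n) (a b : B ⟶ T), (∀ i, h i ≫ a = h i ≫ b) → a = b) (y : B.carrier) :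
    ∃ i x, fn (h i) x = y := by
  obtain ⟨i₀⟩ := ‹Nonempty ι›
  by_contra hy
  let a : B ⟶ codisc S n Bool false := mkHom (B := codisc S n Bool false)
    (fun y => decide (¬ ∃ i x, fn (h i) x = y))
    (decide_eq_false (not_not.mpr ⟨i₀, A.pt, fn_pt _⟩)) (fun _ _ => trivial)
  have ha : a = 0 := hj _ _ _ (fun i => hom_ext fun x =>
    decide_eq_false (not_not.mpr ⟨i, x, rfl⟩))
  have h1 : fn a y = false := by
    rw [ha]
    rfl
  exact of_decide_eq_false h1 hy

theorem hasSClosed (hS : Nondeg S) : MatrStar.HasSClosedRels S (RAlg S n)ᵒᵖ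
    (MorphismProperty.monomorphisms (RAlg S n)ᵒᵖ) := by
  intro M hM X P R pr hP r hr
  have hr' : Mono r := hr
  rw [isClosed_iff]
  intro Z f hf hl
  choose h hh using hl
  have : Nonempty (Fin M.n) := ⟨⟨0, M.npos⟩⟩
  let q : Fin M.n → (X.unop ⟶ R.unop) := fun i => (r ≫ pr i).unop
  have hsurj := jointly_surj q (fun T a b hab => by
    apply Quiver.Hom.op_inj
    rw [← cancel_mono r]
    refine Fan.IsLimit.hom_ext hP _ _ (fun i => ?_)
    change (a.op ≫ r) ≫ pr i = (b.op ≫ r) ≫ pr i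
    rw [Category.assoc, Category.assoc]
    exact Quiver.Hom.unop_inj (hab i))
  have hq : ∀ i j x, fn (h j).unop (fn (q i) x) = fn (f (M.left i j)).unop x := by
    intro i j x
    rw [← hh j i]
    rfl
  have hfn : ∀ x, fn (f none).unop x = Z.unop.pt := by
    intro x
    rw [hf]
    rfl
  choose I A hIA using hsurj
  have hwd : ∀ i x, fn (f (M.right (I (fn (q i) x)))).unop (A (fn (q i) x)) =
      fn (f (M.right i)).unop x := by
    intro i x
    refine hS.eq hM (z := Z.unop.pt) (I (fn (q i) x)) i
      (fun e => fn (f e).unop (A (fn (q i) x))) (fun e => fn (f e).unop x) (hfn _) (hfn _) ?_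
    intro j
    change fn (f _).unop _ = fn (f _).unop _
    rw [← hq, ← hq, hIA]
  let g : R.unop ⟶ Z.unop := mkHom (fun y => fn (f (M.right (I y))).unop (A y))
    (by
      have := hwd (Classical.arbitrary _) X.unop.pt
      rw [fn_pt, fn_pt] at this
      exact this)
    (fun y hy => Z.unop.closed M hM (fun l => I (y l)) (fun l e => fn (f e).unop (A (y l)))
      (fun l => hfn _) (fun j => by
        have := fn_rel (h j).unop hy
        simp only [← hq, hIA]
        exact this))
  exact ⟨g.op, fun i => Quiver.Hom.unop_inj (hom_ext fun x => hwd i x)⟩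

theorem deriv_of_closed {N : MatrStar}
    (hN : N.HasClosedRels (RAlg S N.n)ᵒᵖ (MorphismProperty.monomorphisms (RAlg S N.n)ᵒᵖ)) :
    Deriv S N := by
  intro ρ hρ h0 hl
  let A : RAlg S N.n := gen S Bool false ∅
  let B : RAlg S N.n := gen S (Option (Fin N.n)) none {some}
  let Z : RAlg S N.n := ⟨Option (Fin N.k), inferInstance, none, ρ, h0, hρ⟩
  let inj : Fin N.n → (A ⟶ B) := fun i =>
    genHom (B := B) (fun b => if b then some i else none) rfl (by simp)
  let P : (RAlg S N.n)ᵒᵖ := ∏ᶜ (fun _ : Fin N.n => Opposite.op A)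
  let r : Opposite.op B ⟶ P := Pi.lift fun i => (inj i).op
  have hrp : ∀ i, r ≫ Pi.π (fun _ : Fin N.n => Opposite.op A) i = (inj i).op := fun i =>
    Pi.lift_π _ i
  let tt : A.carrier := true
  have hmono : Mono r := ⟨fun {T} a b hab => by
    apply Quiver.Hom.unop_inj
    refine hom_ext fun y => ?_
    rcases y with _ | i
    · exact (fn_pt a.unop).trans (fn_pt b.unop).symm
    · have h1 : a ≫ (inj i).op = b ≫ (inj i).op := by
        rw [← hrp, ← Category.assoc, ← Category.assoc, hab]
      exact congrArg (fun g : T ⟶ Opposite.op A => fn g.unop tt) h1⟩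
  have hc := hN (Opposite.op A) P (Opposite.op B) _ (productIsProduct _) r hmono
  rw [isClosed_iff] at hc
  let f : Option (Fin N.k) → (Opposite.op Z ⟶ Opposite.op A) := fun e =>
    (genHom (B := Z) (fun b => if b then e else none) rfl (by simp) : A ⟶ Z).op
  simp only [hrp] at hc
  obtain ⟨g, hg⟩ := hc (Opposite.op Z) f
    (Quiver.Hom.unop_inj (hom_ext fun b => by cases b <;> rfl)) (fun j =>
      ⟨(genHom (B := Z) (fun o => o.elim none (fun i => N.left i j)) rfl (by
          rintro _ rfl
          exact hl j) : B ⟶ Z).op,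
        fun i => Quiver.Hom.unop_inj (hom_ext fun b => by cases b <;> rfl)⟩)
  have h1 : (fun l => fn g.unop (some l)) ∈ Z.rel := fn_rel g.unop (x := some) (mem_gen rfl)
  have h2 : (fun l => fn g.unop (some l)) = N.right := funext fun i =>
    congrArg (fun g : Opposite.op Z ⟶ Opposite.op A => fn g.unop tt) (hg i)
  rw [h2] at h1
  exact h1

/-- Transport of structure along a bijection with some `Fin n`. -/
theorem exists_small (A : RAlg S n) :
    ∃ (k : ℕ) (B : RAlg S n), B.carrier = Fin k ∧ Nonempty (B ≅ A) := by
  have := A.fin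
  obtain ⟨k, ⟨e⟩⟩ := Finite.exists_equiv_fin A.carrier
  let B : RAlg S n :=
    { carrier := Fin k
      fin := inferInstance
      pt := e A.pt
      rel := {c | (fun l => e.symm (c l)) ∈ A.rel}
      zero_mem := by simpa using A.zero_mem
      closed := fun M hM φ g hg hl => A.closed M hM φ (fun l x => e.symm (g l x))
        (fun l => by rw [hg]; simp) hl }
  refine ⟨k, B, rfl, ⟨⟨mkHom (A := B) e.symm (e.symm_apply_apply _) (fun _ h => h),
    mkHom (B := B) e rfl (fun x h => ?_), hom_ext fun x => e.apply_symm_apply x,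
    hom_ext fun x => e.symm_apply_apply x⟩⟩⟩
  change (fun l => e.symm (e (x l))) ∈ A.rel
  simpa using h

/-- Structures with underlying set some `Fin k`. -/
structure Code (S : Set MatrStar) (n : ℕ) : Type where
  k : ℕ
  pt : Fin k
  rel : Set (Fin n → Fin k)
  zero_mem : (fun _ => pt) ∈ rel
  closed : RClosed S pt rel

def Code.toRAlg (c : Code S n) : RAlg S n :=
  ⟨Fin c.k, inferInstance, c.pt, c.rel, c.zero_mem, c.closed⟩

instance : (inducedFunctor (Code.toRAlg (S := S) (n := n))).EssSurj := ⟨fun A => by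
  obtain ⟨k, ⟨B, fB, pt, rel, h0, hc⟩, h, ⟨i⟩⟩ := exists_small A
  dsimp at h
  subst h
  exact ⟨⟨k, pt, rel, h0, hc⟩, ⟨i⟩⟩⟩

instance : (inducedFunctor (Code.toRAlg (S := S) (n := n))).IsEquivalence where

end RAlg

end Relational

end PLex

/-- For a set `S` of pointed matrices and a pointed matrix `N`,
every finitely complete pointed category with `S`-closed relations has
`N`-closed relations (`S ⇒_{lex*} N`) if and only if every finitely complete
pointed category with `S`-closed strong relations has `N`-closed strong
relations (`S ⇒_{lex*}^strong N`). -/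
theorem pointed_lexImp_iff_strong_lexImp (S : Set MatrStar) (N : MatrStar) :
    (∀ (C : Type u) [Category.{v} C] [HasFiniteLimits C] [HasZeroObject C]
        [HasZeroMorphisms C],
        MatrStar.HasSClosedRels S C (MorphismProperty.monomorphisms C) →
        MatrStar.HasClosedRels N C (MorphismProperty.monomorphisms C)) ↔
    (∀ (C : Type u) [Category.{v} C] [HasFiniteLimits C] [HasZeroObject C]
        [HasZeroMorphisms C],
        MatrStar.HasSClosedRels S C (strongMonos C) →
        MatrStar.HasClosedRels N C (strongMonos C)) := by
  constructor
  · intro H C _ _ _ _ hS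
    refine PLex.closed_of_deriv (fun f hf => PLex.strongMonos_split f hf) hS (fun hnd => ?_)
    exact PLex.RAlg.deriv_of_closed (PLex.mono_transfer
      (inducedFunctor (PLex.RAlg.Code.toRAlg (S := S) (n := N.n))).asEquivalence.symm.op
      S N H (PLex.RAlg.hasSClosed hnd))
  · intro H C _ _ _ _ hS
    refine PLex.closed_of_deriv (fun f hf => (inferInstance : Mono f)) hS (fun hnd => ?_)
    exact PLex.PAlg.deriv_of_closed hnd (PLex.strong_transfer
      (inducedFunctor (PLex.PAlg.Code.toPAlg (S := S))).asEquivalence.symm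
      S N H PLex.PAlg.hasSClosed)
end

section
/- Let S be a set of non-pointed matrices (S ⊆ matr) and N ∈ matr a non-pointed matrix having at least one left column (m > 0). Then the following are equivalent: (i) every finitely complete category with S-closed relations has N-closed relations; (ii) every finitely complete category with S-closed strong relations has N-closed strong relations. -/
open CategoryTheory CategoryTheory.Limits

universe w v u

namespace LexAux

/-- `T ⊆ Kⁿ` is closed under all row-wise interpretations of matrices in `S`. -/
def ClosedT (S : Set Matr) (n : ℕ) {K : Type} (T : (Fin n → K) → Prop) : Prop :=
  ∀ M ∈ S, ∀ (σ : Fin n → Fin M.n) (φ : Fin n → Fin M.k → K),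
    (∀ j, T (fun i => φ i (M.left (σ i) j))) → T (fun i => φ i (M.right (σ i)))

/-- The closure of the set of left columns of `N`. -/
inductive Cl_s16 (S : Set Matr) (N : Matr) : (Fin N.n → Fin N.k) → Prop
  | base (j : Fin N.m) : Cl_s16 S N (fun i => N.left i j)
  | step (M : Matr) (hM : M ∈ S) (σ : Fin N.n → Fin M.n) (φ : Fin N.n → Fin M.k → Fin N.k)
      (h : ∀ j, Cl_s16 S N (fun i => φ i (M.left (σ i) j))) :
      Cl_s16 S N (fun i => φ i (M.right (σ i)))

/-- The diagonal is closed. -/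
def Diag (S : Set Matr) : Prop :=
  ∀ M ∈ S, ∀ (q q' : Fin M.n) (f f' : Fin M.k → Bool),
    (∀ j, f (M.left q j) = f' (M.left q' j)) → f (M.right q) = f' (M.right q')

/-! ### The positive case -/

theorem strongMono_of_isPullback {C : Type u} [Category.{v} C] {A B A' B' : C}
    {t : A' ⟶ A} {r' : A' ⟶ B'} {r : A ⟶ B} {s : B' ⟶ B} (h : IsPullback t r' r s)
    (hr : StrongMono r) : StrongMono r' := by
  have : Mono r := hr.mono
  refine ⟨?_, ?_⟩
  · refine ⟨fun {Z} a b hab => h.hom_ext ?_ hab⟩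
    rw [← cancel_mono r, Category.assoc, Category.assoc, h.w, reassoc_of% hab]
  · intro X Y z hz
    have := hr.rlp z
    exact h.hasLiftingProperty z

theorem positive {C : Type u} [Category.{v} C] [HasFiniteLimits C]
    (W : MorphismProperty C)
    (hW : ∀ {A B A' B' : C} {t : A' ⟶ A} {r' : A' ⟶ B'} {r : A ⟶ B} {s : B' ⟶ B},
      IsPullback t r' r s → W r → W r')
    (S : Set Matr) (N : Matr) (hN : Cl_s16 S N N.right)
    (hS : Matr.HasSClosedRels S C W) : Matr.HasClosedRels N C W := by
  intro X P R pr hP r hr Z f hl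
  have key : ∀ c, Cl_s16 S N c → ∃ g : Z ⟶ R, g ≫ r = hP.lift (Fan.mk Z (fun i => f (c i))) := by
    intro c hc
    induction hc with
    | base j => exact hl j
    | step M hM σ φ _ ih =>
      let t : (∏ᶜ fun _ : Fin M.n => P) ⟶ P :=
        hP.lift (Fan.mk _ (fun i => Pi.π (fun _ : Fin M.n => P) (σ i) ≫ pr i))
      have ht : ∀ i, t ≫ pr i = Pi.π (fun _ : Fin M.n => P) (σ i) ≫ pr i := fun i =>
        hP.fac _ ⟨i⟩
      have hpr : ∀ (Z' : C) (x : Fin N.n → (Z' ⟶ X)) i,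
        hP.lift (Fan.mk Z' x) ≫ pr i = x i := fun Z' x i => hP.fac _ ⟨i⟩
      have hPext : ∀ (Z' : C) (a b : Z' ⟶ P), (∀ i, a ≫ pr i = b ≫ pr i) → a = b :=
        fun Z' a b h => hP.hom_ext (fun ⟨i⟩ => h i)
      let hP' := productIsProduct (fun _ : Fin M.n => P)
      have hpr' : ∀ (Z' : C) (x : Fin M.n → (Z' ⟶ P)) i,
        hP'.lift (Fan.mk Z' x) ≫ Pi.π (fun _ : Fin M.n => P) i = x i :=
          fun Z' x i => hP'.fac _ ⟨i⟩
      have hpb := IsPullback.of_hasPullback r t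
      let F : Fin M.k → (Z ⟶ P) := fun l => hP.lift (Fan.mk Z (fun i => f (φ i l)))
      have hcol : ∀ x : Fin M.n → Fin M.k,
          hP'.lift (Fan.mk Z (fun q => F (x q))) ≫ t =
            hP.lift (Fan.mk Z (fun i => f (φ i (x (σ i))))) := by
        intro x
        apply hPext
        intro i
        rw [Category.assoc, ht, reassoc_of% (hpr' Z (fun q => F (x q)) (σ i)), hpr, hpr]
      obtain ⟨g, hg⟩ := hS M hM P _ _ _ hP' (pullback.snd r t) (hW hpb hr) Z F (by
        intro j
        obtain ⟨g, hg⟩ := ih j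
        refine ⟨pullback.lift g (hP'.lift (Fan.mk Z (fun q => F (M.left q j)))) ?_, ?_⟩
        · rw [hg]; exact (hcol (fun q => M.left q j)).symm
        · exact pullback.lift_snd _ _ _)
      refine ⟨g ≫ pullback.fst r t, ?_⟩
      rw [Category.assoc, pullback.condition, reassoc_of% hg]
      exact hcol M.right
  exact key _ hN

/-! ### The preorder case -/

theorem collapse {C : Type u} [Category.{v} C] [HasFiniteLimits C] (S : Set Matr)
    (hD : ¬ Diag S) (hS : Matr.HasSClosedRels S C (strongMonos C))
    {Z X : C} (a b : Z ⟶ X) : a = b := by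
  unfold Diag at hD
  push Not at hD
  obtain ⟨M, hM, q, q', f, f', hl, hr⟩ := hD
  let Y := X ⨯ X
  let hP := productIsProduct (fun _ : Fin M.n => Y)
  have hpr : ∀ (Z' : C) (x : Fin M.n → (Z' ⟶ Y)) i,
        hP.lift (Fan.mk Z' x) ≫ Pi.π (fun _ : Fin M.n => Y) i = x i :=
          fun Z' x i => hP.fac _ ⟨i⟩
  let α := Pi.π (fun _ : Fin M.n => Y) q ≫ (prod.fst : X ⨯ X ⟶ X)
  let β := Pi.π (fun _ : Fin M.n => Y) q' ≫ (prod.snd : X ⨯ X ⟶ X)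
  let w : Bool → (Z ⟶ X) := fun e => if e then a else b
  let F : Fin M.k → (Z ⟶ Y) := fun l => prod.lift (w (f l)) (w (f' l))
  have hα : ∀ x : Fin M.n → Fin M.k,
      hP.lift (Fan.mk Z (fun i => F (x i))) ≫ α = w (f (x q)) := by
    intro x
    rw [reassoc_of% (hpr Z (fun i => F (x i)) q)]
    exact prod.lift_fst _ _
  have hβ : ∀ x : Fin M.n → Fin M.k,
      hP.lift (Fan.mk Z (fun i => F (x i))) ≫ β = w (f' (x q')) := by
    intro x
    rw [reassoc_of% (hpr Z (fun i => F (x i)) q')]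
    exact prod.lift_snd _ _
  obtain ⟨g, hg⟩ := hS M hM Y _ _ _ hP (equalizer.ι α β)
    (show StrongMono _ from inferInstance) Z F (by
      intro j
      have hj : hP.lift (Fan.mk Z (fun i => F (M.left i j))) ≫ α =
          hP.lift (Fan.mk Z (fun i => F (M.left i j))) ≫ β := by
        rw [hα (fun i => M.left i j), hβ (fun i => M.left i j), hl]
      exact ⟨equalizer.lift _ hj, equalizer.lift_ι _ hj⟩)
  have h1 := hα M.right
  have h2 := hβ M.right
  rw [← hg, Category.assoc] at h1 h2
  rw [equalizer.condition, h2] at h1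
  revert h1 hr
  cases f (M.right q) <;> cases f' (M.right q') <;> simp [w]
  intro h; exact h.symm

theorem closed_of_collapse {C : Type u} [Category.{v} C] (N : Matr) (hm : 0 < N.m)
    (W : MorphismProperty C)
    (h : ∀ {Z X : C} (a b : Z ⟶ X), a = b) : Matr.HasClosedRels N C W := by
  intro X P R pr hP r hr Z f hl
  obtain ⟨g, -⟩ := hl ⟨0, hm⟩
  exact ⟨g, h _ _⟩

/-! ### The counterexample category -/

theorem Diag.gen {S : Set Matr} (hD : Diag S) {M : Matr} (hM : M ∈ S) (q q' : Fin M.n)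
    {K : Type} (f f' : Fin M.k → K)
    (h : ∀ j, f (M.left q j) = f' (M.left q' j)) : f (M.right q) = f' (M.right q') := by
  classical
  have := hD M hM q q' (fun l => decide (f l = f' (M.right q')))
    (fun l => decide (f' l = f' (M.right q'))) (fun j => by simp only [h])
  simpa using this

theorem Diag.occurs {S : Set Matr} (hD : Diag S) {M : Matr} (hM : M ∈ S) (q : Fin M.n) :
    ∃ j, M.left q j = M.right q := by
  classical
  by_contra hne
  push Not at hne
  have := hD M hM q q (fun l => decide (l = M.right q)) (fun _ => false)
    (fun j => by simpa using hne j)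
  simp at this

/-- A finite set `A = Fin a`, with a set `B = Fin b` over `Aⁿ` with two sections `u`, `v` such
that the equalizer of `u` and `v` is closed. -/
structure Code (S : Set Matr) (n : ℕ) : Type u where
  a : ℕ
  b : ℕ
  d : Fin b → Fin n → Fin a
  u : (Fin n → Fin a) → Fin b
  v : (Fin n → Fin a) → Fin b
  du : ∀ c, d (u c) = c
  dv : ∀ c, d (v c) = c
  closed : ClosedT S n (fun c => u c = v c)

/-- Morphisms, in the opposite direction. -/
@[ext]
structure Code.Hom {S : Set Matr} {n : ℕ} (P Q : Code.{u} S n) : Type v where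
  fA : Fin Q.a → Fin P.a
  fB : Fin Q.b → Fin P.b
  hd : ∀ b i, P.d (fB b) i = fA (Q.d b i)
  hu : ∀ c, fB (Q.u c) = P.u (fun i => fA (c i))
  hv : ∀ c, fB (Q.v c) = P.v (fun i => fA (c i))

instance codeCat (S : Set Matr) (n : ℕ) : Category.{v} (Code.{u} S n) where
  Hom P Q := Code.Hom.{v} P Q
  id P := ⟨id, id, fun _ _ => rfl, fun _ => rfl, fun _ => rfl⟩
  comp f g := ⟨fun x => f.fA (g.fA x), fun x => f.fB (g.fB x),
    fun b i => by rw [f.hd, g.hd], fun c => by rw [g.hu, f.hu], fun c => by rw [g.hv, f.hv]⟩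

section
variable {S : Set Matr} {n : ℕ}

def fa {P Q : Code.{u} S n} (f : P ⟶ Q) : Fin Q.a → Fin P.a := Code.Hom.fA f

def fb {P Q : Code.{u} S n} (f : P ⟶ Q) : Fin Q.b → Fin P.b := Code.Hom.fB f

theorem fa_comp {P Q R : Code.{u} S n} (f : P ⟶ Q) (g : Q ⟶ R) (x) :
    fa (f ≫ g) x = fa f (fa g x) := rfl

theorem fb_comp {P Q R : Code.{u} S n} (f : P ⟶ Q) (g : Q ⟶ R) (x) :
    fb (f ≫ g) x = fb f (fb g x) := rfl

theorem fhd {P Q : Code.{u} S n} (f : P ⟶ Q) (b i) : P.d (fb f b) i = fa f (Q.d b i) :=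
  Code.Hom.hd f b i

theorem fhu {P Q : Code.{u} S n} (f : P ⟶ Q) (c) : fb f (Q.u c) = P.u (fun i => fa f (c i)) :=
  Code.Hom.hu f c

theorem fhv {P Q : Code.{u} S n} (f : P ⟶ Q) (c) : fb f (Q.v c) = P.v (fun i => fa f (c i)) :=
  Code.Hom.hv f c

theorem hom_ext {P Q : Code.{u} S n} {f g : P ⟶ Q} (h : ∀ x, fa f x = fa g x)
    (h' : ∀ x, fb f x = fb g x) : f = g :=
  Code.Hom.ext (funext h) (funext h')

def homMk {P Q : Code.{u} S n} (fA : Fin Q.a → Fin P.a) (fB : Fin Q.b → Fin P.b)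
    (hd : ∀ b i, P.d (fB b) i = fA (Q.d b i))
    (hu : ∀ c, fB (Q.u c) = P.u (fun i => fA (c i)))
    (hv : ∀ c, fB (Q.v c) = P.v (fun i => fA (c i))) : P ⟶ Q :=
  Code.Hom.mk fA fB hd hu hv

/-- The underlying type of the `B`-part of a standard object. -/
abbrev BT {a : ℕ} (T : (Fin n → Fin a) → Prop) (e : ℕ) : Type :=
  {p : (Fin n → Fin a) × Bool // T p.1 → p.2 = false} ⊕ Fin e

noncomputable def eqB {a : ℕ} (T : (Fin n → Fin a) → Prop) (e : ℕ) :
    BT T e ≃ Fin (Nat.card (BT T e)) := Finite.equivFin _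

def dT {a : ℕ} {T : (Fin n → Fin a) → Prop} {e : ℕ} (δ : Fin e → Fin n → Fin a) :
    BT T e → Fin n → Fin a
  | .inl p => p.1.1
  | .inr x => δ x

open Classical in
noncomputable def vT {a : ℕ} (T : (Fin n → Fin a) → Prop) (e : ℕ) (c : Fin n → Fin a) : BT T e :=
  .inl ⟨(c, decide (¬ T c)), fun h => by simpa using h⟩

def uT {a : ℕ} (T : (Fin n → Fin a) → Prop) (e : ℕ) (c : Fin n → Fin a) : BT T e :=
  .inl ⟨(c, false), fun _ => rfl⟩

theorem uT_eq_vT {a : ℕ} (T : (Fin n → Fin a) → Prop) (e : ℕ) (c : Fin n → Fin a) :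
    uT T e c = vT T e c ↔ T c := by
  simp [uT, vT]

/-- Standard objects. -/
noncomputable def Std (a : ℕ) (T : (Fin n → Fin a) → Prop) (hT : ClosedT S n T) (e : ℕ)
    (δ : Fin e → Fin n → Fin a) : Code.{u} S n where
  a := a
  b := Nat.card (BT T e)
  d x := dT δ ((eqB T e).symm x)
  u c := eqB T e (uT T e c)
  v c := eqB T e (vT T e c)
  du c := by simp [uT, dT]
  dv c := by simp [vT, dT]
  closed := by
    have : (fun c => eqB T e (uT T e c) = eqB T e (vT T e c)) = T := by
      funext c
      rw [(eqB T e).injective.eq_iff, uT_eq_vT]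
    rw [this]
    exact hT

def outB {a : ℕ} {T : (Fin n → Fin a) → Prop} {e : ℕ} (P : Code.{u} S n)
    (φ : Fin a → Fin P.a) (ε : Fin e → Fin P.b) : BT T e → Fin P.b
  | .inl p => if p.1.2 then P.v (fun i => φ (p.1.1 i)) else P.u (fun i => φ (p.1.1 i))
  | .inr x => ε x

noncomputable def stdOut {a : ℕ} {T : (Fin n → Fin a) → Prop} {hT : ClosedT S n T} {e : ℕ}
    {δ : Fin e → Fin n → Fin a} (P : Code.{u} S n)
    (φ : Fin a → Fin P.a) (ε : Fin e → Fin P.b)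
    (hφ : ∀ c, T c → P.u (fun i => φ (c i)) = P.v (fun i => φ (c i)))
    (hε : ∀ x i, P.d (ε x) i = φ (δ x i)) : P ⟶ Std a T hT e δ :=
  homMk (Q := Std a T hT e δ) φ (fun x => outB P φ ε ((eqB T e).symm x))
    (by
      intro b i
      simp only [Std]
      rcases h : (eqB T e).symm b with p | x
      · simp only [outB, dT]
        split_ifs
        · rw [P.dv]
        · rw [P.du]
      · simp only [outB, dT, hε])
    (by
      intro c
      simp [Std, uT, outB])
    (by
      intro c
      simp only [Std, vT, outB, Equiv.symm_apply_apply]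
      by_cases h : T c
      · simp [h, hφ c h]
      · simp [h])

theorem closedT_true {K : Type} : ClosedT S n (fun _ : Fin n → K => True) :=
  fun _ _ _ _ _ => trivial

theorem closedT_false (hn : 0 < n) (hD : Diag S) {K : Type} :
    ClosedT S n (fun _ : Fin n → K => False) := by
  intro M hM σ φ h
  obtain ⟨j, -⟩ := hD.occurs hM (σ ⟨0, hn⟩)
  exact h j

/-- The test object. -/
noncomputable def QQ (S : Set Matr) (n : ℕ) : Code.{u} S n :=
  Std 2 (fun _ => True) closedT_true 1 (fun _ _ => 0)

open Classical in
noncomputable def toQ {R : Code.{u} S n} (φ : Fin R.a → Fin 2) (s : Fin R.b → Prop)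
    (hs : ∀ b, s b → ∀ i, φ (R.d b i) = 0) (hsu : ∀ c, ¬ s (R.u c)) (hsv : ∀ c, ¬ s (R.v c)) :
    (QQ.{u} S n) ⟶ R :=
  homMk (P := QQ S n) φ
    (fun b => eqB _ _ (if s b then .inr 0 else uT (fun _ => True) 1 (fun i => φ (R.d b i))))
    (by
      intro b i
      simp only [QQ, Std, Equiv.symm_apply_apply]
      split_ifs with h
      · exact (hs b h i).symm
      · rfl)
    (by
      intro c
      simp only [QQ, Std, hsu, if_false, R.du])
    (by
      intro c
      simp only [QQ, Std, hsv, if_false, R.dv]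
      rw [(uT_eq_vT _ _ _).2 trivial])

theorem fa_toQ {R : Code.{u} S n} (φ : Fin R.a → Fin 2) (s : Fin R.b → Prop) (hs hsu hsv)
    (x) : (fa (toQ φ s hs hsu hsv) x : Fin 2) = φ x := rfl

open Classical in
theorem fb_toQ {R : Code.{u} S n} (φ : Fin R.a → Fin 2) (s : Fin R.b → Prop) (hs hsu hsv)
    (b) : (fb (toQ φ s hs hsu hsv) b : Fin (Nat.card (BT (n := n) (a := 2) (fun _ => True) 1))) =
    eqB _ _ (if s b then .inr 0 else uT (fun _ => True) 1 (fun i => φ (R.d b i))) := rfl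

open Classical in
theorem joint {I : Type} {R X : Code.{u} S n} (p : I → (R ⟶ X))
    (hp : ∀ (Z : Code.{u} S n) (g h : Z ⟶ R), (∀ i, g ≫ p i = h ≫ p i) → g = h) :
    (∀ a, ∃ i x, fa (p i) x = a) ∧
    (∀ b, (∃ i x, fb (p i) x = b) ∨ (∃ c, R.u c = b) ∨ ∃ c, R.v c = b) := by
  constructor
  · intro a
    by_contra hne
    push Not at hne
    have := hp _ (toQ (fun x => if x = a then 1 else 0) (fun _ => False) (by simp) (by simp)
      (by simp)) (toQ (fun _ => 0) (fun _ => False) (by simp) (by simp) (by simp)) (by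
        intro i
        apply hom_ext
        · intro x
          rw [fa_comp, fa_comp]
          refine (fa_toQ _ _ _ _ _ _).trans (Eq.trans ?_ (fa_toQ _ _ _ _ _ _).symm)
          exact if_neg (hne i x)
        · intro x
          rw [fb_comp, fb_comp]
          have : ∀ k, R.d (fb (p i) x) k ≠ a := fun k => by rw [fhd]; exact hne _ _
          refine (fb_toQ _ _ _ _ _ _).trans (Eq.trans ?_ (fb_toQ _ _ _ _ _ _).symm)
          simp only [this, if_false]
          rfl)
    have h2 := congrArg (fun f => fa f a) this
    have h3 := (fa_toQ _ _ _ _ _ _).symm.trans (h2.trans (fa_toQ _ _ _ _ _ _))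
    rw [if_pos rfl] at h3
    have h4 : (1 : Fin 2) = 0 := h3
    exact absurd h4 (by decide)
  · intro b
    by_contra hne
    push Not at hne
    obtain ⟨h1, h2, h3⟩ := hne
    have := hp _ (toQ (fun _ => 0) (fun x => x = b) (by simp) h2 h3)
      (toQ (fun _ => 0) (fun _ => False) (by simp) (by simp) (by simp)) (by
        intro i
        apply hom_ext
        · intro x
          rfl
        · intro x
          rw [fb_comp, fb_comp]
          have := h1 i x
          refine (fb_toQ _ _ _ _ _ _).trans (Eq.trans ?_ (fb_toQ _ _ _ _ _ _).symm)
          simp only [this, if_false]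
          rfl)
    have h2 := congrArg (fun f => fb f b) this
    have h3 := (fb_toQ _ _ _ _ _ _).symm.trans (h2.trans (fb_toQ _ _ _ _ _ _))
    have h4 := (eqB _ _).injective h3
    simp [uT] at h4

theorem code_closed (hD : Diag S) :
    Matr.HasSClosedRels S (Code.{u} S n) (MorphismProperty.monomorphisms (Code.{u} S n)) := by
  intro M hM X P R pr hP r hr Z f hl
  have hmono : Mono r := hr
  have hpr : ∀ (Z' : Code.{u} S n) (x : Fin M.n → (Z' ⟶ X)) i,
      hP.lift (Fan.mk Z' x) ≫ pr i = x i := fun Z' x i => hP.fac _ ⟨i⟩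
  have hPext : ∀ (Z' : Code.{u} S n) (a b : Z' ⟶ P), (∀ i, a ≫ pr i = b ≫ pr i) → a = b :=
    fun Z' a b h => hP.hom_ext (fun ⟨i⟩ => h i)
  let p : Fin M.n → (R ⟶ X) := fun i => r ≫ pr i
  obtain ⟨jA, jB⟩ := joint p (by
    intro Z' g h hh
    rw [← cancel_mono r]
    apply hPext
    intro i
    simpa [p] using hh i)
  choose g hg using hl
  have hgp : ∀ j i, g j ≫ p i = f (M.left i j) := by
    intro j i
    simp only [p]
    rw [← Category.assoc, hg, hpr]
  have hgA : ∀ j i x, fa (g j) (fa (p i) x) = fa (f (M.left i j)) x := by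
    intro j i x
    rw [← hgp j i]; rfl
  have hgB : ∀ j i x, fb (g j) (fb (p i) x) = fb (f (M.left i j)) x := by
    intro j i x
    rw [← hgp j i]; rfl
  choose iA xA hA using jA
  let gA : Fin R.a → Fin Z.a := fun a => fa (f (M.right (iA a))) (xA a)
  have gA_spec : ∀ i x, gA (fa (p i) x) = fa (f (M.right i)) x := by
    intro i x
    refine hD.gen hM _ _ (fun l => fa (f l) (xA (fa (p i) x))) (fun l => fa (f l) x) ?_
    intro j
    rw [← hgA, ← hgA, hA]
  have xu : ∀ q x c, fb (p q) x = R.u c → fb (f (M.right q)) x = Z.u (fun i => gA (c i)) := by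
    intro q x c h
    obtain ⟨j, hj⟩ := hD.occurs hM q
    have h1 : ∀ i, c i = fa (p q) (X.d x i) := by
      intro i
      rw [← fhd, h, R.du]
    rw [← hj, ← hgB, h, fhu]
    congr 1
    funext i
    rw [h1, gA_spec, hgA, hj]
  have xv : ∀ q x c, fb (p q) x = R.v c → fb (f (M.right q)) x = Z.v (fun i => gA (c i)) := by
    intro q x c h
    obtain ⟨j, hj⟩ := hD.occurs hM q
    have h1 : ∀ i, c i = fa (p q) (X.d x i) := by
      intro i
      rw [← fhd, h, R.dv]
    rw [← hj, ← hgB, h, fhv]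
    congr 1
    funext i
    rw [h1, gA_spec, hgA, hj]
  have uv : ∀ c c', R.u c = R.v c' → Z.u (fun i => gA (c i)) = Z.v (fun i => gA (c' i)) := by
    intro c c' h
    have hcc : c = c' := by rw [← R.du c, h, R.dv]
    subst hcc
    refine Z.closed M hM (fun i => iA (c i)) (fun i l => fa (f l) (xA (c i))) ?_
    intro j
    have h1 : (fun i => fa (f (M.left (iA (c i)) j)) (xA (c i))) = fun i => fa (g j) (c i) := by
      funext i
      rw [← hgA, hA]
    simp only [h1]
    rw [← fhu, ← fhv, h]
  have hB : ∀ b, ∃ b', (∀ i x, fb (p i) x = b → fb (f (M.right i)) x = b') ∧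
      (∀ c, R.u c = b → Z.u (fun i => gA (c i)) = b') ∧
      (∀ c, R.v c = b → Z.v (fun i => gA (c i)) = b') := by
    intro b
    rcases jB b with ⟨i, x, h⟩ | ⟨c, h⟩ | ⟨c, h⟩
    · refine ⟨fb (f (M.right i)) x, ?_, ?_, ?_⟩
      · intro i' x' h'
        refine hD.gen hM _ _ (fun l => fb (f l) x') (fun l => fb (f l) x) ?_
        intro j
        rw [← hgB, ← hgB, h, h']
      · intro c hc
        exact (xu i x c (h.trans hc.symm)).symm
      · intro c hc
        exact (xv i x c (h.trans hc.symm)).symm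
    · refine ⟨Z.u (fun i => gA (c i)), ?_, ?_, ?_⟩
      · intro i' x' h'
        exact xu _ _ _ (h'.trans h.symm)
      · intro c' hc
        have : c' = c := by rw [← R.du c', hc, ← h, R.du]
        rw [this]
      · intro c' hc
        exact (uv _ _ (h.trans hc.symm)).symm
    · refine ⟨Z.v (fun i => gA (c i)), ?_, ?_, ?_⟩
      · intro i' x' h'
        exact xv _ _ _ (h'.trans h.symm)
      · intro c' hc
        exact uv _ _ (hc.trans h.symm)
      · intro c' hc
        have : c' = c := by rw [← R.dv c', hc, ← h, R.dv]
        rw [this]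
  choose gB hB1 hB2 hB3 using hB
  refine ⟨homMk gA gB ?_ (fun c => (hB2 _ c rfl).symm) (fun c => (hB3 _ c rfl).symm), ?_⟩
  · intro b k
    rcases jB b with ⟨i, x, h⟩ | ⟨c, h⟩ | ⟨c, h⟩
    · rw [← hB1 b i x h, fhd, ← h, fhd, gA_spec]
    · rw [← hB2 b c h, Z.du, ← h, R.du]
    · rw [← hB3 b c h, Z.dv, ← h, R.dv]
  · apply hPext
    intro i
    rw [hpr, Category.assoc]
    apply hom_ext
    · intro x
      exact gA_spec i x
    · intro x
      exact (hB1 _ i x rfl).symm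

theorem exists_quot {X : Type} [Finite X] (s : Setoid X) :
    ∃ (m : ℕ) (π : X → Fin m), Function.Surjective π ∧ ∀ x y, π x = π y ↔ s x y := by
  let e : Quotient s ≃ Fin (Nat.card (Quotient s)) := Finite.equivFin _
  refine ⟨_, fun x => e (Quotient.mk s x), ?_, ?_⟩
  · exact e.surjective.comp Quotient.mk_surjective
  · intro x y
    rw [e.injective.eq_iff, Quotient.eq]

theorem exists_lift {X Y W : Type} {π : X → Y} (hπ : Function.Surjective π) (g : X → W)
    (h : ∀ x y, π x = π y → g x = g y) : ∃ g' : Y → W, ∀ x, g' (π x) = g x :=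
  ⟨fun y => g (hπ y).choose, fun x => h _ _ (hπ (π x)).choose_spec⟩

section limits
variable {J : Type} [SmallCategory J] (F : J ⥤ Code.{u} S n)

inductive RelA : (Σ j, Fin (F.obj j).a) → (Σ j, Fin (F.obj j).a) → Prop
  | glue {j j' : J} (f : j ⟶ j') (x : Fin (F.obj j').a) : RelA ⟨j', x⟩ ⟨j, fa (F.map f) x⟩

/-- Generators of the `B`-part. -/
abbrev GenB (m : ℕ) : Type := (Σ j, Fin (F.obj j).b) ⊕ ((Fin n → Fin m) ⊕ (Fin n → Fin m))

inductive RelB {m : ℕ} (π : (Σ j, Fin (F.obj j).a) → Fin m) : GenB F m → GenB F m → Prop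
  | refl (x) : RelB π x x
  | symm (x y) : RelB π x y → RelB π y x
  | trans (x y z) : RelB π x y → RelB π y z → RelB π x z
  | glue {j j' : J} (f : j ⟶ j') (x : Fin (F.obj j').b) :
      RelB π (.inl ⟨j', x⟩) (.inl ⟨j, fb (F.map f) x⟩)
  | uglue (j : J) (c : Fin n → Fin (F.obj j).a) :
      RelB π (.inl ⟨j, (F.obj j).u c⟩) (.inr (.inl (fun i => π ⟨j, c i⟩)))
  | vglue (j : J) (c : Fin n → Fin (F.obj j).a) :
      RelB π (.inl ⟨j, (F.obj j).v c⟩) (.inr (.inr (fun i => π ⟨j, c i⟩)))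
  | closed (M : Matr) (hM : M ∈ S) (σ : Fin n → Fin M.n) (φ : Fin n → Fin M.k → Fin m)
      (h : ∀ j, RelB π (.inr (.inl (fun i => φ i (M.left (σ i) j))))
        (.inr (.inr (fun i => φ i (M.left (σ i) j))))) :
      RelB π (.inr (.inl (fun i => φ i (M.right (σ i)))))
        (.inr (.inr (fun i => φ i (M.right (σ i)))))

def genD {m : ℕ} (π : (Σ j, Fin (F.obj j).a) → Fin m) : GenB F m → Fin n → Fin m
  | .inl x => fun i => π ⟨x.1, (F.obj x.1).d x.2 i⟩
  | .inr (.inl c) => c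
  | .inr (.inr c) => c

def genDesc {m : ℕ} (P : Code.{u} S n) (h : Fin m → Fin P.a)
    (k : ∀ j, Fin (F.obj j).b → Fin P.b) : GenB F m → Fin P.b
  | .inl x => k x.1 x.2
  | .inr (.inl c) => P.u (fun i => h (c i))
  | .inr (.inr c) => P.v (fun i => h (c i))

theorem hasLimit [FinCategory J] : HasLimit F := by
  obtain ⟨m, π, hπ, hker⟩ := exists_quot (Relation.EqvGen.setoid (RelA F))
  have hglue : ∀ {j j' : J} (f : j ⟶ j') x, π ⟨j', x⟩ = π ⟨j, fa (F.map f) x⟩ := fun f x =>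
    (hker _ _).2 (Relation.EqvGen.rel _ _ (RelA.glue f x))
  obtain ⟨l, ρ, hρ, hkerB⟩ := exists_quot (X := GenB F m)
    ⟨RelB F π, RelB.refl, fun h => RelB.symm _ _ h, fun h h' => RelB.trans _ _ _ h h'⟩
  have hkerB' : ∀ x y, ρ x = ρ y ↔ RelB F π x y := hkerB
  obtain ⟨d, hd⟩ := exists_lift hρ (genD F π) (by
    intro x y h
    rw [hkerB'] at h
    induction h with
    | refl x => rfl
    | symm x y _ ih => exact ih.symm
    | trans x y z _ _ ih ih' => exact ih.trans ih'
    | glue f x =>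
      funext i
      simp only [genD]
      rw [hglue f, fhd]
    | uglue j c => simp only [genD, (F.obj j).du]
    | vglue j c => simp only [genD, (F.obj j).dv]
    | closed M hM σ φ h ih => rfl)
  let L : Code.{u} S n :=
    { a := m
      b := l
      d := d
      u := fun c => ρ (.inr (.inl c))
      v := fun c => ρ (.inr (.inr c))
      du := fun c => by rw [hd]; rfl
      dv := fun c => by rw [hd]; rfl
      closed := by
        intro M hM σ φ h
        exact (hkerB' _ _).2 (RelB.closed M hM σ φ (fun j => (hkerB' _ _).1 (h j))) }
  let leg : ∀ j, L ⟶ F.obj j := fun j => homMk (P := L) (fun x => π ⟨j, x⟩)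
    (fun x => ρ (.inl ⟨j, x⟩))
    (fun b i => by simp only [L, hd, genD])
    (fun c => (hkerB' _ _).2 (RelB.uglue j c))
    (fun c => (hkerB' _ _).2 (RelB.vglue j c))
  let cone : Cone F :=
    { pt := L
      π :=
        { app := leg
          naturality := by
            intro j j' f
            dsimp
            rw [Category.id_comp]
            apply hom_ext
            · intro x
              exact hglue f x
            · intro x
              exact (hkerB' _ _).2 (RelB.glue f x) } }
  have hw : ∀ (s : Cone F) {j j' : J} (f : j ⟶ j'), s.π.app j ≫ F.map f = s.π.app j' :=
    fun s _ _ f => s.w f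
  have hex : ∀ s : Cone F, ∃ g : s.pt ⟶ L, ∀ j, g ≫ leg j = s.π.app j := by
    intro s
    obtain ⟨hA, hhA⟩ := exists_lift hπ (fun x => fa (s.π.app x.1) x.2) (by
      intro x y h
      have h' : Relation.EqvGen (RelA F) x y := (hker _ _).1 h
      clear h
      induction h' with
      | rel x y h =>
        obtain ⟨f, x⟩ := h
        simp only
        rw [← hw s f, fa_comp]
      | refl x => rfl
      | symm x y _ ih => exact ih.symm
      | trans x y z _ _ ih ih' => exact ih.trans ih')
    obtain ⟨hB, hhB⟩ := exists_lift hρ (genDesc F s.pt hA (fun j => fb (s.π.app j))) (by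
      intro x y h
      rw [hkerB'] at h
      induction h with
      | refl x => rfl
      | symm x y _ ih => exact ih.symm
      | trans x y z _ _ ih ih' => exact ih.trans ih'
      | glue f x =>
        simp only [genDesc]
        rw [← hw s f, fb_comp]
      | uglue j c => simp only [genDesc, hhA]; exact fhu _ _
      | vglue j c => simp only [genDesc, hhA]; exact fhv _ _
      | closed M hM σ φ h ih =>
        exact s.pt.closed M hM σ (fun i l => hA (φ i l)) ih)
    refine ⟨homMk (Q := L) hA hB ?_ ?_ ?_, ?_⟩
    · intro b i
      obtain ⟨x, rfl⟩ := hρ b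
      simp only [L, hd, hhB]
      rcases x with x | c | c
      · simp only [genDesc, genD, hhA]
        exact fhd _ _ _
      · simp only [genDesc, genD, s.pt.du]
      · simp only [genDesc, genD, s.pt.dv]
    · intro c
      exact hhB _
    · intro c
      exact hhB _
    · intro j
      apply hom_ext
      · intro x
        exact hhA _
      · intro x
        exact hhB _
  choose lift hlift using hex
  refine ⟨⟨⟨cone, ⟨lift, hlift, ?_⟩⟩⟩⟩
  intro s g hg
  have hg' : ∀ j, g ≫ leg j = lift s ≫ leg j := fun j => (hg j).trans (hlift s j).symm
  have hA : ∀ x, fa g x = fa (lift s) x := by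
    intro x
    obtain ⟨⟨j, x⟩, rfl⟩ := hπ x
    exact congrArg (fun h => fa h x) (hg' j)
  apply hom_ext
  · exact hA
  · intro x
    obtain ⟨x, rfl⟩ := hρ x
    rcases x with ⟨j, x⟩ | c | c
    · exact congrArg (fun h => fb h x) (hg' j)
    · have h1 := fhu g c
      have h2 := fhu (lift s) c
      simp only [hA] at h1
      exact h1.trans h2.symm
    · have h1 := fhv g c
      have h2 := fhv (lift s) c
      simp only [hA] at h1
      exact h1.trans h2.symm

end limits

instance codeLex (S : Set Matr) (n : ℕ) : HasFiniteLimits (Code.{u} S n) :=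
  ⟨fun _ _ _ => ⟨fun F => hasLimit F⟩⟩

end

theorem code_not_closed (S : Set Matr) (N : Matr) (hD : Diag S) (hN : ¬ Cl_s16 S N N.right) :
    ¬ Matr.HasClosedRels N (Code.{u} S N.n) (strongMonos (Code.{u} S N.n)) := by
  intro hC
  let X : Code.{u} S N.n := Std 1 (fun _ => False) (closedT_false N.npos hD) 0 Fin.elim0
  let Y : Code.{u} S N.n := Std N.n (fun _ => False) (closedT_false N.npos hD) 1 (fun _ i => i)
  let Z : Code.{u} S N.n := Std N.k (Cl_s16 S N) (fun M hM σ φ h => Cl_s16.step M hM σ φ h) 0 Fin.elim0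
  let P : Code.{u} S N.n := ∏ᶜ fun _ : Fin N.n => X
  let pr : Fin N.n → (P ⟶ X) := Pi.π (fun _ : Fin N.n => X)
  let hP : IsLimit (Fan.mk P pr) := productIsProduct (fun _ : Fin N.n => X)
  have hpr : ∀ (Z' : Code.{u} S N.n) (x : Fin N.n → (Z' ⟶ X)) i,
      hP.lift (Fan.mk Z' x) ≫ pr i = x i := fun Z' x i => hP.fac _ ⟨i⟩
  let pt : Fin X.a := (0 : Fin 1)
  let a : Fin N.n → Fin P.a := fun i => fa (pr i) pt
  let α : P ⟶ Y := stdOut P a (fun _ => P.u a) (fun _ h => h.elim) (fun _ i => by rw [P.du])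
  let β : P ⟶ Y := stdOut P a (fun _ => P.v a) (fun _ h => h.elim) (fun _ i => by rw [P.dv])
  let f : Fin N.k → (Z ⟶ X) := fun l => stdOut Z (fun _ => l) Fin.elim0 (fun _ h => h.elim)
    (fun x => x.elim0)
  let col : (Fin N.n → Fin N.k) → (Z ⟶ P) := fun c => hP.lift (Fan.mk Z (fun i => f (c i)))
  have hcol : ∀ c i, fa (col c) (a i) = c i := by
    intro c i
    have := congrArg (fun h => fa h pt) (hpr Z (fun i => f (c i)) i)
    exact this
  have hZ : ∀ c, Z.u c = Z.v c ↔ Cl_s16 S N c := by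
    intro c
    exact ((eqB (Cl_s16 S N) 0).injective.eq_iff).trans (uT_eq_vT _ _ _)
  let y : Fin Y.b := eqB (fun _ : Fin N.n → Fin N.n => False) 1 (.inr 0)
  have hα : fb α y = P.u a := by
    simp [α, y, fb, stdOut, homMk, outB]
  have hβ : fb β y = P.v a := by
    simp [β, y, fb, stdOut, homMk, outB]
  have hiff : ∀ c, col c ≫ α = col c ≫ β ↔ Cl_s16 S N c := by
    intro c
    have hu : fb (col c) (P.u a) = Z.u c := by rw [fhu]; simp only [hcol]
    have hv : fb (col c) (P.v a) = Z.v c := by rw [fhv]; simp only [hcol]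
    refine Iff.trans ?_ (hZ c)
    constructor
    · intro h
      have := congrArg (fun h => fb h y) h
      simp only [fb_comp, hα, hβ, hu, hv] at this
      exact this
    · intro h
      apply hom_ext
      · intro x
        rfl
      · intro x
        rw [fb_comp, fb_comp]
        simp only [α, β, fb, stdOut, homMk]
        rcases (eqB (fun _ : Fin N.n → Fin N.n => False) 1).symm x with p | z
        · rfl
        · simp only [outB]
          exact hu.trans (h.trans hv.symm)
  obtain ⟨g, hg⟩ := hC X P _ pr hP (equalizer.ι α β) (show StrongMono _ from inferInstance) Z f (by
    intro j
    have hj := (hiff _).2 (Cl_s16.base (S := S) (N := N) j)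
    exact ⟨equalizer.lift _ hj, equalizer.lift_ι _ hj⟩)
  apply hN
  rw [← hiff]
  have hg' : g ≫ equalizer.ι α β = col N.right := hg
  rw [← hg', Category.assoc, Category.assoc, equalizer.condition]

theorem mono_to_strong {C : Type u} [Category.{v} C] (S : Set Matr)
    (h : Matr.HasSClosedRels S C (MorphismProperty.monomorphisms C)) :
    Matr.HasSClosedRels S C (strongMonos C) := by
  intro M hM X P R pr hP r hr
  exact h M hM X P R pr hP r (StrongMono.mono (self := hr))

end LexAux

/-- For a set `S` of non-pointed matrices and a non-pointed
matrix `N` with at least one left column (`0 < N.m`), every finitely complete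
category with `S`-closed relations has `N`-closed relations (`S ⇒_lex N`) if
and only if every finitely complete category with `S`-closed strong relations
has `N`-closed strong relations (`S ⇒_lex^strong N`). -/
theorem lexImp_iff_strong_lexImp (S : Set Matr) (N : Matr) (hm : 0 < N.m) :
    (∀ (C : Type u) [Category.{v} C] [HasFiniteLimits C],
        Matr.HasSClosedRels S C (MorphismProperty.monomorphisms C) →
        Matr.HasClosedRels N C (MorphismProperty.monomorphisms C)) ↔
    (∀ (C : Type u) [Category.{v} C] [HasFiniteLimits C],
        Matr.HasSClosedRels S C (strongMonos C) →
        Matr.HasClosedRels N C (strongMonos C)) := by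
  by_cases hD : LexAux.Diag S
  · by_cases hN : LexAux.Cl_s16 S N N.right
    · constructor
      · intro _ C _ _ hS
        exact LexAux.positive _ (fun h hr => LexAux.strongMono_of_isPullback h hr) S N hN hS
      · intro _ C _ _ hS
        exact LexAux.positive _ (fun h hr => MorphismProperty.of_isPullback h hr) S N hN hS
    · constructor
      · intro h
        refine absurd ?_ (LexAux.code_not_closed.{u, v} S N hD hN)
        intro X P R pr hP r hr
        exact h (LexAux.Code.{u} S N.n) (LexAux.code_closed hD) X P R pr hP r
          (StrongMono.mono (self := hr))
      · intro h
        exact absurd (h (LexAux.Code.{u} S N.n)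
          (LexAux.mono_to_strong _ (LexAux.code_closed hD)))
          (LexAux.code_not_closed.{u, v} S N hD hN)
  · constructor
    · intro _ C _ _ hS
      exact LexAux.closed_of_collapse N hm _ (LexAux.collapse S hD hS)
    · intro _ C _ _ hS
      exact LexAux.closed_of_collapse N hm _
        (LexAux.collapse S hD (LexAux.mono_to_strong _ hS))
end
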